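/- For every natural number n with n ≤ 9, and also for n = 11, every ordered tree on n vertices admits an L-shaped embedding in every point set of n points. -/

import Mathlib

/-- A point set: finitely many points in the plane, no two of which share
an x-coordinate or a y-coordinate. -/
def IsPointSet (S : Finset (ℝ × ℝ)) : Prop :=
  ∀ p ∈ S, ∀ q ∈ S, p ≠ q → p.1 ≠ q.1 ∧ p.2 ≠ q.2

/-- The drawing of the edge `uv`: the union of the two axis-parallel segments
joining `φ u` and `φ v` through the corner point `c u v`. -/
def LDraw {α : Type*} (φ : α → ℝ × ℝ) (c : α → α → ℝ × ℝ) (u v : α) : Set (ℝ × ℝ) :=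
  segment ℝ (φ u) (c u v) ∪ segment ℝ (c u v) (φ v)

/-- `φ` together with the corner assignment `c` is an L-shaped embedding of the
graph `G` in the point set `S`:  `φ` is an injective map of the vertices into `S`,
every edge `uv` is drawn as an `L` whose corner is `((φ u).1, (φ v).2)` or
`((φ v).1, (φ u).2)`, and the drawings of two distinct edges intersect only in the
image `φ w` of a common endpoint `w` of the two edges. -/
def IsLEmbedding {α : Type*} (G : SimpleGraph α) (S : Finset (ℝ × ℝ))
    (φ : α → ℝ × ℝ) (c : α → α → ℝ × ℝ) : Prop :=
  Function.Injective φ ∧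
  (∀ v, φ v ∈ S) ∧
  (∀ u v, c u v = c v u) ∧
  (∀ u v, G.Adj u v → c u v = ((φ u).1, (φ v).2) ∨ c u v = ((φ v).1, (φ u).2)) ∧
  (∀ u v a b, G.Adj u v → G.Adj a b → s(u, v) ≠ s(a, b) →
    ∀ p ∈ LDraw φ c u v ∩ LDraw φ c a b,
      ∃ w, (w = u ∨ w = v) ∧ (w = a ∨ w = b) ∧ p = φ w)

/-- `G` admits an L-shaped embedding in the point set `S`. -/
def HasLEmbedding {α : Type*} (G : SimpleGraph α) (S : Finset (ℝ × ℝ)) : Prop :=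
  ∃ φ c, IsLEmbedding G S φ c

/-- The direction (0 = right, 1 = up, 2 = left, 3 = down, i.e. counterclockwise order)
in which the initial segment of the drawn edge from `v` towards `u` leaves `φ v`. -/
noncomputable def dirOf {α : Type*} (φ : α → ℝ × ℝ) (c : α → α → ℝ × ℝ) (v u : α) : Fin 4 :=
  if (c v u).2 = (φ v).2 then (if (φ v).1 < (φ u).1 then 0 else 2)
  else (if (φ v).2 < (φ u).2 then 1 else 3)

/-- An ordered tree: a tree with maximum degree at most 4, together with, for every
vertex `v`, a list `ord v` of its neighbors prescribing their counterclockwise cyclic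
order (the list is understood up to cyclic rotation). -/
def IsOrderedTree {α : Type*} (G : SimpleGraph α) (ord : α → List α) : Prop :=
  G.IsTree ∧ ∀ v, (ord v).Nodup ∧ (ord v).length ≤ 4 ∧ (∀ u, u ∈ ord v ↔ G.Adj v u)

/-- The L-shaped embedding `(φ, c)` respects the prescribed cyclic neighbor orders `ord`:
around each vertex `v`, some cyclic rotation of `ord v` lists the neighbors in strictly
increasing (i.e. counterclockwise) order of the directions in which their edges leave `φ v`. -/
def RespectsOrder {α : Type*} (φ : α → ℝ × ℝ) (c : α → α → ℝ × ℝ) (ord : α → List α) : Prop :=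
  ∀ v, ∃ L ∈ (ord v).cyclicPermutations,
    List.Chain' (· < ·) (L.map fun u => dirOf φ c v u)


/-! ### Kernel-friendly checker -/

namespace LTree

/-- Boolean conjunction, by recursion on the first argument. -/
def band (a b : Bool) : Bool := Bool.rec false b a

/-- `if b then x else y` by recursion on `b`. -/
def bsel {α : Type} (b : Bool) (x y : α) : α := Bool.rec y x b

/-- `k`-th bit of `m`. -/
def tb (m k : ℕ) : Bool := Nat.beq (Nat.land (Nat.shiftRight m k) 1) 1

/-- `i`-th hexadecimal digit of `m`. -/
def nib (m i : ℕ) : ℕ := Nat.land (Nat.shiftRight m (Nat.mul 4 i)) 15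

/-- conjunction of `f i` over `i < n`. -/
def allN (n : ℕ) (f : ℕ → Bool) : Bool := Nat.rec true (fun i ih => band (f i) ih) n

/-- bitwise or of `f i` over `i < n`. -/
def orN (n : ℕ) (f : ℕ → ℕ) : ℕ := Nat.rec 0 (fun i ih => Nat.lor (f i) ih) n

/-- bitwise or of `f j` over `j ∈ l`. -/
def orL (l : List ℕ) (f : ℕ → ℕ) : ℕ := List.rec 0 (fun j _ ih => Nat.lor (f j) ih) l

/-- map of a list, by the recursor. -/
def mapL (f : ℕ → ℕ) (l : List ℕ) : List ℕ := List.rec [] (fun j _ ih => f j :: ih) l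

/-- decode a row: hexadecimal digits `d+1`, terminated by `0`. -/
def decode (fuel : ℕ) : ℕ → List ℕ :=
  Nat.rec (fun _ => []) (fun _ ih r =>
    Nat.rec [] (fun k _ => k :: ih (Nat.shiftRight r 4)) (Nat.land r 15)) fuel

/-- neighbour list of `i` in the packed table `M`. -/
def nbL (M i : ℕ) : List ℕ := decode 4 (Nat.land (Nat.shiftRight M (Nat.mul 16 i)) 65535)

/-- the values `f 0, …, f (n-1)` are a permutation of `0, …, n-1`. -/
def permOK (n : ℕ) (f : ℕ → ℕ) : Bool :=
  Nat.beq (orN n fun i => Nat.shiftLeft 1 (f i)) (Nat.sub (Nat.pow 2 n) 1)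

/-- entry `(i,j)` of a bit matrix. -/
def ent (M i j : ℕ) : Bool := tb M (Nat.add (Nat.mul 16 i) j)

/-- row `i` of a bit matrix. -/
def row (M i : ℕ) : ℕ := Nat.land (Nat.shiftRight M (Nat.mul 16 i)) 65535

/-- mask of column zero. -/
def colMask : ℕ := 1766874025136433896750911497805568136923323180981774075523881651146915841

/-- column `i` of a bit matrix, spread out with stride 16. -/
def col (M i : ℕ) : ℕ := Nat.land (Nat.shiftRight M i) colMask

/-- add the relation `i → j` to a transitive relation. -/
def addRel (n M i j : ℕ) : ℕ :=
  Nat.lor M (orN n fun a => bsel (bsel (Nat.beq a i) true (ent M a i))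
    (Nat.shiftLeft (Nat.lor (row M j) (Nat.shiftLeft 1 j)) (Nat.mul 16 a)) 0)

/-- columns possibly met by a horizontal arm in row `r` between columns `p` and `q`. -/
def hT (U D p q r : ℕ) : ℕ :=
  Nat.shiftLeft (Nat.xor 65535 (Nat.lor
    (Nat.lor (Nat.land (row U p) (row U q)) (Nat.land (row D p) (row D q)))
    (Nat.lor (Nat.shiftLeft 1 p) (Nat.shiftLeft 1 q)))) (Nat.mul 16 r)

/-- rows possibly met by a vertical arm in column `k` between rows `p` and `q`. -/
def vT (U D p q k : ℕ) : ℕ :=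
  Nat.shiftLeft (Nat.xor colMask (Nat.lor
    (Nat.lor (Nat.land (col U p) (col U q)) (Nat.land (col D p) (col D q)))
    (Nat.lor (Nat.shiftLeft 1 (Nat.mul 16 p)) (Nat.shiftLeft 1 (Nat.mul 16 q))))) k

/-- does the edge `ij` leave `i` horizontally? -/
def horN (v i j : ℕ) : Bool :=
  bsel (Nat.ble j i) (bsel (tb v (Nat.add 44 i)) false true) (tb v (Nat.add 44 j))

/-- known direction code. -/
def sgn (U D p q a b c : ℕ) : ℕ := bsel (ent U p q) a (bsel (ent D p q) b c)

/-- direction code of the port of `i` towards `j`. -/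
def pcode (XU XD YU YD v i j : ℕ) : ℕ :=
  bsel (horN v i j) (sgn XU XD (nib v i) (nib v j) 0 2 4) (sgn YU YD (nib v i) (nib v j) 1 3 5)

/-- both values are known directions. -/
def lt4 (a : ℕ) : Bool := Nat.ble a 3

/-- counterclockwise step from `a` to `b`. -/
def step (a b : ℕ) : ℕ := Nat.mod (Nat.sub (Nat.add b 4) a) 4

/-- the ports are in counterclockwise order. -/
def portsOK : List ℕ → Bool
  | [] => true
  | [_] => true
  | [a, b] => bsel (Nat.beq (Nat.mod a 2) (Nat.mod b 2))
      (band (lt4 a) (band (lt4 b) (bsel (Nat.beq a b) false true))) true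
  | [a, b, c] => band (lt4 a) (band (lt4 b) (band (lt4 c) (band (Nat.ble 1 (step a b))
      (band (Nat.ble 1 (step b c)) (Nat.ble (Nat.add (step a b) (step b c)) 3)))))
  | [a, b, c, d] => band (lt4 a) (band (lt4 b) (band (lt4 c) (band (lt4 d)
      (band (Nat.beq (step a b) 1) (band (Nat.beq (step b c) 1) (Nat.beq (step c d) 1))))))
  | _ => false

/-- all horizontal arms. -/
def hMat (n M XU XD v : ℕ) : ℕ :=
  orN n fun i => orL (nbL M i) fun j => bsel (Nat.ble j i) 0
    (hT XU XD (nib v i) (nib v j) (bsel (tb v (Nat.add 44 j)) (nib v i) (nib v j)))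

/-- all vertical arms. -/
def vMat (n M YU YD v : ℕ) : ℕ :=
  orN n fun i => orL (nbL M i) fun j => bsel (Nat.ble j i) 0
    (vT YU YD (nib v i) (nib v j) (bsel (tb v (Nat.add 44 j)) (nib v j) (nib v i)))

/-- check of a leaf of the decision tree. -/
def leafOK (n M v XU XD YU YD : ℕ) : Bool :=
  band (permOK n (nib v))
    (band (Nat.beq (Nat.land (hMat n M XU XD v) (vMat n M YU YD v)) 0)
      (allN n fun i => portsOK (mapL (pcode XU XD YU YD v i) (nbL M i))))

/-- Decision trees: leaves carry an assignment of names and bend bits, inner nodes compare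
two coordinates. -/
inductive DT : Type
  | L (v : ℕ) : DT
  | Q (q : ℕ) (y z : DT) : DT

/-- check of a decision tree. -/
noncomputable def chkDT (n M : ℕ) (t : DT) : ℕ → ℕ → ℕ → ℕ → Bool :=
  DT.rec (fun v XU XD YU YD => leafOK n M v XU XD YU YD)
    (fun q _ _ ihy ihz XU XD YU YD =>
      band (Nat.blt (nib q 1) n) (band (Nat.blt (nib q 0) n)
        (bsel (Nat.beq (nib q 1) (nib q 0)) false
          (bsel (Nat.beq (nib q 2) 0)
            (band (ihy (addRel n XU (nib q 1) (nib q 0)) (addRel n XD (nib q 0) (nib q 1)) YU YD)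
              (ihz (addRel n XU (nib q 0) (nib q 1)) (addRel n XD (nib q 1) (nib q 0)) YU YD))
            (band (ihy XU XD (addRel n YU (nib q 1) (nib q 0)) (addRel n YD (nib q 0) (nib q 1)))
              (ihz XU XD (addRel n YU (nib q 0) (nib q 1)) (addRel n YD (nib q 1) (nib q 0))))))))
    t

/-- relation known from the naming of the points. -/
def known (ds lo hi a b : ℕ) : Bool :=
  bsel (Nat.blt a b) (Nat.beq (nib ds a) lo) (bsel (Nat.blt b a) (Nat.beq (nib ds b) hi) false)

/-- initial matrix. -/
def initMat (n ds lo hi : ℕ) : ℕ :=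
  orN n fun a => orN n fun b => bsel (known ds lo hi a b)
    (Nat.shiftLeft 1 (Nat.add (Nat.mul 16 a) b)) 0

/-- A certificate: tree table, naming directions, decision tree. -/
structure Cert : Type where
  M : ℕ
  ds : ℕ
  t : DT

/-- check of a certificate. -/
noncomputable def certOK (n : ℕ) (c : Cert) : Bool :=
  chkDT n c.M c.t (initMat n c.ds 2 0) (initMat n c.ds 0 2) (initMat n c.ds 3 1)
    (initMat n c.ds 1 3)

/-- check of a list of certificates. -/
noncomputable def certsOK (n : ℕ) (l : List Cert) : Bool :=
  List.rec true (fun c _ ih => band (certOK n c) ih) l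

/-- equality of lists. -/
def eqL : List ℕ → List ℕ → Bool
  | [], [] => true
  | a :: l, b :: m => band (Nat.beq a b) (eqL l m)
  | _, _ => false

/-- rotate by one. -/
def rot1 (l : List ℕ) : List ℕ := List.rec [] (fun a t _ => t ++ [a]) l

/-- equality up to rotation. -/
def rotEq (k : ℕ) : List ℕ → List ℕ → Bool :=
  Nat.rec (fun l m => eqL l m) (fun _ ih l m => bsel (eqL l m) true (ih (rot1 l) m)) k

/-- check that the table `M`, read through `τ` is the tree given by the rows `rows`. -/
def rowsOK (M τ : ℕ) (mir : Bool) (rows : List (List ℕ)) : ℕ → Bool :=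
  List.rec (fun _ => true)
    (fun r _ ih i => band (rotEq 3 (bsel mir (mapL (nib τ) r).reverse (mapL (nib τ) r))
      (nbL M (nib τ i))) (ih (Nat.succ i))) rows

/-- check of a hint. -/
def hintOK (n : ℕ) (l : List Cert) (rows : List (List ℕ)) (h : ℕ) : Bool :=
  band (permOK n (nib h))
    (rowsOK ((l.map Cert.M).getD (Nat.shiftRight h 45) 0) h (tb h 44) rows 0)

/-- check all codes against the hints. -/
def hintsOK (n : ℕ) (l : List Cert) (codes : List (List (List ℕ))) : List ℕ → Bool :=
  List.rec (fun _ => true)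
    (fun c _ ih hs => List.rec false (fun h t _ => band (hintOK n l c h) (ih t)) hs) codes

/-- enumeration of all breadth-first codes. -/
def enum (n : ℕ) : ℕ → ℕ → ℕ → List ℕ → List (List (List ℕ))
  | 0, _, _, _ => [[]]
  | _ + 1, _, _, [] => []
  | f + 1, i, s, p :: ps =>
    [0, 1, 2, 3].flatMap fun c => bsel (Nat.ble (s + c) n)
      ((enum n f (i + 1) (s + c) (ps ++ List.replicate c i)).map
        fun rest => (p :: List.range' s c) :: rest) []

/-- all codes of trees on `n` vertices rooted at a leaf. -/
def codes (n : ℕ) : List (List (List ℕ)) :=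
  (enum n (n - 1) 1 2 [0]).map fun rest => [1] :: rest

end LTree

namespace LTree

/-! ### Specifications of the basic operations -/

@[simp] theorem band_eq (a b : Bool) : band a b = (a && b) := by cases a <;> rfl

@[simp] theorem bsel_eq {α : Type} (b : Bool) (x y : α) : bsel b x y = if b = true then x else y := by
  cases b <;> rfl

theorem tb_eq (m k : ℕ) : tb m k = m.testBit k := by
  have h : tb m k = Nat.beq ((m >>> k) &&& 1) 1 := rfl
  rw [h, Nat.testBit, Nat.and_comm, Nat.one_and_eq_mod_two]
  rcases Nat.mod_two_eq_zero_or_one (m >>> k) with h | h <;> rw [h] <;> rfl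

theorem allN_succ (n : ℕ) (f : ℕ → Bool) : allN (n + 1) f = (f n && allN n f) := band_eq _ _

theorem allN_spec {n : ℕ} {f : ℕ → Bool} (h : allN n f = true) : ∀ i < n, f i = true := by
  induction n with
  | zero => intro i hi; omega
  | succ n ih =>
    rw [allN_succ, Bool.and_eq_true] at h
    intro i hi
    rcases Nat.lt_succ_iff_lt_or_eq.mp hi with h1 | h1
    · exact ih h.2 i h1
    · rw [h1]; exact h.1

theorem orN_succ (n : ℕ) (f : ℕ → ℕ) : orN (n + 1) f = f n ||| orN n f := rfl

theorem testBit_orN (n : ℕ) (f : ℕ → ℕ) (k : ℕ) :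
    (orN n f).testBit k = true ↔ ∃ i < n, (f i).testBit k = true := by
  induction n with
  | zero => simp [orN]
  | succ n ih =>
    rw [orN_succ, Nat.testBit_or, Bool.or_eq_true, ih]
    constructor
    · rintro (h | ⟨i, hi, h⟩)
      · exact ⟨n, by omega, h⟩
      · exact ⟨i, by omega, h⟩
    · rintro ⟨i, hi, h⟩
      rcases Nat.lt_succ_iff_lt_or_eq.mp hi with h1 | h1
      · exact Or.inr ⟨i, h1, h⟩
      · left; rw [← h1]; exact h

theorem orL_cons (a : ℕ) (l : List ℕ) (f : ℕ → ℕ) : orL (a :: l) f = f a ||| orL l f := rfl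

theorem testBit_orL (l : List ℕ) (f : ℕ → ℕ) (k : ℕ) :
    (orL l f).testBit k = true ↔ ∃ i ∈ l, (f i).testBit k = true := by
  induction l with
  | nil => simp [orL]
  | cons a l ih =>
    rw [orL_cons, Nat.testBit_or, Bool.or_eq_true, ih]
    simp

theorem mapL_eq (f : ℕ → ℕ) (l : List ℕ) : mapL f l = l.map f := by
  induction l with
  | nil => rfl
  | cons a l ih => rw [List.map_cons, ← ih]; rfl

theorem testBit_one_shl (k j : ℕ) : (Nat.shiftLeft 1 k).testBit j = true ↔ j = k := by
  have h : Nat.shiftLeft 1 k = 1 <<< k := rfl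
  rw [h, Nat.shiftLeft_eq, one_mul, Nat.testBit_two_pow]
  simp [eq_comm]

theorem permOK_spec {n : ℕ} {f : ℕ → ℕ} (h : permOK n f = true) :
    (∀ i < n, f i < n) ∧ ∀ i < n, ∀ j < n, f i = f j → i = j := by
  have h1 : (orN n fun i => Nat.shiftLeft 1 (f i)) = 2 ^ n - 1 := Nat.eq_of_beq_eq_true h
  have hs : ∀ j < n, ∃ i < n, f i = j := by
    intro j hj
    have h2 : (orN n fun i => Nat.shiftLeft 1 (f i)).testBit j = true := by
      rw [h1, Nat.testBit_two_pow_sub_one]; simpa using hj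
    obtain ⟨i, hi, h3⟩ := (testBit_orN _ _ _).mp h2
    exact ⟨i, hi, ((testBit_one_shl _ _).mp h3).symm⟩
  have hsub : Finset.range n ⊆ (Finset.range n).image f := by
    intro j hj
    obtain ⟨i, hi, h3⟩ := hs j (Finset.mem_range.mp hj)
    exact Finset.mem_image.mpr ⟨i, Finset.mem_range.mpr hi, h3⟩
  have hle : ((Finset.range n).image f).card ≤ (Finset.range n).card := Finset.card_image_le
  have heq := Finset.eq_of_subset_of_card_le hsub hle
  constructor
  · intro i hi
    have : f i ∈ Finset.range n := by
      rw [heq]; exact Finset.mem_image_of_mem _ (Finset.mem_range.mpr hi)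
    exact Finset.mem_range.mp this
  · have hc : ((Finset.range n).image f).card = (Finset.range n).card := by rw [← heq]
    have := Finset.card_image_iff.mp hc
    intro i hi j hj hij
    exact this (by simpa using hi) (by simpa using hj) hij

theorem testBit_row (M i j : ℕ) :
    (row M i).testBit j = true ↔ M.testBit (16 * i + j) = true ∧ j < 16 := by
  have h : row M i = (M >>> (16 * i)) &&& (2 ^ 16 - 1) := rfl
  rw [h, Nat.testBit_and, Nat.testBit_shiftRight, Nat.testBit_two_pow_sub_one]
  simp

theorem ent_eq (M i j : ℕ) : ent M i j = M.testBit (16 * i + j) := tb_eq _ _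

theorem colMask_bit (r j : ℕ) (hr : r < 16) (hj : j < 16) : 
    colMask.testBit (16 * r + j) = true ↔ j = 0 := by
  have : ∀ r < 16, ∀ j < 16, (colMask.testBit (16 * r + j) = true ↔ j = 0) := by decide +kernel
  exact this r hr j hj

theorem testBit_col (M i r : ℕ) (hr : r < 16) :
    (col M i).testBit (16 * r) = true ↔ M.testBit (16 * r + i) = true := by
  have h : col M i = (M >>> i) &&& colMask := rfl
  rw [h, Nat.testBit_and, Nat.testBit_shiftRight]
  have := (colMask_bit r 0 hr (by norm_num)).mpr rfl
  rw [add_zero] at this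
  rw [this, add_comm]; simp

/-! ### Knowledge matrices -/

/-- every recorded entry of the matrix is correct for the relation `R`. -/
def Sound (n M : ℕ) (R : ℕ → ℕ → Prop) : Prop :=
  ∀ i < n, ∀ j < 16, M.testBit (16 * i + j) = true → j < n ∧ R i j

theorem sound_addRel {n M i j : ℕ} {R : ℕ → ℕ → Prop} (hn : n ≤ 16)
    (htr : ∀ a b c, R a b → R b c → R a c) (hM : Sound n M R)
    (hi : i < n) (hj : j < n) (hij : R i j) : Sound n (addRel n M i j) R := by
  intro a ha b hb h
  have e : addRel n M i j = M ||| (orN n fun a => bsel (bsel (Nat.beq a i) true (ent M a i))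
    (Nat.shiftLeft (Nat.lor (row M j) (Nat.shiftLeft 1 j)) (Nat.mul 16 a)) 0) := rfl
  rw [e, Nat.testBit_or, Bool.or_eq_true, testBit_orN] at h
  rcases h with h | ⟨a', ha', h⟩
  · exact hM a ha b hb h
  · rw [bsel_eq] at h
    by_cases h1 : bsel (Nat.beq a' i) true (ent M a' i) = true
    · rw [if_pos h1] at h
      rw [bsel_eq] at h1
      have e2 : Nat.shiftLeft (Nat.lor (row M j) (Nat.shiftLeft 1 j)) (Nat.mul 16 a')
        = (row M j ||| Nat.shiftLeft 1 j) <<< (16 * a') := rfl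
      rw [e2, Nat.testBit_shiftLeft, Bool.and_eq_true, Nat.testBit_or, Bool.or_eq_true,
        testBit_row, testBit_one_shl] at h
      obtain ⟨h3, h4⟩ := h
      have h3 : 16 * a' ≤ 16 * a + b := by simpa using h3
      have haa : a' = a ∧ 16 * a + b - 16 * a' = b := by
        rcases h4 with h4 | h4 <;> omega
      obtain ⟨rfl, hb'⟩ := haa
      rw [hb'] at h4
      have hai : a' = i ∨ R a' i := by
        by_cases hh : a' = i
        · exact Or.inl hh
        · right
          have hne : Nat.beq a' i = false := by
            rw [← Bool.not_eq_true]; intro h; exact hh (Nat.eq_of_beq_eq_true h)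
          rw [hne] at h1
          simp only [Bool.false_eq_true, if_false, ent_eq] at h1
          exact (hM a' ha i (by omega) h1).2
      have hjb : b < n ∧ R i b := by
        rcases h4 with h4 | h4
        · have := hM j hj b hb h4.1
          exact ⟨this.1, htr _ _ _ hij this.2⟩
        · rw [h4]; exact ⟨hj, hij⟩
      refine ⟨hjb.1, ?_⟩
      rcases hai with h | h
      · rw [h]; exact hjb.2
      · exact htr _ _ _ h hjb.2
    · rw [if_neg h1] at h
      simp at h

theorem sound_init {n ds lo hi : ℕ} {R : ℕ → ℕ → Prop} (hn : n ≤ 16)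
    (h1 : ∀ a b, a < b → b < n → nib ds a = lo → R a b)
    (h2 : ∀ a b, b < a → a < n → nib ds b = hi → R a b) : Sound n (initMat n ds lo hi) R := by
  intro a ha b hb h
  unfold initMat at h
  rw [testBit_orN] at h
  obtain ⟨a', ha', h⟩ := h
  rw [testBit_orN] at h
  obtain ⟨b', hb', h⟩ := h
  simp only [bsel_eq] at h
  split_ifs at h with hk
  · rw [testBit_one_shl] at h
    have h : 16 * a + b = 16 * a' + b' := h
    have haa : a' = a ∧ b' = b := by omega
    obtain ⟨rfl, rfl⟩ := haa
    refine ⟨hb', ?_⟩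
    simp only [known, bsel_eq] at hk
    split_ifs at hk with h3 h4
    · exact h1 _ _ (by simpa [Nat.blt] using h3) hb' (Nat.eq_of_beq_eq_true hk)
    · exact h2 _ _ (by simpa [Nat.blt] using h4) ha' (Nat.eq_of_beq_eq_true hk)
  · simp at h

end LTree

namespace LTree

/-! ### Geometry -/

/-- `z` lies strictly on one side of both `a` and `b`. -/
def Out (z a b : ℝ) : Prop := (z < a ∧ z < b) ∨ (a < z ∧ b < z)

/-- `z` lies between `a` and `b`. -/
def Btw (z a b : ℝ) : Prop := (a ≤ z ∧ z ≤ b) ∨ (b ≤ z ∧ z ≤ a)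

theorem mem_seg {p a b : ℝ × ℝ} (h : p ∈ segment ℝ a b) : Btw p.1 a.1 b.1 ∧ Btw p.2 a.2 b.2 := by
  have h1 := Prod.segment_subset a b h
  rw [Set.mem_prod, segment_eq_uIcc, segment_eq_uIcc, Set.mem_uIcc, Set.mem_uIcc] at h1
  exact h1

theorem Btw.self {z a : ℝ} (h : Btw z a a) : z = a := by
  rcases h with h | h <;> exact le_antisymm (by linarith) (by linarith)

theorem Btw.not_out {z a b : ℝ} (h : Btw z a b) (h' : Out z a b) : False := by
  rcases h with h | h <;> rcases h' with h' | h' <;> linarith [h.1, h.2, h'.1, h'.2]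

theorem btw_opp {z a b b' : ℝ} (hb : b ≠ a) (hb' : b' ≠ a) (h : Btw z a b) (h' : Btw z a b')
    (ho : ¬ (a < b ↔ a < b')) : z = a := by
  by_cases h1 : a < b
  · have h2 : ¬ a < b' := fun h2 => ho ⟨fun _ => h2, fun _ => h1⟩
    have h3 : b' < a := lt_of_le_of_ne (not_lt.mp h2) hb'
    rcases h with h | h <;> rcases h' with h' | h' <;>
      exact le_antisymm (by linarith [h.1, h.2, h'.1, h'.2]) (by linarith [h.1, h.2, h'.1, h'.2])
  · have h2 : a < b' := by
      by_contra h2; exact ho ⟨fun h => absurd h h1, fun h => absurd h h2⟩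
    have h3 : b < a := lt_of_le_of_ne (not_lt.mp h1) hb
    rcases h with h | h <;> rcases h' with h' | h' <;>
      exact le_antisymm (by linarith [h.1, h.2, h'.1, h'.2]) (by linarith [h.1, h.2, h'.1, h'.2])

section geom

variable {α : Type*} {G : SimpleGraph α} {S : Finset (ℝ × ℝ)} {φ : α → ℝ × ℝ}
  {hor : α → α → Bool} {ord : α → List α}

/-- corner function associated with `hor`. -/
def cor (φ : α → ℝ × ℝ) (hor : α → α → Bool) (u v : α) : ℝ × ℝ :=
  if hor u v = true then ((φ v).1, (φ u).2) else ((φ u).1, (φ v).2)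

theorem dirOf_cor_h {u v : α} (hy : (φ v).2 ≠ (φ u).2) (h : hor v u = true) :
    dirOf φ (cor φ hor) v u = if (φ v).1 < (φ u).1 then 0 else 2 := by
  unfold dirOf cor
  simp [h]

theorem dirOf_cor_v {u v : α} (hy : (φ v).2 ≠ (φ u).2) (h : hor v u = false) :
    dirOf φ (cor φ hor) v u = if (φ v).2 < (φ u).2 then 1 else 3 := by
  unfold dirOf cor
  simp [h, hy.symm]

theorem dir_ne {c : α → α → ℝ × ℝ} (hresp : RespectsOrder φ c ord) {v u w : α}
    (hu : u ∈ ord v) (hw : w ∈ ord v) (hne : u ≠ w) : dirOf φ c v u ≠ dirOf φ c v w := by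
  obtain ⟨L, hL, hch⟩ := hresp v
  rw [List.mem_cyclicPermutations_iff] at hL
  have hu' : u ∈ L := hL.mem_iff.mpr hu
  have hw' : w ∈ L := hL.mem_iff.mpr hw
  have hp : (L.map fun u => dirOf φ c v u).Pairwise (· < ·) := List.isChain_iff_pairwise.mp hch
  have hnd : (L.map fun u => dirOf φ c v u).Nodup := hp.imp (fun h => ne_of_lt h)
  intro h
  exact hne (List.inj_on_of_nodup_map hnd hu' hw' h)

theorem mem_LDraw_cor {u v r k : α} {p : ℝ × ℝ} (huv : (r = u ∧ k = v) ∨ (r = v ∧ k = u))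
    (hh : ∀ u v, u ≠ v → hor u v = !hor v u) (hne : u ≠ v) (hr : hor r k = true)
    (hp : p ∈ LDraw φ (cor φ hor) u v) :
    (p.2 = (φ r).2 ∧ Btw p.1 (φ r).1 (φ k).1) ∨ (p.1 = (φ k).1 ∧ Btw p.2 (φ k).2 (φ r).2) := by
  have hc : cor φ hor u v = ((φ k).1, (φ r).2) := by
    rcases huv with ⟨rfl, rfl⟩ | ⟨rfl, rfl⟩
    · simp [cor, hr]
    · have := hh _ _ hne
      rw [hr] at this
      simp [cor, this]
  unfold LDraw at hp
  rw [hc] at hp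
  have sw : ∀ {z a b : ℝ}, Btw z a b → Btw z b a := fun h => Or.symm h
  rcases huv with ⟨rfl, rfl⟩ | ⟨rfl, rfl⟩
  · rcases hp with hp | hp
    · have := mem_seg hp
      exact Or.inl ⟨this.2.self, this.1⟩
    · have := mem_seg hp
      exact Or.inr ⟨this.1.self, sw this.2⟩
  · rcases hp with hp | hp
    · have := mem_seg hp
      exact Or.inr ⟨this.1.self, this.2⟩
    · have := mem_seg hp
      exact Or.inl ⟨this.2.self, sw this.1⟩

theorem cross_aux {r k r' k' : α} {p : ℝ × ℝ}
    (hinj : ∀ u v, u ≠ v → (φ u).1 ≠ (φ v).1 ∧ (φ u).2 ≠ (φ v).2)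
    (hneq : ¬ (r = r' ∧ k = k')) (hrk : r ≠ k) (hrk' : r' ≠ k')
    (hH : r = r' → k ≠ k' → ¬ ((φ r).1 < (φ k).1 ↔ (φ r).1 < (φ k').1))
    (hV : k = k' → r ≠ r' → ¬ ((φ k).2 < (φ r).2 ↔ (φ k).2 < (φ r').2))
    (hnc : k' = r ∨ k' = k ∨ r = r' ∨ Out (φ k').1 (φ r).1 (φ k).1 ∨ Out (φ r).2 (φ k').2 (φ r').2)
    (h1 : p.2 = (φ r).2 ∧ Btw p.1 (φ r).1 (φ k).1)
    (h2 : p.1 = (φ k').1 ∧ Btw p.2 (φ k').2 (φ r').2) : k' = r ∧ p = φ r := by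
  rw [h2.1] at h1
  rw [h1.1] at h2
  have hsame : r = r' → False := by
    intro e
    have hkk : k ≠ k' := fun h => hneq ⟨e, h⟩
    have h3 : Btw (φ k').1 (φ r).1 (φ k').1 := by
      rcases le_total (φ r).1 (φ k').1 with h | h
      · exact Or.inl ⟨h, le_rfl⟩
      · exact Or.inr ⟨le_rfl, h⟩
    have := btw_opp (hinj _ _ hrk.symm).1 (hinj k' r (by rw [e]; exact hrk'.symm)).1 h1.2 h3
      (hH e hkk)
    exact (hinj k' r (by rw [e]; exact hrk'.symm)).1 this
  have hsame2 : k' = k → False := by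
    intro e
    have hrr : r ≠ r' := fun h => hneq ⟨h, e.symm⟩
    subst e
    have h3 : Btw (φ r).2 (φ k').2 (φ r).2 := by
      rcases le_total (φ k').2 (φ r).2 with h | h
      · exact Or.inl ⟨h, le_rfl⟩
      · exact Or.inr ⟨le_rfl, h⟩
    have := btw_opp (hinj _ _ hrk).2 (hinj _ _ hrk').2 h3 h2.2 (hV rfl hrr)
    exact (hinj _ _ hrk).2 this
  rcases hnc with h | h | h | h | h
  · exact ⟨h, Prod.ext (by rw [h2.1, h]) h1.1⟩
  · exact (hsame2 h).elim
  · exact (hsame h).elim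
  · exact (h1.2.not_out h).elim
  · exact (h2.2.not_out h).elim

theorem emb_of
    (hinj : ∀ u v, u ≠ v → (φ u).1 ≠ (φ v).1 ∧ (φ u).2 ≠ (φ v).2)
    (hS : ∀ v, φ v ∈ S)
    (hh : ∀ u v, u ≠ v → hor u v = !hor v u)
    (hord : ∀ v u, u ∈ ord v ↔ G.Adj v u)
    (hresp : RespectsOrder φ (cor φ hor) ord)
    (hnc : ∀ r k r' k', G.Adj r k → hor r k = true → G.Adj r' k' → hor r' k' = true →
      k' = r ∨ k' = k ∨ r = r' ∨ Out (φ k').1 (φ r).1 (φ k).1 ∨ Out (φ r).2 (φ k').2 (φ r').2) :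
    IsLEmbedding G S φ (cor φ hor) := by
  have hsym : ∀ u v, cor φ hor u v = cor φ hor v u := by
    intro u v
    by_cases h : u = v
    · rw [h]
    · have := hh u v h
      unfold cor
      rw [this]
      cases hor v u <;> simp
  have hoppH : ∀ r k k', G.Adj r k → G.Adj r k' → hor r k = true → hor r k' = true → k ≠ k' →
      ¬ ((φ r).1 < (φ k).1 ↔ (φ r).1 < (φ k').1) := by
    intro r k k' h1 h2 h3 h4 hne hiff
    apply dir_ne hresp ((hord r k).mpr h1) ((hord r k').mpr h2) hne
    rw [dirOf_cor_h (hinj _ _ h1.ne).2 h3, dirOf_cor_h (hinj _ _ h2.ne).2 h4]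
    simp only [hiff]
  have hoppV : ∀ k r r', G.Adj k r → G.Adj k r' → hor r k = true → hor r' k = true → r ≠ r' →
      ¬ ((φ k).2 < (φ r).2 ↔ (φ k).2 < (φ r').2) := by
    intro k r r' h1 h2 h3 h4 hne hiff
    apply dir_ne hresp ((hord k r).mpr h1) ((hord k r').mpr h2) hne
    rw [dirOf_cor_v (hinj _ _ h1.ne).2 (by rw [hh _ _ h1.ne, h3]; rfl),
      dirOf_cor_v (hinj _ _ h2.ne).2 (by rw [hh _ _ h2.ne, h4]; rfl)]
    simp only [hiff]
  refine ⟨?_, hS, hsym, ?_, ?_⟩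
  · intro u v h
    by_contra hne
    exact (hinj u v hne).1 (by rw [h])
  · intro u v _
    unfold cor
    split_ifs
    · exact Or.inr rfl
    · exact Or.inl rfl
  · intro u v a b huv hab hne p hp
    have orient : ∀ u v, G.Adj u v → ∃ r k, ((r = u ∧ k = v) ∨ (r = v ∧ k = u)) ∧ hor r k = true ∧
        G.Adj r k := by
      intro u v h
      cases hx : hor u v
      · refine ⟨v, u, Or.inr ⟨rfl, rfl⟩, ?_, h.symm⟩
        rw [hh _ _ h.ne.symm, hx]; rfl
      · exact ⟨u, v, Or.inl ⟨rfl, rfl⟩, hx, h⟩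
    obtain ⟨r, k, e1, hr, hadj⟩ := orient u v huv
    obtain ⟨r', k', e2, hr', hadj'⟩ := orient a b hab
    have m1 := mem_LDraw_cor e1 hh huv.ne hr hp.1
    have m2 := mem_LDraw_cor e2 hh hab.ne hr' hp.2
    have hs1 : s(u, v) = s(r, k) := by
      rcases e1 with ⟨rfl, rfl⟩ | ⟨rfl, rfl⟩
      · rfl
      · exact Sym2.eq_swap
    have hs2 : s(a, b) = s(r', k') := by
      rcases e2 with ⟨rfl, rfl⟩ | ⟨rfl, rfl⟩
      · rfl
      · exact Sym2.eq_swap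
    have hneq : ¬ (r = r' ∧ k = k') := by
      rintro ⟨rfl, rfl⟩; exact hne (hs1.trans hs2.symm)
    have hw1 : ∀ w, (w = r ∨ w = k) → (w = u ∨ w = v) := by
      intro w hw; rcases e1 with ⟨rfl, rfl⟩ | ⟨rfl, rfl⟩ <;> tauto
    have hw2 : ∀ w, (w = r' ∨ w = k') → (w = a ∨ w = b) := by
      intro w hw; rcases e2 with ⟨rfl, rfl⟩ | ⟨rfl, rfl⟩ <;> tauto
    suffices h : ∃ w, (w = r ∨ w = k) ∧ (w = r' ∨ w = k') ∧ p = φ w by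
      obtain ⟨w, h1, h2, h3⟩ := h
      exact ⟨w, hw1 w h1, hw2 w h2, h3⟩
    have hH : r = r' → k ≠ k' → ¬ ((φ r).1 < (φ k).1 ↔ (φ r).1 < (φ k').1) := by
      intro e hk
      exact hoppH r k k' hadj (by rw [e]; exact hadj') hr (by rw [e]; exact hr') hk
    have hV : k = k' → r ≠ r' → ¬ ((φ k).2 < (φ r).2 ↔ (φ k).2 < (φ r').2) := by
      intro e hk
      exact hoppV k r r' hadj.symm (by rw [e]; exact hadj'.symm) hr (by rw [e]; exact hr') hk
    have inj2 : ∀ x y, (φ x).2 = (φ y).2 → x = y := by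
      intro x y h; by_contra hh; exact (hinj x y hh).2 h
    have inj1 : ∀ x y, (φ x).1 = (φ y).1 → x = y := by
      intro x y h; by_contra hh; exact (hinj x y hh).1 h
    rcases m1 with m1 | m1 <;> rcases m2 with m2 | m2
    · have e : r = r' := inj2 _ _ (m1.1.symm.trans m2.1)
      have hk : k ≠ k' := fun h => hneq ⟨e, h⟩
      have m2' := m2.2
      rw [← e] at m2'
      have := btw_opp (hinj _ _ hadj.ne.symm).1 (hinj k' r (by rw [e]; exact hadj'.ne.symm)).1
        m1.2 m2' (hH e hk)
      exact ⟨r, Or.inl rfl, Or.inl e, Prod.ext this m1.1⟩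
    · have := cross_aux hinj hneq hadj.ne hadj'.ne hH hV (hnc r k r' k' hadj hr hadj' hr') m1 m2
      exact ⟨r, Or.inl rfl, Or.inr this.1.symm, this.2⟩
    · have := cross_aux hinj (fun h => hneq ⟨h.1.symm, h.2.symm⟩) hadj'.ne hadj.ne
        (fun e hk => by
          have := hH e.symm hk.symm
          rw [e]; tauto)
        (fun e hk => by
          have := hV e.symm hk.symm
          rw [e]; tauto) (hnc r' k' r k hadj' hr' hadj hr) m2 m1
      exact ⟨k, Or.inr rfl, Or.inl this.1, by rw [this.1]; exact this.2⟩
    · have e : k = k' := inj1 _ _ (m1.1.symm.trans m2.1)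
      have hk : r ≠ r' := fun h => hneq ⟨h, e⟩
      have m2' := m2.2
      rw [← e] at m2'
      have := btw_opp (hinj _ _ hadj.ne).2 (hinj r' k (by rw [e]; exact hadj'.ne)).2
        m1.2 m2' (hV e hk)
      exact ⟨k, Or.inr rfl, Or.inr e, Prod.ext m1.1 this⟩

end geom

end LTree

namespace LTree

/-! ### Soundness of the leaf check -/

theorem hT_unset {n U D p q r k : ℕ} {f : ℕ → ℝ} (hk : k < 16) (hp : p < n) (hq : q < n)
    (hU : Sound n U fun i j => f i < f j) (hD : Sound n D fun i j => f j < f i)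
    (h : (hT U D p q r).testBit (16 * r + k) = false) :
    k = p ∨ k = q ∨ Out (f k) (f p) (f q) := by
  have e : hT U D p q r = ((2 ^ 16 - 1) ^^^ (((row U p &&& row U q) ||| (row D p &&& row D q)) |||
    (Nat.shiftLeft 1 p ||| Nat.shiftLeft 1 q))) <<< (16 * r) := rfl
  rw [e, Nat.testBit_shiftLeft, Nat.testBit_xor, Nat.testBit_two_pow_sub_one,
    Nat.add_sub_cancel_left] at h
  simp only [hk, decide_true, ge_iff_le, Nat.le_add_right, Bool.true_and, Bool.true_xor,
    Bool.not_eq_false', Nat.testBit_or, Nat.testBit_and, Bool.or_eq_true, Bool.and_eq_true,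
    testBit_row, testBit_one_shl] at h
  rcases h with (⟨h1, h2⟩ | ⟨h1, h2⟩) | (h | h)
  · exact Or.inr (Or.inr (Or.inr ⟨(hU p hp k hk h1.1).2, (hU q hq k hk h2.1).2⟩))
  · exact Or.inr (Or.inr (Or.inl ⟨(hD p hp k hk h1.1).2, (hD q hq k hk h2.1).2⟩))
  · exact Or.inl h
  · exact Or.inr (Or.inl h)

theorem vT_unset {n U D p q r k : ℕ} {f : ℕ → ℝ} (hn : n ≤ 16) (hr : r < n) (hp : p < n)
    (hq : q < n)
    (hU : Sound n U fun i j => f i < f j) (hD : Sound n D fun i j => f j < f i)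
    (h : (vT U D p q k).testBit (16 * r + k) = false) :
    r = p ∨ r = q ∨ Out (f r) (f p) (f q) := by
  have e : vT U D p q k = (colMask ^^^ (((col U p &&& col U q) ||| (col D p &&& col D q)) |||
    (Nat.shiftLeft 1 (16 * p) ||| Nat.shiftLeft 1 (16 * q)))) <<< k := rfl
  have hc := (colMask_bit r 0 (by omega) (by norm_num)).mpr rfl
  rw [add_zero] at hc
  rw [e, Nat.testBit_shiftLeft, Nat.testBit_xor, Nat.add_sub_cancel, hc] at h
  simp only [decide_true, ge_iff_le, Nat.le_add_left, Bool.true_and, Bool.true_xor,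
    Bool.not_eq_false', Nat.testBit_or, Nat.testBit_and, Bool.or_eq_true, Bool.and_eq_true,
    testBit_col _ _ r (by omega : r < 16), testBit_one_shl] at h
  rcases h with (⟨h1, h2⟩ | ⟨h1, h2⟩) | (h | h)
  · exact Or.inr (Or.inr (Or.inl ⟨(hU r hr p (by omega) h1).2, (hU r hr q (by omega) h2).2⟩))
  · exact Or.inr (Or.inr (Or.inr ⟨(hD r hr p (by omega) h1).2, (hD r hr q (by omega) h2).2⟩))
  · exact Or.inl (by omega)
  · exact Or.inr (Or.inl (by omega))

/-- a direction code is compatible with a direction. -/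
def Compat (c : ℕ) (d : Fin 4) : Prop := (c < 4 → c = d.val) ∧ c % 2 = d.val % 2

theorem ports4 : ∀ a b c d : Fin 4, step a.val b.val = 1 → step b.val c.val = 1 →
    step c.val d.val = 1 → ∃ k < 4, List.IsChain (· < ·) ([a, b, c, d].rotate k) := by
  decide +kernel

theorem ports3 : ∀ a b c : Fin 4, 1 ≤ step a.val b.val → 1 ≤ step b.val c.val →
    step a.val b.val + step b.val c.val ≤ 3 →
    ∃ k < 4, List.IsChain (· < ·) ([a, b, c].rotate k) := by
  decide +kernel

theorem ports2 : ∀ a b : Fin 4, a ≠ b → ∃ k < 4, List.IsChain (· < ·) ([a, b].rotate k) := by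
  decide +kernel

theorem ports_sound {C : List ℕ} {D : List (Fin 4)} (h : List.Forall₂ Compat C D)
    (hp : portsOK C = true) : ∃ k, List.IsChain (· < ·) (D.rotate k) := by
  match C, hp with
  | [], _ => cases h; exact ⟨0, by simp⟩
  | [_], _ => 
    cases h with | cons h1 h2 => cases h2; exact ⟨0, by simp⟩
  | [a, b], hp =>
    obtain _ | ⟨h1, _ | ⟨h2, _ | _⟩⟩ := h
    rename_i x y
    simp only [portsOK, bsel_eq, band_eq] at hp
    have hne : x ≠ y := by
      rintro rfl
      split_ifs at hp with h3 h4
      · simp at hp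
      · simp only [Bool.and_true, Bool.and_eq_true, lt4] at hp
        have ha := h1.1 (Nat.lt_succ_of_le (Nat.le_of_ble_eq_true hp.1))
        have hb := h2.1 (Nat.lt_succ_of_le (Nat.le_of_ble_eq_true hp.2))
        apply h4; rw [ha, hb]; exact Nat.beq_refl _
      · apply h3
        have : Nat.mod a 2 = Nat.mod b 2 := h1.2.trans h2.2.symm
        rw [this]; exact Nat.beq_refl _
    obtain ⟨k, -, hk⟩ := ports2 x y hne
    exact ⟨k, hk⟩
  | [a, b, c], hp =>
    obtain _ | ⟨h1, _ | ⟨h2, _ | ⟨h3, _ | _⟩⟩⟩ := h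
    rename_i x y z
    simp only [portsOK, band_eq, Bool.and_eq_true, lt4] at hp
    obtain ⟨ha, hb, hc, p1, p2, p3⟩ := hp
    have ha := h1.1 (Nat.lt_succ_of_le (Nat.le_of_ble_eq_true ha))
    have hb := h2.1 (Nat.lt_succ_of_le (Nat.le_of_ble_eq_true hb))
    have hc := h3.1 (Nat.lt_succ_of_le (Nat.le_of_ble_eq_true hc))
    have p1 := Nat.le_of_ble_eq_true p1
    have p2 := Nat.le_of_ble_eq_true p2
    have p3 := Nat.le_of_ble_eq_true p3
    rw [ha, hb] at p1 p3
    rw [hb, hc] at p2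
    rw [hc] at p3
    obtain ⟨k, -, hk⟩ := ports3 x y z p1 p2 p3
    exact ⟨k, hk⟩
  | [a, b, c, d], hp =>
    obtain _ | ⟨h1, _ | ⟨h2, _ | ⟨h3, _ | ⟨h4, _ | _⟩⟩⟩⟩ := h
    rename_i x y z w
    simp only [portsOK, band_eq, Bool.and_eq_true, lt4] at hp
    obtain ⟨ha, hb, hc, hd, p1, p2, p3⟩ := hp
    have ha := h1.1 (Nat.lt_succ_of_le (Nat.le_of_ble_eq_true ha))
    have hb := h2.1 (Nat.lt_succ_of_le (Nat.le_of_ble_eq_true hb))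
    have hc := h3.1 (Nat.lt_succ_of_le (Nat.le_of_ble_eq_true hc))
    have hd := h4.1 (Nat.lt_succ_of_le (Nat.le_of_ble_eq_true hd))
    have p1 := Nat.eq_of_beq_eq_true p1
    have p2 := Nat.eq_of_beq_eq_true p2
    have p3 := Nat.eq_of_beq_eq_true p3
    rw [ha, hb] at p1
    rw [hb, hc] at p2
    rw [hc, hd] at p3
    obtain ⟨k, -, hk⟩ := ports4 x y z w p1 p2 p3
    exact ⟨k, hk⟩
  | _ :: _ :: _ :: _ :: _ :: _, hp => simp [portsOK] at hp

theorem horN_symm (v i j : ℕ) (h : i ≠ j) : horN v i j = !horN v j i := by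
  unfold horN
  simp only [bsel_eq]
  rcases lt_or_gt_of_ne h with h | h
  · have h1 : Nat.ble j i = false := by
      rw [← Bool.not_eq_true, Nat.ble_eq]; omega
    have h2 : Nat.ble i j = true := by rw [Nat.ble_eq]; omega
    rw [h1, h2]
    cases tb v (Nat.add 44 j) <;> simp
  · have h1 : Nat.ble i j = false := by
      rw [← Bool.not_eq_true, Nat.ble_eq]; omega
    have h2 : Nat.ble j i = true := by rw [Nat.ble_eq]; omega
    rw [h1, h2]
    cases tb v (Nat.add 44 i) <;> simp

theorem hMat_bit {n M XU XD v i j b : ℕ} (hi : i < n) (hj : j < n) (hij : j ∈ nbL M i)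
    (hji : i ∈ nbL M j) (hne : i ≠ j) (hh : horN v i j = true)
    (h : (hT XU XD (nib v i) (nib v j) (nib v i)).testBit b = true ∧
      (hT XU XD (nib v j) (nib v i) (nib v i)).testBit b = true) :
    (hMat n M XU XD v).testBit b = true := by
  unfold hMat
  unfold horN at hh
  rw [testBit_orN]
  simp only [bsel_eq] at hh
  rcases lt_or_gt_of_ne hne with hlt | hlt
  · have h1 : Nat.ble j i = false := by
      rw [← Bool.not_eq_true, Nat.ble_eq]; omega
    refine ⟨i, hi, ?_⟩
    rw [testBit_orL]
    refine ⟨j, hij, ?_⟩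
    rw [h1] at hh ⊢
    simp only [Bool.false_eq_true, if_false] at hh
    rw [hh]
    simpa using h.1
  · have h1 : Nat.ble i j = false := by
      rw [← Bool.not_eq_true, Nat.ble_eq]; omega
    have h2 : Nat.ble j i = true := by rw [Nat.ble_eq]; omega
    refine ⟨j, hj, ?_⟩
    rw [testBit_orL]
    refine ⟨i, hji, ?_⟩
    rw [h2] at hh
    have hh' : tb v (Nat.add 44 i) = false := by
      cases hx : tb v (Nat.add 44 i)
      · rfl
      · rw [hx] at hh; simp at hh
    rw [h1, hh']
    simpa using h.2

theorem vMat_bit {n M YU YD v i j b : ℕ} (hi : i < n) (hj : j < n) (hij : j ∈ nbL M i)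
    (hji : i ∈ nbL M j) (hne : i ≠ j) (hh : horN v i j = true)
    (h : (vT YU YD (nib v i) (nib v j) (nib v j)).testBit b = true ∧
      (vT YU YD (nib v j) (nib v i) (nib v j)).testBit b = true) :
    (vMat n M YU YD v).testBit b = true := by
  unfold vMat
  unfold horN at hh
  rw [testBit_orN]
  simp only [bsel_eq] at hh
  rcases lt_or_gt_of_ne hne with hlt | hlt
  · have h1 : Nat.ble j i = false := by
      rw [← Bool.not_eq_true, Nat.ble_eq]; omega
    refine ⟨i, hi, ?_⟩
    rw [testBit_orL]
    refine ⟨j, hij, ?_⟩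
    rw [h1] at hh ⊢
    simp only [Bool.false_eq_true, if_false] at hh
    rw [hh]
    simpa using h.1
  · have h1 : Nat.ble i j = false := by
      rw [← Bool.not_eq_true, Nat.ble_eq]; omega
    have h2 : Nat.ble j i = true := by rw [Nat.ble_eq]; omega
    refine ⟨j, hj, ?_⟩
    rw [testBit_orL]
    refine ⟨i, hji, ?_⟩
    rw [h2] at hh
    have hh' : tb v (Nat.add 44 i) = false := by
      cases hx : tb v (Nat.add 44 i)
      · rfl
      · rw [hx] at hh; simp at hh
    rw [h1, hh']
    simpa using h.2

theorem Out.symm {z a b : ℝ} (h : Out z a b) : Out z b a := by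
  rcases h with h | h
  · exact Or.inl h.symm
  · exact Or.inr h.symm

/-- `nb` describes the ordered tree `ord` after relabelling of the vertices. -/
def Realizes (n : ℕ) (ord : Fin n → List (Fin n)) (nb : ℕ → List ℕ) : Prop :=
  ∃ pos : Fin n → ℕ, Function.Injective pos ∧ (∀ v, pos v < n) ∧
    ∀ v, nb (pos v) ~r (ord v).map pos

theorem leaf_sound {n M v XU XD YU YD : ℕ} (hn : n ≤ 16) {pt : ℕ → ℝ × ℝ}
    (hpt : ∀ i < n, ∀ j < n, i ≠ j → (pt i).1 ≠ (pt j).1 ∧ (pt i).2 ≠ (pt j).2)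
    (hXU : Sound n XU fun i j => (pt i).1 < (pt j).1)
    (hXD : Sound n XD fun i j => (pt j).1 < (pt i).1)
    (hYU : Sound n YU fun i j => (pt i).2 < (pt j).2)
    (hYD : Sound n YD fun i j => (pt j).2 < (pt i).2)
    (hok : leafOK n M v XU XD YU YD = true)
    {G : SimpleGraph (Fin n)} {ord : Fin n → List (Fin n)}
    (hord : ∀ v u, u ∈ ord v ↔ G.Adj v u) (hR : Realizes n ord (nbL M))
    {S : Finset (ℝ × ℝ)} (hS : ∀ i < n, pt i ∈ S) :
    ∃ φ c, IsLEmbedding G S φ c ∧ RespectsOrder φ c ord := by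
  obtain ⟨pos, hinj, hlt, hrot⟩ := hR
  simp only [leafOK, band_eq, Bool.and_eq_true] at hok
  obtain ⟨h1, h2, h3⟩ := hok
  obtain ⟨hN, hNinj⟩ := permOK_spec h1
  have h2 : hMat n M XU XD v &&& vMat n M YU YD v = 0 := Nat.eq_of_beq_eq_true h2
  have h3 := allN_spec h3
  have hmem : ∀ {a b : Fin n}, G.Adj a b → pos b ∈ nbL M (pos a) := by
    intro a b hab
    rw [(hrot a).mem_iff]
    exact List.mem_map_of_mem ((hord a b).mpr hab)
  have hne : ∀ {a b : Fin n}, a ≠ b → pos a ≠ pos b := fun h h' => h (hinj h')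
  have hNne : ∀ {a b : Fin n}, a ≠ b → nib v (pos a) ≠ nib v (pos b) := fun h h' =>
    h (hinj (hNinj _ (hlt _) _ (hlt _) h'))
  have hNeq : ∀ {a b : Fin n}, nib v (pos a) = nib v (pos b) → a = b := fun h' =>
    (hinj (hNinj _ (hlt _) _ (hlt _) h'))
  set φ : Fin n → ℝ × ℝ := fun w => pt (nib v (pos w)) with hφ
  set hor : Fin n → Fin n → Bool := fun u w => horN v (pos u) (pos w) with hhor
  have hφinj : ∀ u w, u ≠ w → (φ u).1 ≠ (φ w).1 ∧ (φ u).2 ≠ (φ w).2 := fun u w h =>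
    hpt _ (hN _ (hlt _)) _ (hN _ (hlt _)) (hNne h)
  have hresp : RespectsOrder φ (cor φ hor) ord := by
    intro w
    obtain ⟨k0, hk0⟩ := (hrot w).symm
    rw [← List.map_rotate] at hk0
    have hport := h3 (pos w) (hlt w)
    rw [mapL_eq, ← hk0, List.map_map] at hport
    have hfor : List.Forall₂ Compat
        (((ord w).rotate k0).map (pcode XU XD YU YD v (pos w) ∘ pos))
        (((ord w).rotate k0).map (fun u => dirOf φ (cor φ hor) w u)) := by
      rw [List.forall₂_map_left_iff, List.forall₂_map_right_iff, List.forall₂_same]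
      intro u hu
      have hadj : G.Adj w u := (hord w u).mp (List.mem_rotate.mp hu)
      have hxy := hφinj w u hadj.ne
      have bn : nib v (pos u) < n := hN _ (hlt u)
      have b16 : nib v (pos u) < 16 := by omega
      have bw : nib v (pos w) < n := hN _ (hlt w)
      show Compat (pcode XU XD YU YD v (pos w) (pos u)) _
      unfold pcode sgn
      simp only [bsel_eq, ent_eq]
      cases hx : hor w u
      · rw [dirOf_cor_v hxy.2 hx]
        have hx' : horN v (pos w) (pos u) = false := hx
        rw [hx']
        simp only [Bool.false_eq_true, if_false]
        split_ifs with c1 c2 c3 c4 c5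
        · exact ⟨fun _ => rfl, rfl⟩
        · exact absurd (hYU _ bw _ b16 c1).2 c2
        · exact absurd c4 (not_lt.mpr (le_of_lt (hYD _ bw _ b16 c3).2))
        · exact ⟨fun _ => rfl, rfl⟩
        · exact ⟨fun h => absurd h (by norm_num), rfl⟩
        · exact ⟨fun h => absurd h (by norm_num), rfl⟩
      · rw [dirOf_cor_h hxy.2 hx]
        have hx' : horN v (pos w) (pos u) = true := hx
        rw [hx']
        simp only [if_true]
        split_ifs with c1 c2 c3 c4 c5
        · exact ⟨fun _ => rfl, rfl⟩
        · exact absurd (hXU _ bw _ b16 c1).2 c2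
        · exact absurd c4 (not_lt.mpr (le_of_lt (hXD _ bw _ b16 c3).2))
        · exact ⟨fun _ => rfl, rfl⟩
        · exact ⟨fun h => absurd h (by norm_num), rfl⟩
        · exact ⟨fun h => absurd h (by norm_num), rfl⟩
    obtain ⟨k, hk⟩ := ports_sound hfor hport
    refine ⟨((ord w).rotate k0).rotate k, ?_, ?_⟩
    · rw [List.mem_cyclicPermutations_iff]
      have e1 : (ord w).rotate k0 ~r ord w := (List.IsRotated.refl (ord w)).symm.trans
        (List.IsRotated.refl _) |>.symm.trans ⟨k0, rfl⟩ |>.symm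
      have e2 : ((ord w).rotate k0).rotate k ~r (ord w).rotate k0 :=
        List.IsRotated.symm ⟨k, rfl⟩
      exact e2.trans e1
    · rw [List.map_rotate]
      exact hk
  refine ⟨φ, cor φ hor, emb_of hφinj (fun w => hS _ (hN _ (hlt w)))
    (fun a b h => horN_symm _ _ _ (hne h)) hord hresp ?_, hresp⟩
  intro r k r' k' hadj hr hadj' hr'
  have hbit := congrArg (fun z => Nat.testBit z (16 * nib v (pos r) + nib v (pos k'))) h2
  simp only [Nat.testBit_and, Nat.zero_testBit] at hbit
  have hk16 : nib v (pos k') < 16 := lt_of_lt_of_le (hN _ (hlt k')) hn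
  by_cases hH : (hMat n M XU XD v).testBit (16 * nib v (pos r) + nib v (pos k')) = true
  · rw [hH, Bool.true_and] at hbit
    have hor2 : (vT YU YD (nib v (pos r')) (nib v (pos k')) (nib v (pos k'))).testBit
          (16 * nib v (pos r) + nib v (pos k')) = false ∨
        (vT YU YD (nib v (pos k')) (nib v (pos r')) (nib v (pos k'))).testBit
          (16 * nib v (pos r) + nib v (pos k')) = false := by
      by_contra hcon
      rw [not_or, Bool.not_eq_false, Bool.not_eq_false] at hcon
      have := vMat_bit (hlt _) (hlt _) (hmem hadj') (hmem hadj'.symm) (hne hadj'.ne) hr' hcon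
      rw [this] at hbit
      exact Bool.noConfusion hbit
    have : nib v (pos r) = nib v (pos r') ∨ nib v (pos r) = nib v (pos k') ∨
        Out (φ r).2 (φ k').2 (φ r').2 := by
      rcases hor2 with h | h
      · rcases vT_unset (f := fun i => (pt i).2) hn (hN _ (hlt _)) (hN _ (hlt _)) (hN _ (hlt _))
          hYU hYD h with h | h | h
        · exact Or.inl h
        · exact Or.inr (Or.inl h)
        · exact Or.inr (Or.inr h.symm)
      · rcases vT_unset (f := fun i => (pt i).2) hn (hN _ (hlt _)) (hN _ (hlt _)) (hN _ (hlt _))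
          hYU hYD h with h | h | h
        · exact Or.inr (Or.inl h)
        · exact Or.inl h
        · exact Or.inr (Or.inr h)
    rcases this with h | h | h
    · exact Or.inr (Or.inr (Or.inl (hNeq h)))
    · exact Or.inl (hNeq h).symm
    · exact Or.inr (Or.inr (Or.inr (Or.inr h)))
  · have hor2 : (hT XU XD (nib v (pos r)) (nib v (pos k)) (nib v (pos r))).testBit
          (16 * nib v (pos r) + nib v (pos k')) = false ∨
        (hT XU XD (nib v (pos k)) (nib v (pos r)) (nib v (pos r))).testBit
          (16 * nib v (pos r) + nib v (pos k')) = false := by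
      by_contra hcon
      rw [not_or, Bool.not_eq_false, Bool.not_eq_false] at hcon
      exact hH (hMat_bit (hlt _) (hlt _) (hmem hadj) (hmem hadj.symm) (hne hadj.ne) hr hcon)
    have : nib v (pos k') = nib v (pos r) ∨ nib v (pos k') = nib v (pos k) ∨
        Out (φ k').1 (φ r).1 (φ k).1 := by
      rcases hor2 with h | h
      · exact hT_unset (f := fun i => (pt i).1) hk16 (hN _ (hlt _)) (hN _ (hlt _)) hXU hXD h
      · rcases hT_unset (f := fun i => (pt i).1) hk16 (hN _ (hlt _)) (hN _ (hlt _)) hXU hXD h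
          with h | h | h
        · exact Or.inr (Or.inl h)
        · exact Or.inl h
        · exact Or.inr (Or.inr h.symm)
    rcases this with h | h | h
    · exact Or.inl (hNeq h)
    · exact Or.inr (Or.inl (hNeq h))
    · exact Or.inr (Or.inr (Or.inr (Or.inl h)))

end LTree


namespace LTree

theorem extreme {S : Finset (ℝ × ℝ)} (hS : IsPointSet S) (hne : S.Nonempty) (d : ℕ) :
    ∃ p ∈ S, ∀ q ∈ S, q ≠ p → (d = 0 → q.1 < p.1) ∧ (d = 2 → p.1 < q.1) ∧
      (d = 1 → q.2 < p.2) ∧ (d = 3 → p.2 < q.2) := by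
  by_cases h0 : d = 0
  · subst h0
    obtain ⟨p, hp, hmax⟩ := S.exists_max_image (fun p => p.1) hne
    exact ⟨p, hp, fun q hq hqp => ⟨fun _ => lt_of_le_of_ne (hmax q hq) (hS q hq p hp hqp).1,
      by omega, by omega, by omega⟩⟩
  by_cases h1 : d = 1
  · subst h1
    obtain ⟨p, hp, hmax⟩ := S.exists_max_image (fun p => p.2) hne
    exact ⟨p, hp, fun q hq hqp => ⟨by omega, by omega,
      fun _ => lt_of_le_of_ne (hmax q hq) (hS q hq p hp hqp).2, by omega⟩⟩
  by_cases h2 : d = 2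
  · subst h2
    obtain ⟨p, hp, hmax⟩ := S.exists_min_image (fun p => p.1) hne
    exact ⟨p, hp, fun q hq hqp => ⟨by omega,
      fun _ => lt_of_le_of_ne (hmax q hq) (hS p hp q hq hqp.symm).1, by omega, by omega⟩⟩
  by_cases h3 : d = 3
  · subst h3
    obtain ⟨p, hp, hmax⟩ := S.exists_min_image (fun p => p.2) hne
    exact ⟨p, hp, fun q hq hqp => ⟨by omega, by omega, by omega,
      fun _ => lt_of_le_of_ne (hmax q hq) (hS p hp q hq hqp.symm).2⟩⟩
  obtain ⟨p, hp⟩ := hne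
  exact ⟨p, hp, fun q _ _ => ⟨by omega, by omega, by omega, by omega⟩⟩

theorem naming (n : ℕ) : ∀ (S : Finset (ℝ × ℝ)) (d : ℕ → ℕ), IsPointSet S → S.card = n →
    ∃ pt : ℕ → ℝ × ℝ, (∀ i < n, pt i ∈ S) ∧ (∀ i j, i < j → j < n → pt j ≠ pt i ∧
      (d i = 0 → (pt j).1 < (pt i).1) ∧ (d i = 2 → (pt i).1 < (pt j).1) ∧
      (d i = 1 → (pt j).2 < (pt i).2) ∧ (d i = 3 → (pt i).2 < (pt j).2)) := by
  induction n with
  | zero => intro S d _ _; exact ⟨fun _ => 0, by simp, by simp⟩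
  | succ n ih =>
    intro S d hS hc
    obtain ⟨p, hp, hext⟩ := extreme hS (Finset.card_pos.mp (by omega)) (d 0)
    obtain ⟨pt, h1, h2⟩ := ih (S.erase p) (fun i => d (i + 1))
      (fun a ha b hb => hS a (Finset.mem_of_mem_erase ha) b (Finset.mem_of_mem_erase hb))
      (by rw [Finset.card_erase_of_mem hp]; omega)
    refine ⟨fun i => Nat.casesOn i p pt, ?_, ?_⟩
    · rintro (_ | i) hi
      · exact hp
      · exact Finset.mem_of_mem_erase (h1 i (by omega))
    · rintro (_ | i) (_ | j) hij hj
      · omega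
      · have hq := h1 j (by omega)
        exact ⟨Finset.ne_of_mem_erase hq,
          hext _ (Finset.mem_of_mem_erase hq) (Finset.ne_of_mem_erase hq)⟩
      · omega
      · exact h2 i j (by omega) (by omega)

theorem chkDT_sound {n M : ℕ} (hn : n ≤ 16) {pt : ℕ → ℝ × ℝ}
    (hpt : ∀ i < n, ∀ j < n, i ≠ j → (pt i).1 ≠ (pt j).1 ∧ (pt i).2 ≠ (pt j).2)
    {G : SimpleGraph (Fin n)} {ord : Fin n → List (Fin n)}
    (hord : ∀ v u, u ∈ ord v ↔ G.Adj v u) (hR : Realizes n ord (nbL M))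
    {S : Finset (ℝ × ℝ)} (hS : ∀ i < n, pt i ∈ S) (t : DT) : ∀ (XU XD YU YD : ℕ),
    (Sound n XU fun i j => (pt i).1 < (pt j).1) →
    (Sound n XD fun i j => (pt j).1 < (pt i).1) →
    (Sound n YU fun i j => (pt i).2 < (pt j).2) →
    (Sound n YD fun i j => (pt j).2 < (pt i).2) →
    chkDT n M t XU XD YU YD = true →
    ∃ φ c, IsLEmbedding G S φ c ∧ RespectsOrder φ c ord := by
  have tr1 : ∀ a b c : ℕ, (pt a).1 < (pt b).1 → (pt b).1 < (pt c).1 → (pt a).1 < (pt c).1 :=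
    fun _ _ _ => lt_trans
  have tr2 : ∀ a b c : ℕ, (pt b).1 < (pt a).1 → (pt c).1 < (pt b).1 → (pt c).1 < (pt a).1 :=
    fun _ _ _ h h' => lt_trans h' h
  have tr3 : ∀ a b c : ℕ, (pt a).2 < (pt b).2 → (pt b).2 < (pt c).2 → (pt a).2 < (pt c).2 :=
    fun _ _ _ => lt_trans
  have tr4 : ∀ a b c : ℕ, (pt b).2 < (pt a).2 → (pt c).2 < (pt b).2 → (pt c).2 < (pt a).2 :=
    fun _ _ _ h h' => lt_trans h' h
  induction t with
  | L v =>
    intro XU XD YU YD h1 h2 h3 h4 h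
    exact leaf_sound hn hpt h1 h2 h3 h4 h hord hR hS
  | Q q y z ihy ihz =>
    intro XU XD YU YD h1 h2 h3 h4 h
    change band (Nat.blt (nib q 1) n) (band (Nat.blt (nib q 0) n)
        (bsel (Nat.beq (nib q 1) (nib q 0)) false
          (bsel (Nat.beq (nib q 2) 0)
            (band (chkDT n M y (addRel n XU (nib q 1) (nib q 0)) (addRel n XD (nib q 0) (nib q 1))
                YU YD)
              (chkDT n M z (addRel n XU (nib q 0) (nib q 1)) (addRel n XD (nib q 1) (nib q 0))
                YU YD))
            (band (chkDT n M y XU XD (addRel n YU (nib q 1) (nib q 0))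
                (addRel n YD (nib q 0) (nib q 1)))
              (chkDT n M z XU XD (addRel n YU (nib q 0) (nib q 1))
                (addRel n YD (nib q 1) (nib q 0))))))) = true at h
    generalize nib q 1 = i at h
    generalize nib q 0 = j at h
    simp only [band_eq, bsel_eq, Bool.and_eq_true] at h
    obtain ⟨hi, hj, h⟩ := h
    have hi : i < n := by simpa [Nat.blt] using hi
    have hj : j < n := by simpa [Nat.blt] using hj
    split_ifs at h with hij hax
    · have hne : i ≠ j := fun e => hij (by simp [e])
      simp only [Bool.and_eq_true] at h
      rcases lt_or_gt_of_ne (hpt i hi j hj hne).1 with hlt | hlt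
      · exact ihy _ _ _ _ (sound_addRel hn tr1 h1 hi hj hlt) (sound_addRel hn tr2 h2 hj hi hlt)
          h3 h4 h.1
      · exact ihz _ _ _ _ (sound_addRel hn tr1 h1 hj hi hlt) (sound_addRel hn tr2 h2 hi hj hlt)
          h3 h4 h.2
    · have hne : i ≠ j := fun e => hij (by simp [e])
      simp only [Bool.and_eq_true] at h
      rcases lt_or_gt_of_ne (hpt i hi j hj hne).2 with hlt | hlt
      · exact ihy _ _ _ _ h1 h2 (sound_addRel hn tr3 h3 hi hj hlt)
          (sound_addRel hn tr4 h4 hj hi hlt) h.1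
      · exact ihz _ _ _ _ h1 h2 (sound_addRel hn tr3 h3 hj hi hlt)
          (sound_addRel hn tr4 h4 hi hj hlt) h.2

/-- Every point set of the right size admits an embedding. -/
def Good (n : ℕ) (G : SimpleGraph (Fin n)) (ord : Fin n → List (Fin n)) : Prop :=
  ∀ S : Finset (ℝ × ℝ), IsPointSet S → S.card = n →
    ∃ φ c, IsLEmbedding G S φ c ∧ RespectsOrder φ c ord

theorem certOK_sound {n : ℕ} {C : Cert} (hn : n ≤ 16) (hC : certOK n C = true)
    {G : SimpleGraph (Fin n)} {ord : Fin n → List (Fin n)}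
    (hord : ∀ v u, u ∈ ord v ↔ G.Adj v u) (hR : Realizes n ord (nbL C.M)) : Good n G ord := by
  intro S hS hc
  obtain ⟨pt, hmem, hnm⟩ := naming n S (nib C.ds) hS hc
  have hne : ∀ i < n, ∀ j < n, i ≠ j → pt i ≠ pt j := by
    intro i hi j hj hij
    rcases lt_or_gt_of_ne hij with h | h
    · exact (hnm i j h hj).1.symm
    · exact (hnm j i h hi).1
  refine chkDT_sound hn (fun i hi j hj hij => hS _ (hmem i hi) _ (hmem j hj) (hne i hi j hj hij))
    hord hR hmem C.t _ _ _ _ ?_ ?_ ?_ ?_ hC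
  · exact sound_init hn (fun a b h hb => (hnm a b h hb).2.2.1)
      (fun a b h hb => (hnm b a h hb).2.1)
  · exact sound_init hn (fun a b h hb => (hnm a b h hb).2.1)
      (fun a b h hb => (hnm b a h hb).2.2.1)
  · exact sound_init hn (fun a b h hb => (hnm a b h hb).2.2.2.2)
      (fun a b h hb => (hnm b a h hb).2.2.2.1)
  · exact sound_init hn (fun a b h hb => (hnm a b h hb).2.2.2.1)
      (fun a b h hb => (hnm b a h hb).2.2.2.2)

theorem certsOK_spec {n : ℕ} {l : List Cert} (h : certsOK n l = true) :
    ∀ C ∈ l, certOK n C = true := by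
  induction l with
  | nil => simp
  | cons c l ih =>
    change band (certOK n c) (certsOK n l) = true at h
    simp only [band_eq, Bool.and_eq_true] at h
    intro C hC
    rcases List.mem_cons.mp hC with rfl | hC
    · exact h.1
    · exact ih h.2 C hC

end LTree


namespace LTree

/-- reflection in the vertical axis. -/
def refl (p : ℝ × ℝ) : ℝ × ℝ := (-p.1, p.2)

theorem refl_refl (p : ℝ × ℝ) : refl (refl p) = p := by simp [refl]

theorem refl_inj : Function.Injective refl := fun p q h => by
  rw [← refl_refl p, h, refl_refl]

theorem refl_segment {p a b : ℝ × ℝ} (h : p ∈ segment ℝ (refl a) (refl b)) :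
    refl p ∈ segment ℝ a b := by
  obtain ⟨s, t, hs, ht, hst, rfl⟩ := h
  refine ⟨s, t, hs, ht, hst, ?_⟩
  ext
  · simp [refl]; ring
  · simp [refl]

/-- reflection of directions. -/
def swapDir (d : Fin 4) : Fin 4 := if d = 0 then 2 else if d = 2 then 0 else d

theorem sd2 : ∀ a b : Fin 4, a < b →
    ∃ k < 4, List.IsChain (· < ·) ((([a, b].reverse).map swapDir).rotate k) := by decide

theorem sd3 : ∀ a b c : Fin 4, a < b → b < c →
    ∃ k < 4, List.IsChain (· < ·) ((([a, b, c].reverse).map swapDir).rotate k) := by decide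

theorem sd4 : ∀ a b c d : Fin 4, a < b → b < c → c < d →
    ∃ k < 4, List.IsChain (· < ·) ((([a, b, c, d].reverse).map swapDir).rotate k) := by decide

theorem swap_chain (D : List (Fin 4)) (h : List.IsChain (· < ·) D) :
    ∃ k, List.IsChain (· < ·) ((D.reverse.map swapDir).rotate k) := by
  match D, h with
  | [], _ => exact ⟨0, by simp⟩
  | [a], _ => exact ⟨0, by simp⟩
  | [a, b], h =>
    obtain ⟨k, _, hk⟩ := sd2 a b (by simpa using h)
    exact ⟨k, hk⟩
  | [a, b, c], h =>
    simp only [List.isChain_cons_cons] at h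
    obtain ⟨k, _, hk⟩ := sd3 a b c h.1 h.2.1
    exact ⟨k, hk⟩
  | [a, b, c, d], h =>
    simp only [List.isChain_cons_cons] at h
    obtain ⟨k, _, hk⟩ := sd4 a b c d h.1 h.2.1 h.2.2.1
    exact ⟨k, hk⟩
  | a :: b :: c :: d :: e :: t, h =>
    simp only [List.isChain_cons_cons] at h
    obtain ⟨h1, h2, h3, h4, _⟩ := h
    exact absurd h4 (by omega)

theorem good_mirror {n : ℕ} {G : SimpleGraph (Fin n)} {ord : Fin n → List (Fin n)}
    (hord : ∀ v u, u ∈ ord v ↔ G.Adj v u) (h : Good n G fun v => (ord v).reverse) :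
    Good n G ord := by
  intro S hS hc
  have hS' : IsPointSet (S.image refl) := by
    intro p0 hp0 q0 hq0 hpq
    obtain ⟨p, hp, rfl⟩ := Finset.mem_image.mp hp0
    obtain ⟨q, hq, rfl⟩ := Finset.mem_image.mp hq0
    have := hS p hp q hq (fun e => hpq (by rw [e]))
    exact ⟨fun e => this.1 (neg_injective e), this.2⟩
  obtain ⟨φ, c, ⟨hinj, hmem, hsym, hcor, hcross⟩, hresp⟩ :=
    h (S.image refl) hS' (by rw [Finset.card_image_of_injective _ refl_inj, hc])
  refine ⟨fun v => refl (φ v), fun u v => refl (c u v), ⟨refl_inj.comp hinj, ?_, ?_, ?_, ?_⟩, ?_⟩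
  · intro v
    obtain ⟨p, hp, hpv⟩ := Finset.mem_image.mp (hmem v)
    change refl (φ v) ∈ S
    rw [← hpv, refl_refl]; exact hp
  · intro u v; change refl _ = refl _; rw [hsym]
  · intro u v huv
    rcases hcor u v huv with e | e
    · left; change refl _ = _; rw [e]; rfl
    · right; change refl _ = _; rw [e]; rfl
  · rintro u v a b huv hab hne p ⟨hp1, hp2⟩
    have key : ∀ x y, p ∈ LDraw (fun v => refl (φ v)) (fun u v => refl (c u v)) x y →
        refl p ∈ LDraw φ c x y := by
      rintro x y (hp | hp)
      · exact Or.inl (refl_segment hp)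
      · exact Or.inr (refl_segment hp)
    obtain ⟨w, hw1, hw2, hw⟩ := hcross u v a b huv hab hne (refl p) ⟨key _ _ hp1, key _ _ hp2⟩
    exact ⟨w, hw1, hw2, by rw [← refl_refl p, hw]⟩
  · intro v
    obtain ⟨L, hL, hch⟩ := hresp v
    rw [List.mem_cyclicPermutations_iff] at hL
    have hdir : ∀ u, G.Adj v u → dirOf (fun v => refl (φ v)) (fun u v => refl (c u v)) v u
        = swapDir (dirOf φ c v u) := by
      intro u hvu
      have hx : (φ v).1 ≠ (φ u).1 :=
        (hS' _ (hmem v) _ (hmem u) (fun e => hvu.ne (hinj e))).1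
      have : (-(φ v).1 < -(φ u).1) ↔ ¬ ((φ v).1 < (φ u).1) := by
        rw [neg_lt_neg_iff, not_lt]
        exact ⟨le_of_lt, fun h => lt_of_le_of_ne h hx.symm⟩
      simp only [dirOf, refl, this]
      by_cases a1 : (c v u).2 = (φ v).2 <;> by_cases a2 : (φ v).1 < (φ u).1 <;>
        by_cases a3 : (φ v).2 < (φ u).2 <;> simp only [a1, a2, a3, if_true, if_false] <;> decide
    obtain ⟨k, hk⟩ := swap_chain _ hch
    have hLr : L.reverse ~r ord v := by
      have := hL.reverse
      rwa [List.reverse_reverse] at this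
    refine ⟨L.reverse.rotate k, ?_, ?_⟩
    · rw [List.mem_cyclicPermutations_iff]
      exact (List.IsRotated.symm ⟨k, rfl⟩).trans hLr
    · have e : (L.reverse.rotate k).map
          (fun u => dirOf (fun v => refl (φ v)) (fun u v => refl (c u v)) v u)
          = ((L.map fun u => dirOf φ c v u).reverse.map swapDir).rotate k := by
        rw [List.map_rotate, ← List.map_reverse, List.map_map]
        congr 1
        apply List.map_congr_left
        intro u hu
        exact hdir u ((hord v u).mp (hLr.mem_iff.mp hu))
      rw [e]; exact hk

theorem eqL_spec : ∀ {l m : List ℕ}, eqL l m = true → l = m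
  | [], [], _ => rfl
  | a :: l, b :: m, h => by
    simp only [eqL, band_eq, Bool.and_eq_true] at h
    rw [Nat.eq_of_beq_eq_true h.1, eqL_spec h.2]
  | [], _ :: _, h => by simp [eqL] at h
  | _ :: _, [], h => by simp [eqL] at h

theorem rot1_spec (l : List ℕ) : l ~r rot1 l := by
  cases l with
  | nil => exact List.IsRotated.refl _
  | cons a t => exact ⟨1, by simp [rot1]⟩

theorem rotEq_spec (k : ℕ) : ∀ {l m : List ℕ}, rotEq k l m = true → l ~r m := by
  induction k with
  | zero => intro l m h; rw [eqL_spec h]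
  | succ k ih =>
    intro l m h
    change bsel (eqL l m) true (rotEq k (rot1 l) m) = true at h
    rw [bsel_eq] at h
    split_ifs at h with h'
    · rw [eqL_spec h']
    · exact (rot1_spec l).trans (ih h)

theorem rowsOK_spec {M τ : ℕ} {mir : Bool} {rows : List (List ℕ)} : ∀ {i : ℕ},
    rowsOK M τ mir rows i = true → ∀ k < rows.length,
      (if mir = true then ((rows.getD k []).map (nib τ)).reverse
        else (rows.getD k []).map (nib τ)) ~r nbL M (nib τ (i + k)) := by
  induction rows with
  | nil => intro i _ k hk; simp at hk
  | cons r rs ih =>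
    intro i h k hk
    change band (rotEq 3 (bsel mir (mapL (nib τ) r).reverse (mapL (nib τ) r))
      (nbL M (nib τ i))) (rowsOK M τ mir rs (i + 1)) = true at h
    rw [band_eq, Bool.and_eq_true, bsel_eq, mapL_eq] at h
    cases k with
    | zero => exact rotEq_spec 3 h.1
    | succ k =>
      have := ih h.2 k (by simpa using hk)
      rw [show i + (k + 1) = i + 1 + k by omega]
      exact this

theorem nbL_zero (i : ℕ) : nbL 0 i = [] := by
  have : Nat.land (Nat.shiftRight 0 (Nat.mul 16 i)) 65535 = 0 := by
    change (0 >>> (16 * i)) &&& 65535 = 0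
    simp
  unfold nbL
  rw [this]; rfl

theorem hint_sound {n : ℕ} (hn : n ≤ 16) {l : List Cert} (hl : certsOK n l = true)
    {rows : List (List ℕ)} {h : ℕ} (hh : hintOK n l rows h = true) (hlen : rows.length = n)
    {G : SimpleGraph (Fin n)} {ord : Fin n → List (Fin n)}
    (hord : ∀ v u, u ∈ ord v ↔ G.Adj v u) (hne : ∃ v, ord v ≠ [])
    (hR : Realizes n ord fun i => rows.getD i []) : Good n G ord := by
  simp only [hintOK, band_eq, Bool.and_eq_true] at hh
  obtain ⟨h1, h2⟩ := hh
  obtain ⟨hlt, hinj⟩ := permOK_spec h1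
  have h3 := rowsOK_spec h2
  obtain ⟨pos, pinj, plt, prot⟩ := hR
  have hinj' : Function.Injective fun v => nib h (pos v) := fun a b e =>
    pinj (hinj _ (plt a) _ (plt b) e)
  have hlt' : ∀ v, nib h (pos v) < n := fun v => hlt _ (plt v)
  have hM : (∃ C ∈ l, (l.map Cert.M).getD (Nat.shiftRight h 45) 0 = C.M) ∨
      (l.map Cert.M).getD (Nat.shiftRight h 45) 0 = 0 := by
    generalize Nat.shiftRight h 45 = k
    by_cases hk : k < l.length
    · left; exact ⟨l[k], List.getElem_mem hk, by simp [List.getD, hk]⟩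
    · right; simp [List.getD, Nat.not_lt.mp hk]
  generalize (l.map Cert.M).getD (Nat.shiftRight h 45) 0 = M at h3 hM
  have hrow : ∀ v, nbL M (nib h (pos v)) ~r
      (if tb h 44 = true then (ord v).reverse else ord v).map (fun v => nib h (pos v)) := by
    intro v
    have e1 := (h3 (pos v) (by rw [hlen]; exact plt v)).symm
    rw [Nat.zero_add] at e1
    have e2 := (prot v).map (nib h)
    rw [List.map_map] at e2
    refine e1.trans ?_
    split_ifs
    · rw [List.map_reverse]; exact e2.reverse
    · exact e2
  rcases hM with ⟨C, hC, rfl⟩ | rfl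
  · have hCok := certsOK_spec hl C hC
    by_cases hm : tb h 44 = true
    · simp only [hm, if_true] at hrow
      apply good_mirror hord
      exact certOK_sound hn hCok (fun v u => by rw [List.mem_reverse]; exact hord v u)
        ⟨_, hinj', hlt', hrow⟩
    · simp only [hm] at hrow
      exact certOK_sound hn hCok hord ⟨_, hinj', hlt', hrow⟩
  · exfalso
    obtain ⟨v, hv⟩ := hne
    have := hrow v
    rw [nbL_zero] at this
    have := List.isRotated_nil_iff'.mp this
    split_ifs at this <;> simp_all

theorem hintsOK_spec {n : ℕ} {l : List Cert} {cs : List (List (List ℕ))} : ∀ {hs : List ℕ},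
    hintsOK n l cs hs = true → ∀ c ∈ cs, ∃ h, hintOK n l c h = true := by
  induction cs with
  | nil => simp
  | cons c cs ih =>
    intro hs h
    cases hs with
    | nil => exact absurd h (by change ¬ (false = true); simp)
    | cons a hs =>
      change band (hintOK n l c a) (hintsOK n l cs hs) = true at h
      rw [band_eq, Bool.and_eq_true] at h
      intro d hd
      rcases List.mem_cons.mp hd with rfl | hd
      · exact ⟨a, h.1⟩
      · exact ih h.2 d hd

end LTree


namespace LTree

theorem map_idxOf_mid {α : Type} [DecidableEq α] (A B C : List α) (h : (A ++ B ++ C).Nodup) :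
    B.map (fun u => (A ++ B ++ C).idxOf u) = List.range' A.length B.length := by
  apply List.ext_getElem
  · simp
  · intro i h1 h2
    have hi : i < B.length := by simpa using h1
    have e : (A ++ B ++ C)[A.length + i]'(by simp; omega) = B[i] := by
      rw [List.getElem_append_left (by simp; omega), List.getElem_append_right (by omega)]
      simp
    rw [List.getElem_map, ← e, List.Nodup.idxOf_getElem h]
    simp

theorem bfs {n : ℕ} {r : Fin n} {par : Fin n → Fin n} {ch : Fin n → List (Fin n)}
    (h1 : ∀ v u, u ∈ ch v ↔ u ≠ r ∧ par u = v)
    (hnd : ∀ v, (ch v).Nodup)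
    (h4 : ∀ v, v ≠ r → (ch v).length ≤ 3)
    (h5 : ∀ P : Fin n → Prop, P r → (∀ u, u ≠ r → P (par u) → P u) → ∀ v, P v) :
    ∀ (f : ℕ) (D Q : List (Fin n)), (D ++ Q).Nodup → D.length + f = n → r ∈ D →
      (∀ u, u ∈ D ++ Q ↔ u = r ∨ (u ≠ r ∧ par u ∈ D)) →
      ∃ rest ∈ enum n f D.length (D ++ Q).length (Q.map fun v => D.idxOf (par v)),
      ∃ T : List (Fin n), (D ++ Q ++ T).Nodup ∧ (∀ v, v ∈ D ++ Q ++ T) ∧ rest.length = f ∧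
        ∀ v, D.length ≤ (D ++ Q ++ T).idxOf v →
          rest.getD ((D ++ Q ++ T).idxOf v - D.length) [] =
            (par v :: ch v).map (fun u => (D ++ Q ++ T).idxOf u) := by
  have hfull : ∀ D : List (Fin n), D.Nodup → D.length = n → ∀ v, v ∈ D := by
    intro D hD hlen v
    have hc : D.toFinset.card = n := by rw [List.toFinset_card_of_nodup hD, hlen]
    have := Finset.eq_univ_of_card D.toFinset (by rw [hc, Fintype.card_fin])
    rw [← List.mem_toFinset, this]; exact Finset.mem_univ v
  have hle : ∀ D : List (Fin n), D.Nodup → D.length ≤ n := by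
    intro D hD
    simpa using hD.length_le_card
  intro f
  induction f with
  | zero =>
    intro D Q hN hlen hr hinv
    have hD := hfull D (List.Nodup.of_append_left hN) (by omega)
    refine ⟨[], by simp [enum], [], by simpa using hN, fun v => by simp [hD v], rfl, ?_⟩
    intro v hv
    exfalso
    rw [List.append_nil, List.idxOf_append_of_mem (hD v)] at hv
    exact absurd (List.idxOf_lt_length_iff.mpr (hD v)) (by omega)
  | succ f ih =>
    intro D Q hN hlen hr hinv
    cases Q with
    | nil =>
      exfalso
      have : ∀ v, v ∈ D := by
        apply h5 (fun v => v ∈ D) hr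
        intro u hu hp
        have := (hinv u).mpr (Or.inr ⟨hu, hp⟩)
        simpa using this
      have hc : D.toFinset = Finset.univ := by
        ext v; simp [this v]
      have h6 := List.toFinset_card_of_nodup (List.Nodup.of_append_left hN)
      rw [hc, Finset.card_univ, Fintype.card_fin] at h6
      omega
    | cons v Q =>
      have hvD : v ∉ D := by
        intro h
        have := List.disjoint_of_nodup_append hN h
        simp at this
      have hvr : v ≠ r := fun e => hvD (e ▸ hr)
      have hpv : par v ∈ D := by
        rcases (hinv v).mp (by simp) with h | h
        · exact absurd h hvr
        · exact h.2
      have hchN : ∀ u ∈ ch v, u ∉ D ++ v :: Q := by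
        intro u hu hu2
        obtain ⟨hur, hpu⟩ := (h1 v u).mp hu
        rcases (hinv u).mp hu2 with h | h
        · exact hur h
        · exact hvD (hpu ▸ h.2)
      have eL : (D ++ [v]) ++ (Q ++ ch v) = (D ++ v :: Q) ++ ch v := by simp
      have hN' : ((D ++ [v]) ++ (Q ++ ch v)).Nodup := by
        rw [eL]
        refine List.Nodup.append hN (hnd v) ?_
        intro u hu hu'
        exact hchN u hu' hu
      have hinv' : ∀ u, u ∈ (D ++ [v]) ++ (Q ++ ch v) ↔ u = r ∨ (u ≠ r ∧ par u ∈ D ++ [v]) := by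
        intro u
        rw [eL, List.mem_append, hinv u, h1 v u, List.mem_append, List.mem_singleton]
        tauto
      obtain ⟨rest, hrest, T, hT1, hT2, hT3, hT4⟩ := ih (D ++ [v]) (Q ++ ch v) hN'
        (by simp; omega) (by simp [hr]) hinv'
      have epars : (Q ++ ch v).map (fun u => (D ++ [v]).idxOf (par u)) =
          Q.map (fun u => D.idxOf (par u)) ++ List.replicate (ch v).length D.length := by
        rw [List.map_append]
        congr 1
        · apply List.map_congr_left
          intro u hu
          apply List.idxOf_append_of_mem
          rcases (hinv u).mp (by simp [hu]) with h | h
          · exfalso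
            have := List.disjoint_of_nodup_append hN hr
            apply this
            rw [← h]; simp [hu]
          · exact h.2
        · rw [List.eq_replicate_iff]
          refine ⟨by simp, ?_⟩
          intro b hb
          obtain ⟨u, hu, rfl⟩ := List.mem_map.mp hb
          rw [((h1 v u).mp hu).2, List.idxOf_append_of_notMem hvD]
          simp
      have elen : ((D ++ [v]) ++ (Q ++ ch v)).length = (D ++ v :: Q).length + (ch v).length := by
        rw [eL, List.length_append]
      rw [epars, elen, List.length_append, List.length_singleton] at hrest
      have hsn : (D ++ v :: Q).length + (ch v).length ≤ n := by
        rw [← elen]; exact hle _ hN'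
      have eT : (D ++ [v]) ++ (Q ++ ch v) ++ T = (D ++ v :: Q) ++ (ch v ++ T) := by simp
      rw [eT] at hT1 hT2 hT4
      refine ⟨(D.idxOf (par v) :: List.range' (D ++ v :: Q).length (ch v).length) :: rest, ?_,
        ch v ++ T, hT1, hT2, by simp [hT3], ?_⟩
      · have h3 := h4 v hvr
        simp only [List.map_cons, enum, List.mem_flatMap]
        have hc4 : ∀ c ≤ 3, c ∈ [0, 1, 2, 3] := by decide
        refine ⟨(ch v).length, hc4 _ h3, ?_⟩
        rw [bsel_eq, if_pos (Nat.ble_eq.mpr hsn)]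
        exact List.mem_map_of_mem hrest
      · intro u hu
        have hrow : D.idxOf (par v) :: List.range' (D ++ v :: Q).length (ch v).length =
            (par v :: ch v).map (fun u => (D ++ v :: Q ++ (ch v ++ T)).idxOf u) := by
          rw [List.map_cons]
          congr 1
          · rw [List.append_assoc, List.idxOf_append_of_mem hpv]
          · rw [← List.append_assoc] at hT1 ⊢
            exact (map_idxOf_mid _ _ _ hT1).symm
        have hidx : (D ++ v :: Q ++ (ch v ++ T)).idxOf v = D.length := by
          rw [List.append_assoc, List.idxOf_append_of_notMem hvD]
          simp
        rcases Nat.eq_or_lt_of_le hu with he | hlt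
        · have : u = v := by
            have h7 := List.idxOf_inj (hT2 u) |>.mp (he.symm.trans hidx.symm)
            exact h7
          subst this
          rw [hidx, Nat.sub_self]
          exact hrow
        · have := hT4 u (by simpa using hlt)
          rw [← this, show (D ++ [v]).length = D.length + 1 by simp]
          obtain ⟨m, hm⟩ : ∃ m, (D ++ v :: Q ++ (ch v ++ T)).idxOf u = D.length + 1 + m :=
            ⟨_, (Nat.add_sub_cancel' hlt).symm⟩
          rw [hm, show D.length + 1 + m - D.length = m + 1 by omega,
            show D.length + 1 + m - (D.length + 1) = m by omega]
          rfl

theorem par_unique {n : ℕ} {G : SimpleGraph (Fin n)} (hT : G.IsTree) {r u u' v : Fin n}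
    (hu : G.Adj u v) (hu' : G.Adj u' v) (hd : G.dist r v = G.dist r u + 1)
    (hd' : G.dist r v = G.dist r u' + 1) : u = u' := by
  obtain ⟨p, hp⟩ := hT.connected.exists_walk_length_eq_dist r u
  obtain ⟨p', hp'⟩ := hT.connected.exists_walk_length_eq_dist r u'
  have q : (p.concat hu).IsPath := SimpleGraph.Walk.isPath_of_length_eq_dist _ (by
    rw [SimpleGraph.Walk.length_concat, hp, hd])
  have q' : (p'.concat hu').IsPath := SimpleGraph.Walk.isPath_of_length_eq_dist _ (by
    rw [SimpleGraph.Walk.length_concat, hp', hd'])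
  have e : (⟨_, q⟩ : G.Path r v) = ⟨_, q'⟩ := (hT.isAcyclic.subsingleton_path r v).elim _ _
  have e' : p.concat hu = p'.concat hu' := congrArg Subtype.val e
  have := congrArg SimpleGraph.Walk.penultimate e'
  simpa using this

theorem par_exists {n : ℕ} {G : SimpleGraph (Fin n)} (hT : G.IsTree) {r v : Fin n}
    (hv : v ≠ r) : ∃ u, G.Adj u v ∧ G.dist r v = G.dist r u + 1 := by
  obtain ⟨p, hp⟩ := hT.connected.exists_walk_length_eq_dist r v
  have hnil : ¬ p.Nil := SimpleGraph.Walk.not_nil_of_ne hv.symm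
  refine ⟨p.penultimate, p.adj_penultimate hnil, ?_⟩
  have h1 : G.dist r p.penultimate ≤ p.dropLast.length := SimpleGraph.dist_le _
  have h2 : p.dropLast.length + 1 = p.length := SimpleGraph.Walk.length_dropLast_add_one hnil
  rcases hT.dist_eq_dist_add_one_of_adj r (p.adj_penultimate hnil) with h | h <;> omega

theorem complete {n : ℕ} (hn : 2 ≤ n) {G : SimpleGraph (Fin n)} {ord : Fin n → List (Fin n)}
    (hG : IsOrderedTree G ord) :
    ∃ code ∈ codes n, code.length = n ∧ (∃ v, ord v ≠ []) ∧
      Realizes n ord fun i => code.getD i [] := by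
  classical
  obtain ⟨hT, hG⟩ := hG
  have : Nontrivial (Fin n) := Fin.nontrivial_iff_two_le.mpr hn
  obtain ⟨r, hr⟩ := hT.exists_vert_degree_one_of_nontrivial
  have hordN : ∀ v, (ord v).Nodup := fun v => (hG v).1
  have hord : ∀ v u, u ∈ ord v ↔ G.Adj v u := fun v => (hG v).2.2
  obtain ⟨r1, hr1⟩ : ∃ r1, ord r = [r1] := by
    have : (ord r).length = 1 := by
      rw [← hr, ← List.toFinset_card_of_nodup (hordN r), ← SimpleGraph.card_neighborFinset_eq_degree]
      congr 1
      ext u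
      simp [hord]
    exact List.length_eq_one_iff.mp this
  have hex : ∀ v, ∃ u, v ≠ r → G.Adj u v ∧ G.dist r v = G.dist r u + 1 := by
    intro v
    by_cases hv : v = r
    · exact ⟨v, fun h => absurd hv h⟩
    · obtain ⟨u, hu⟩ := par_exists hT hv
      exact ⟨u, fun _ => hu⟩
  choose par hpar using hex
  have hex2 : ∀ v, ∃ c : List (Fin n), (v = r → c = ord v) ∧ (v ≠ r → ord v ~r par v :: c) := by
    intro v
    by_cases hv : v = r
    · exact ⟨ord v, fun _ => rfl, fun h => absurd hv h⟩
    · have hm : par v ∈ ord v := (hord v _).mpr (hpar v hv).1.symm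
      obtain ⟨A, B, hAB⟩ := List.append_of_mem hm
      refine ⟨B ++ A, fun h => absurd h hv, fun _ => ?_⟩
      rw [hAB]
      have := List.isRotated_append (l := A) (l' := par v :: B)
      simpa using this
  choose ch hchr hch using hex2
  have hd0 : ∀ v, v ≠ r → par v ≠ v := fun v hv => (hpar v hv).1.ne
  have hnd' : ∀ v, v ≠ r → (par v :: ch v).Nodup := fun v hv =>
    (hch v hv).nodup_iff.mp (hordN v)
  have h1 : ∀ v u, u ∈ ch v ↔ u ≠ r ∧ par u = v := by
    intro v u
    by_cases hv : v = r
    · rw [hchr v hv, hord]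
      subst hv
      constructor
      · intro h
        have hne : u ≠ v := h.ne.symm
        refine ⟨hne, ?_⟩
        refine par_unique hT (hpar u hne).1 h (hpar u hne).2 ?_
        rcases hT.dist_eq_dist_add_one_of_adj v h with h' | h'
        · rw [SimpleGraph.dist_self] at h'; omega
        · exact h'
      · rintro ⟨h2, h3⟩
        have := (hpar u h2).1
        rwa [h3] at this
    · have hm : u ∈ ord v ↔ u = par v ∨ u ∈ ch v := by
        rw [(hch v hv).mem_iff, List.mem_cons]
      have hnp : par v ∉ ch v := (List.nodup_cons.mp (hnd' v hv)).1
      constructor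
      · intro hu
        have hadj : G.Adj v u := (hord v u).mp (hm.mpr (Or.inr hu))
        rcases hT.dist_eq_dist_add_one_of_adj r hadj with h' | h'
        · exfalso
          have := par_unique hT (hpar v hv).1 hadj.symm (hpar v hv).2 h'
          exact hnp (this ▸ hu)
        · have hur : u ≠ r := by
            rintro rfl
            rw [SimpleGraph.dist_self] at h'; omega
          exact ⟨hur, par_unique hT (hpar u hur).1 hadj (hpar u hur).2 h'⟩
      · rintro ⟨hur, hpu⟩
        have h6 := hpar u hur
        rw [hpu] at h6
        rcases hm.mp ((hord v u).mpr h6.1) with h | h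
        · exfalso
          have h7 := (hpar v hv).2
          rw [← h] at h7
          omega
        · exact h
  have hnd : ∀ v, (ch v).Nodup := by
    intro v
    by_cases hv : v = r
    · rw [hchr v hv]; exact hordN v
    · exact (List.nodup_cons.mp (hnd' v hv)).2
  have h4 : ∀ v, v ≠ r → (ch v).length ≤ 3 := by
    intro v hv
    have h6 := (hch v hv).perm.length_eq
    have h7 := (hG v).2.1
    simp at h6
    omega
  have h5 : ∀ P : Fin n → Prop, P r → (∀ u, u ≠ r → P (par u) → P u) → ∀ v, P v := by
    intro P hP hstep
    have : ∀ k v, G.dist r v = k → P v := by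
      intro k
      induction k with
      | zero =>
        intro v hv
        have : r = v := hT.connected.dist_eq_zero_iff.mp hv
        exact this ▸ hP
      | succ k ih =>
        intro v hv
        have hvr : v ≠ r := by
          rintro rfl
          simp at hv
        exact hstep v hvr (ih _ (by have := (hpar v hvr).2; omega))
    exact fun v => this _ v rfl
  have hchr' : ch r = [r1] := by rw [hchr r rfl, hr1]
  have hr1r : r1 ≠ r ∧ par r1 = r := (h1 r r1).mp (by rw [hchr']; simp)
  obtain ⟨rest, hrest, T, hT1, hT2, hT3, hT4⟩ := bfs h1 hnd h4 h5 (n - 1) [r] [r1]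
    (by simpa using hr1r.1.symm) (by simp; omega) (by simp) (by
      intro u
      have := h1 r u
      rw [hchr'] at this
      simp only [List.cons_append, List.nil_append, List.mem_cons, List.not_mem_nil, or_false]
        at this ⊢
      rw [this])
  have elen : ([r] ++ [r1] ++ T).length = n := by
    have h6 := List.toFinset_card_of_nodup hT1
    have h7 : ([r] ++ [r1] ++ T).toFinset = Finset.univ := by
      ext v; rw [List.mem_toFinset]; simp only [hT2 v, Finset.mem_univ]
    rw [h7, Finset.card_univ, Fintype.card_fin] at h6
    exact h6.symm
  refine ⟨[1] :: rest, ?_, by simp [hT3]; omega, ⟨r, by simp [hr1]⟩,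
    fun v => ([r] ++ [r1] ++ T).idxOf v, ?_, ?_, ?_⟩
  · unfold codes
    apply List.mem_map_of_mem
    simpa [hr1r.2] using hrest
  · intro a b hab
    exact (List.idxOf_inj (hT2 a)).mp hab
  · intro v
    have := List.idxOf_lt_length_iff.mpr (hT2 v)
    rwa [elen] at this
  · intro v
    by_cases hv : v = r
    · subst hv
      have e1 : ([v] ++ [r1] ++ T).idxOf v = 0 := by simp
      have e2 : ([v] ++ [r1] ++ T).idxOf r1 = 1 := by
        simp [hr1r.1.symm]
      rw [hr1]
      simp only [e1, List.map_cons, List.map_nil, e2]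
      exact List.IsRotated.refl _
    · have hpos : 1 ≤ ([r] ++ [r1] ++ T).idxOf v := by
        have : ([r] ++ [r1] ++ T).idxOf v ≠ 0 := by
          intro h0
          have e1 : ([r] ++ [r1] ++ T).idxOf r = 0 := by simp
          exact hv ((List.idxOf_inj (hT2 v)).mp (h0.trans e1.symm))
        omega
      have h6 := hT4 v hpos
      have h7 := ((hch v hv).map (fun u => ([r] ++ [r1] ++ T).idxOf u)).symm
      rw [← h6] at h7
      obtain ⟨m, hm⟩ : ∃ m, ([r] ++ [r1] ++ T).idxOf v = m + 1 := ⟨_, (Nat.sub_add_cancel hpos).symm⟩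
      rw [hm] at h7
      change ([1] :: rest).getD (([r] ++ [r1] ++ T).idxOf v) [] ~r _
      rw [hm]
      exact h7

theorem main {n : ℕ} (hn : 2 ≤ n) (hn16 : n ≤ 16) {l : List Cert} {hs : List ℕ}
    (hl : certsOK n l = true) (hh : hintsOK n l (codes n) hs = true)
    (G : SimpleGraph (Fin n)) (ord : Fin n → List (Fin n)) (hG : IsOrderedTree G ord) :
    Good n G ord := by
  obtain ⟨code, hcode, hlen, hne, hR⟩ := complete hn hG
  obtain ⟨h, hh⟩ := hintsOK_spec hh code hcode
  exact hint_sound hn16 hl hh hlen (fun v => (hG.2 v).2.2) hne hR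

end LTree


namespace LTree

theorem good_one (G : SimpleGraph (Fin 1)) (ord : Fin 1 → List (Fin 1))
    (hG : IsOrderedTree G ord) : Good 1 G ord := by
  intro S hS hc
  obtain ⟨p, rfl⟩ := Finset.card_eq_one.mp hc
  have hadj : ∀ u v, ¬ G.Adj u v := fun u v h => h.ne (Subsingleton.elim u v)
  refine ⟨fun _ => p, fun _ _ => p, ⟨fun a b _ => Subsingleton.elim a b, by simp, by simp,
    fun u v h => absurd h (hadj u v), fun u v a b h => absurd h (hadj u v)⟩, ?_⟩
  intro v
  have : ord v = [] := List.eq_nil_iff_forall_not_mem.mpr fun u hu =>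
    hadj v u (((hG.2 v).2.2 u).mp hu)
  refine ⟨[], ?_, List.IsChain.nil⟩
  rw [this, List.mem_cyclicPermutations_iff]

end LTree

namespace LTree

open DT

set_option maxRecDepth 100000

/-- certificates for `n = 2`. -/
def certs2 : List Cert := [
  ⟨65538, 16, (L 35184372088848)⟩]
/-- hints for `n = 2`. -/
def hints2 : List ℕ := [
  16]

theorem a2 : certsOK 2 certs2 = true := by decide +kernel

theorem b2 : hintsOK 2 certs2 (codes 2) hints2 = true := by decide +kernel

/-- certificates for `n = 3`. -/
def certs3 : List Cert := [
  ⟨8593145858, 528, (L 528)⟩]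
/-- hints for `n = 3`. -/
def hints3 : List ℕ := [
  528]

theorem a3 : certsOK 3 certs3 = true := by decide +kernel

theorem b3 : hintsOK 3 certs3 (codes 3) hints3 = true := by decide +kernel

/-- certificates for `n = 4`. -/
def certs4 : List Cert := [
  ⟨844708401184770, 12816, (L 246290604622625)⟩, ⟨562958613676034, 12816, (L 70368744181810)⟩]
/-- hints for `n = 4`. -/
def hints4 : List ℕ := [
  12816, 35184372101648]

theorem a4 : certsOK 4 certs4 = true := by decide +kernel

theorem b4 : hintsOK 4 certs4 (codes 4) hints4 = true := by decide +kernel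

/-- certificates for `n = 5`. -/
def certs5 : List Cert := [
  ⟨73810339001376243714, 13072, (L 527765581337650)⟩,
  ⟨55341082427087978498, 12816, (L 527765581341505)⟩,
  ⟨36894051107374956546, 12816, (L 140737488421698)⟩]
/-- hints for `n = 5`. -/
def hints5 : List ℕ := [
  274960, 35184372363792, 35184372093987, 52776558149923, 70368744452624]

theorem a5 : certsOK 5 certs5 = true := by decide +kernel

theorem b5 : hintsOK 5 certs5 (codes 5) hints5 = true := by decide +kernel

/-- certificates for `n = 6`. -/
def certs6 : List Cert := [
  ⟨6046473795843223366729730, 2171169, (L 1090715536020512)⟩,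
  ⟨4835777521143082302636034, 1048832, (L 562949958812432)⟩,
  ⟨3626851269189485970128898, 1053200, (L 562949955597632)⟩,
  ⟨3626832800031867728363522, 1061392, (L 281474979992896)⟩,
  ⟨2417906980311685538054146, 2302755, (Q 36 (L 949978047665184) (L 211106237780547))⟩]
/-- hints for `n = 6`. -/
def hints6 : List ℕ := [
  5517840, 35184377606672, 87960934634000, 70368748712464, 105553121784336, 35184372163892,
  158329677817104, 52776558219828, 70368748384549, 140737492767248, 105553116353571,
  105553116468516, 123145302593827]

theorem a6 : certsOK 6 certs6 = true := by decide +kernel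

theorem b6 : hintsOK 6 certs6 (codes 6) hints6 = true := by decide +kernel

/-- certificates for `n = 7`. -/
def certs7 : List Cert := [
  ⟨475510421251178707252197523458, 36844082, (L 20276256)⟩,
  ⟨396146892101682911278602977282, 201523, (L 1653665592328720)⟩,
  ⟨316918696531357596755808026626, 1052688, (L 101930016)⟩,
  ⟨316917485842648943988726366210, 34681360, (L 1653665491477825)⟩,
  ⟨237689323320314163559515881474, 19079203, (Q 339 (L 281475043898722) (L 422212532254050))⟩,
  ⟨158461160806049818269507977218, 17838098, (Q 101 (L 1442559256839523) (L 774056236373570))⟩,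
  ⟨475508001628652053514800922626, 50405889, (L 1688849896982097)⟩,
  ⟨237688114394062325411904290818, 34615824, (L 1653665522795875)⟩,
  ⟨237690533998119722575012626434, 52433696, (L 844424965076544)⟩,
  ⟨158459951861328707054933704706, 33624579, (Q 69 (L 774056237360450) (L 1935140486915651))⟩]
/-- hints for `n = 7`. -/
def hints7 : List ℕ := [
  106181136, 35184478269968, 87961018708496, 70368834630160, 105553222447632, 70368745382725,
  158329746973200, 87960931672901, 211106337731088, 140737576841744, 263882861273616,
  281475067163152, 246290678362640, 35184373282373, 193514119046672, 140737489806644,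
  158329680766005, 334251589707280, 52776559338309, 175921948746256, 87960931607606,
  70368749503030, 140737576448294, 140737489814069, 158329680777780, 158329678926630,
  316659437101584, 105553117472052, 316659355178019, 105553117586997, 246290671932965,
  316659355292964, 123145303712308, 281474982044707, 263882795258661, 334251635790115]

theorem a7 : certsOK 7 certs7 = true := by decide +kernel

theorem b7 : hintsOK 7 certs7 (codes 7) hints7 = true := by decide +kernel

/-- certificates for `n = 8`. -/
def certs8 : List Cert := [
  ⟨36356694724966870413632700127707138, 555819297, (L 4468415579776032)⟩,
  ⟨31154259137510295520650779971092482, 571486208, (L 895959568)⟩,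
  ⟨25961959803133168253222691005333506, 35651585, (L 1688849879353189)⟩,
  ⟨20769662944560562269289989817827330, 301989906, (L 1970325142394720)⟩,
  ⟨25961880440170702735371074836430850, 143888, (L 1125900747044432)⟩,
  ⟨20769583581031412773494016223281154, 540090658, (Q 100 (L 562950581928720) (L 844425558639376))⟩,
  ⟨15577286722496584568511563683659778, 17826576, (Q 308 (L 1653665758922087) (L 1090716893922930))⟩,
  ⟨10384989863961756939972271395635202, 856764929, (Q 84 (L 3342515669726528) (L 1618481136432450))⟩,
  ⟨36356536133242150592522203738210306, 555819809, (L 69690673)⟩,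
  ⟨20769504352835851095090777979682818, 839922192, (L 1125900747106112)⟩,
  ⟨15577207494301014243197040888709122, 34804528, (Q 70 (L 3623992205395539) (L 3483254717040211))⟩,
  ⟨20769662943349874641501133305085954, 570568992, (L 1688850686699344)⟩,
  ⟨15577366084815037789607396214112258, 320868880, (Q 326 (L 281476875699794) (L 4046202829497393))⟩,
  ⟨15577207493090325534544273807048706, 556802352, (Q 356 (L 2920303722317429) (Q 340 (L 2920302903776354) (L 1653666026309237)))⟩,
  ⟨10384910634555497906004981519024130, 271790593, (Q 84 (L 1618481955370305) (L 3905465956263235))⟩,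
  ⟨36356456903868939549089007446065154, 303174162, (Q 356 (L 281475301205024) (L 422212789560352))⟩,
  ⟨15577128264927803199895785991897090, 807481379, (Q 115 (L 1688851036780369) (L 1407375990929013))⟩,
  ⟨10384831406392975571224552308539394, 1192722, (Q 99 (L 774057561768807) (Q 101 (L 4186940400293426) (L 4046202911938098)))⟩,
  ⟨15577366083606111537785741276938242, 839922192, (L 1688850705504064)⟩,
  ⟨15577286722496566099386930790727682, 824193312, (Q 342 (L 844426860897856) (L 1407375708088128))⟩,
  ⟨10384752177021516585768049739628546, 303182112, (Q 325 (Q 101 (L 1407375707764038) (L 3061040673941332)) (L 1407375426139713))⟩]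
/-- hints for `n = 8`. -/
def hints8 : List ℕ := [
  1985229328, 35186357318160, 87962632335888, 70370477748752, 140739473584656, 123147001475600,
  193515493995024, 105554818380304, 281476946211344, 175923562557968, 334252950893072,
  387029826548240, 316660814983696, 70368763278422, 228699865838096, 369437322736144,
  439806334300688, 474990187344400, 87960949568598, 211107931697680, 281475000984389,
  299067281646405, 545358932566544, 422214164230672, 351845168394768, 527767548867088,
  457398536319504, 316659368158021, 580543300661776, 387028114109270, 650912061551120,
  668504771801616, 334251558380357, 633318799790644, 633320383001104, 562951370453520,
  35184391178070, 263884237907728, 211106256795205, 228698537211206, 510174559414032,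
  175921879791173, 615727672731408, 193514070750534, 527765700224308, 615728396969013,
  562949977941300, 668503121536581, 580542247543861, 52776577234006, 246292303540752,
  211106256802630, 228698537222981, 492582908162576, 87960949503303, 211107931238695,
  70368767398727, 105554732204599, 228699861685031, 422212489585972, 369436025758774,
  175921966432823, 457398535860519, 175921879798598, 598134444409397, 193514070762309,
  545359652803124, 598135741313552, 193514068911159, 351843806298678, 439804759200308,
  598135735267622, 562949977948725, 686095374443077, 580542247555636, 474989095949095,
  140737507456581, 492581327889716, 457396861429044, 474989141837110, 721280505636624,
  140737507571526, 492581328004661, 334251557013047, 316659434006326, 562951362909990,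
  457396861543989, 474989142090805, 580542211896871, 703687565710628, 158329693696837,
  510175275737652, 387028116206900, 404620381090356, 686096698863907, 334251557332022,
  316659434144311, 633320375660839, 562951363113255, 457396861616694, 474989142041140,
  668503175689251, 580542212281126, 703688854692368]

theorem a8 : certsOK 8 certs8 = true := by decide +kernel

theorem b8 : hintsOK 8 certs8 (codes 8) hints8 = true := by decide +kernel

/-- certificates for `n = 9`. -/
def certs9 : List Cert := [
  ⟨2723042982809861689755918883625681092610, 9432085042, (L 8972015493477681)⟩,
  ⟨2382013107682980643979069700247766761474, 8876405520, (L 6720215660918353)⟩,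
  ⟨2041730558223141112739053382909260005378, 8623620658, (L 3377704053671763)⟩,
  ⟨1701448191299417326688585015685775687682, 4850786593, (L 8972049566884896)⟩,
  ⟨2041725355829334132490041985266948833282, 570630432, (L 2251808476526129)⟩,
  ⟨1701442988863829870113692033765619073026, 13709214210, (Q 312 (L 3940675833320480) (L 3940685664703520))⟩,
  ⟨1361160621942891364149667598853385289730, 12937474098, (Q 99 (L 6755430063048000) (L 5629508396152916))⟩,
  ⟨1020878255021952900685644482970880376834, 4347605027, (Q 67 (L 6755430046132305) (L 5629508144359301))⟩,
  ⟨680595888101014437222269865643658510338, 8592163107, (Q 374 (L 6720219957921088) (L 3307340378375489))⟩,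
  ⟨2723032588074939856053758473616558718978, 8623559170, (L 1688863841420832)⟩,
  ⟨1701437796564496130505899793078757163010, 857743905, (L 2251800995975969)⟩,
  ⟨1361155429643556987022400170764419530754, 4883357696, (Q 88 (L 1688877564002832) (L 1970360862331408))⟩,
  ⟨1020873062722618523558377054881914617858, 9144705283, (Q 101 (L 6720219422156098) (L 2251800657094529))⟩,
  ⟨2723027395778081283447774540915371212802, 3153968, (L 1970330533323808)⟩,
  ⟨1361150237346698414426144013258352295938, 4850782258, (L 6720223933072963)⟩,
  ⟨1701448191220054435058564407114284990466, 35787312, (L 3377712724469058)⟩,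
  ⟨1361165824299115291575064784799947358210, 9178386432, (Q 103 (L 562968031355408) (L 844443008066064))⟩,
  ⟨1020883457378176828111041668917442445314, 4331733553, (Q 391 (L 5594323822806609) (Q 390 (L 5312848846095953) (L 5594328401872704)))⟩,
  ⟨1361155429564194024556882319148250628098, 9129037843, (Q 52 (L 3236967072805975) (Q 131 (L 1125900215338360) (L 3096229584450647)))⟩,
  ⟨1020873062643255561092859203265745715202, 9144697634, (Q 86 (L 3236980258792720) (Q 133 (L 5629513080263696) (L 3236980258788880)))⟩,
  ⟨680590695722317097629484585938523848706, 13723762737, (Q 308 (L 1125906182067250) (L 5664692874204208))⟩,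
  ⟨2723027395698717754298278744941776666626, 13187027474, (Q 390 (L 562955176928288) (L 844430153638944))⟩,
  ⟨1361150237267334885276648217284757749762, 8909886240, (Q 326 (L 2920311792420487) (L 6157265672628341))⟩,
  ⟨1020867870346396421802897326207132565506, 823144736, (Q 356 (Q 66 (L 6825789719258209) (L 7001694399840854)) (Q 52 (L 3623998939415912) (L 4468423866660200)))⟩,
  ⟨680585503425457958339522708879910699010, 321069105, (Q 104 (Q 84 (L 6157274024593031) (L 3342516810703921)) (Q 100 (L 6086905280415367) (L 2814750324189301)))⟩,
  ⟨2723022203401859219470073762489237045250, 8641519665, (Q 100 (L 1125901283911555) (L 7423912999938128))⟩,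
  ⟨1020862678049537886974692492188662693890, 4564590898, (Q 308 (L 5594343096403794) (L 6157291156097141))⟩,
  ⟨1361165824219887096014467245472272678914, 839922195, (L 5594332394846289)⟩,
  ⟨1020883457298948632540716354394647494658, 53481744, (Q 131 (L 8127591149372193) (L 4503635431143232))⟩,
  ⟨2723027395619489558736600341703533068290, 839922192, (L 7846116102404177)⟩,
  ⟨1020867870267168226241218922968888967170, 4866519553, (Q 87 (L 1125914436196225) (L 7846121471112512))⟩,
  ⟨1361165824378477610038013655827598082050, 13741793331, (L 5031373819832197)⟩,
  ⟨1361160621942890153463120673907441467394, 13203669554, (Q 296 (L 1688875901093187) (L 3940654089004355))⟩,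
  ⟨1020878255021951689989369782829816283138, 4312859138, (Q 322 (L 1407398094840881) (Q 386 (L 1548135583196209) (L 2111085536617521)))⟩,
  ⟨1020867870425758740264765333324214370306, 8875217696, (Q 373 (L 7283170982516610) (Q 118 (L 7283166406604355) (L 2709231333566290)))⟩,
  ⟨680585503504820276801390715996992503810, 13155565617, (Q 355 (L 6227642790938160) (L 1688856375096882))⟩,
  ⟨1020862678128900205427913588021193146370, 8858567186, (Q 359 (L 3940669003494995) (Q 72 (L 3940655366112800) (L 3377705412691488)))⟩,
  ⟨2723022203322629813211039795199360434178, 824193312, (Q 388 (L 8409070669154419) (L 1548122576078929))⟩,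
  ⟨1020862677970308480715658524898786082818, 5120336176, (Q 325 (L 2814754901484661) (Q 328 (Q 117 (L 6157265436886406) (L 2814754901484631)) (L 6157265436820856)))⟩,
  ⟨680580311049370017252283759137494466562, 8875287089, (Q 327 (Q 308 (L 7423926151951478) (Q 310 (L 2814754604671816) (L 1618515778221173))) (Q 323 (L 2814751500502066) (L 5101742649275441)))⟩,
  ⟨680575118752511482424655219847471366146, 4312863235, (Q 70 (Q 86 (L 2814752000788081) (Q 134 (L 3799925456537172) (L 6157274528118086))) (Q 101 (L 2814750355703431) (Q 134 (L 6157271138731331) (L 6157295217100166))))⟩,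
  ⟨2382013107445159546048205156555085119490, 303104002, (Q 323 (L 2674048371802913) (Q 312 (L 5911002299253537) (L 4785102392410913)))⟩,
  ⟨1020883457219719259329673069632425099266, 9127985713, (Q 87 (L 3940650588403010) (L 3659179596404614))⟩,
  ⟨2723022203243401650688705146711545282562, 824193312, (Q 326 (L 7564645670012551) (L 7283170762311795))⟩,
  ⟨680580310970141854729949110649679314946, 8908710672, (Q 389 (Q 340 (L 5946189218538584) (L 7564654779975046)) (Q 340 (L 5946159529162049) (L 3025860334998643)))⟩,
  ⟨2723022203481220328997043036666830323714, 839922192, (L 7283175244974195)⟩,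
  ⟨1020873062643255561074390095125527199746, 8624734739, (Q 101 (Q 133 (L 5875799055238720) (L 5875826144130880)) (L 5875826144130880))⟩,
  ⟨680580311128599423492848601794478145538, 4331733553, (Q 133 (Q 72 (L 3588811892488275) (L 2462910885693011)) (Q 71 (L 2462906874955586) (L 7564650203084881)))⟩]
/-- hints for `n = 9`. -/
def hints9 : List ℕ := [
  36344967696, 35220717056528, 87992745341456, 70401062613520, 140773833323024,
  123177070244368, 193541787890192, 105584931385872, 316695442108944, 175953675563536,
  369463145017872, 527797899768336, 351871761134096, 105553421944167, 228726156046864,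
  404647513174544, 580573651808784, 650934091264528, 123145612903783, 211138000466448,
  475016274063888, 457424845943312, 756487224242704, 562981721354768, 387055834378768,
  738907875717648, 633350465532432, 510200582255120, 791671532433936, 1090747349873168,
  967593660264976, 1125931721962000, 492608463057424, 1020382616498704, 950009594130960,
  774083439768080, 70369049609575, 263910527828496, 439831884956176, 615758023590416,
  686118463046160, 387028403582038, 826855904215568, 580542544434279, 1002778032046608,
  1178704186409488, 1073146005520912, 1213887772066320, 1284231595705174, 87961235899751,
  246322368623120, 598166089511440, 422240202535440, 668534833689104, 316659659404374,
  897224649437712, 334251940066390, 457422692164472, 879636553085456, 985162828636997,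
  1002756774183783, 738873509684088, 1319432584655376, 562950264140903, 1161116042932752,
  404620684244054, 985193930830352, 809267792196112, 756464358671224, 985163786101607,
  1002756619248453, 1442595582915088, 1266637805462358, 1196296388489744, 1055554621944336,
  1301857826189840, 351844026578006, 932409016549904, 1055531567899461, 1284256512311824,
  1354616951767568, 527765888795751, 1231455191724886, 1020347195810629, 949979409711975,
  1495354456834576, 1196269058028374, 1213863008813910, 1530521344762488, 1618512884019728,
  369436216800342, 914820862259728, 949978434921285, 967572135093061, 1530538845696528,
  967570593301351, 1037941147640645, 1583332789137936, 1512950554890872, 1266664583148048,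
  1073125519729477, 1512963776590352, 1477775110582800, 1337033327325712, 35184677509223,
  299094899894288, 246291009587030, 263884957238871, 721302835111952, 211106543126358,
  862040276281360, 228698823542359, 879611473966661, 844452163952664, 914794084447813,
  1249072144132112, 932387874813254, 175922166122326, 844427096962629, 809240963266117,
  1178678631609943, 1389801323833360, 193514357081687, 862051500176710, 738872219088453,
  756466171655494, 1460183660307509, 1161084685924182, 826834915833158, 1442561522017588,
  1372217698099224, 774056496805445, 1565723137091600, 1125900245022550, 1512930171823412,
  1671280814663696, 791648766408006, 1477745532347700, 1530554653680693, 1565739025769525,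
  52776863565159, 281506740404752, 246291009594455, 263884957250646, 703719205470736,
  211106543133783, 862040276271640, 228698823554134, 897235966649157, 844452163977744,
  914794084455238, 1231480760271376, 932387874825029, 87961235834456, 246322368098600,
  598134730733125, 439806817875271, 668534833164584, 70369053729880, 263910523671336,
  123145690690888, 105555018535752, 211137913242168, 422212874163015, 615728683311941,
  228700148016184, 686118458889000, 562950264272453, 1161116042408232, 404620684178759,
  985193930305832, 809267791671592, 175922252763976, 562980124181048, 387053985546808,
  844427183604279, 1266637805593908, 1196296387965224, 1055554621419816, 633320682635832,
  175922166129751, 844427096970054, 809240963273542, 1178678631625558, 1389801323823640,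
  193514357093462, 862051500188485, 738872219095878, 756466171667269, 1460183660319284,
  1161084685935447, 826834915844933, 1442561522025013, 1372217698124304, 193514355242312,
  862051498337335, 387028464718663, 404621912122424, 826855834194728, 580542533886789,
  580544040936504, 1002777963008808, 1178704118354728, 1161084689327412, 826834913993783,
  809242254131767, 1178678201504308, 1372217691091239, 774056496812870, 1548114543919669,
  1143492497929046, 1512930171830837, 1653692722020880, 791648766419781, 1495365987684916,
  1530554653692468, 1548135044448784, 650911242724408, 1073144897409832, 1213886679683880,
  1284231317770804, 1389817129997095, 140737793787734, 703689608361541, 668503474665029,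
  686097422308935, 1424985695614992, 633319008204357, 1372192683222324, 650911288612423,
  1301823939044660, 1389817175885110, 1337006549525812, 1618481946719813, 1354600339883318,
  140737793902679, 703689608476486, 668503474779974, 686097422562630, 1407377149797941,
  369436215433032, 914820853602343, 351844092426311, 492607064254519, 932408950077224,
  1266664574490663, 1073125518362167, 774057881774135, 1337033318668327, 633319008319302,
  1372192683337269, 650911288866118, 1301823939159605, 1389817176138805, 791648730761016,
  1055532530280246, 1284255423477544, 1548134929078054, 1337006549640757, 1618481946896198,
  1354600340137013, 1354599489419048, 158329980027990, 721314006856517, 668503474852679,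
  686097422512965, 1407402066342416, 527765890893381, 1231455193822516, 545358155776837,
  1090717437035828, 1249079670960692, 1196269060126004, 1213863007765815, 1143493822349876,
  1636096505315619, 369436215752007, 914820853870888, 351844092564296, 510175028454455,
  932408950526759, 967570592253496, 1020348158191414, 949980010791480, 1512950556989222,
  1266664574759208, 1073125518681142, 774057881977400, 1477775102193960, 1337033318936872,
  633319008392007, 1372192683409974, 650911288816453, 1319448431911476, 1389817176089140,
  1125900299175220, 1196270287143479, 1213862583300660, 1653667741660195, 791648731145271,
  1055532530418231, 1284255423927079, 1530554618417958, 1565738990506790, 1337006549713462,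
  1636075469959749, 1354600340087348, 1618483101140003, 1354599489868583]

theorem a9 : certsOK 9 certs9 = true := by decide +kernel

theorem b9 : hintsOK 9 certs9 (codes 9) hints9 = true := by decide +kernel

/-- certificates for `n = 11`. -/
def certs11 : List Cert := [
  ⟨14619142068338979037478048278939126216146526732290, 2276635841042, (L 35993769021633841)⟩,
  ⟨13153716458088279978964166272669751612724825096194, 3509813707025, (L 26990010320839184)⟩,
  ⟨11692213862536853319351402401692515942872692883458, 2207646884355, (L 13510950389454673)⟩,
  ⟨10230712225191329116300589134542665708973440696322, 1310790332465, (L 20233296048457280)⟩,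
  ⟨8769210587860425974993802996766042821653716598786, 146584633376, (L 16895105145866065)⟩,
  ⟨11692191507579090980640466989592472340977333370882, 2212176593457, (Q 49 (Q 425 (L 26883087109985093) (L 26988640241980229)) (Q 357 (Q 48 (L 26504288935298401) (Q 112 (L 25941338981877089) (Q 144 (Q 137 (L 10134381360530791) (L 24779773556843843)) (Q 129 (Q 121 (L 26460887544050774) (L 26742349621629765)) (Q 152 (Q 121 (L 11234949290415153) (Q 405 (L 26993090080756784) (L 9007410872620962))) (Q 151 (L 11225096902825008) (Q 33 (L 10390524359959875) (L 9007862593905987)))))))) (Q 129 (L 25933603763602784) (Q 325 (Q 48 (L 26574657679476065) (Q 161 (L 25018809979393072) (Q 113 (L 10107400599384359) (L 10107430664155424)))) (Q 64 (L 9262456298094641) (Q 145 (Q 121 (L 10144233748120936) (L 24772038338504003)) (Q 32 (Q 33 (L 9720402570977332) (L 9261635703231536)) (L 9050529470624849))))))))⟩,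
  ⟨10230689870014244158285142603413493942131824328706, 2268582851091, (Q 402 (Q 294 (L 8973494005691440) (Q 422 (Q 394 (L 8972105668856170) (Q 2 (L 1487703066505) (Q 133 (L 19678059873837108) (Q 149 (L 18548766149224259) (Q 154 (L 29244953513718832) (L 29248252031693872)))))) (Q 2 (L 4505079545808806) (Q 390 (Q 52 (L 7001780831880873) (L 8972105668856230)) (Q 3 (Q 149 (L 7918298645874565) (Q 21 (L 31499309116887555) (Q 338 (L 16890171794605990) (L 12949543647720566)))) (Q 393 (Q 374 (L 8866552552581514) (L 7857200983139376)) (Q 359 (L 41204446408737) (Q 133 (L 6765387562042114) (L 29244953496024112))))))))) (Q 408 (Q 133 (L 31496753309709360) (L 29244953496024112)) (Q 154 (Q 149 (L 31496753327404080) (L 29244953513718832)) (Q 90 (L 27556103669183536) (Q 422 (L 20233321802396720) (Q 70 (L 19107421857941296) (Q 54 (L 108753352870) (Q 424 (L 13475757909584021) (L 13475757909576101)))))))))⟩,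
  ⟨8769188232683341016978356465636871054812100231170, 2280681190195, (Q 103 (Q 377 (L 2226118449246736) (Q 134 (L 13487247269900816) (L 13487247301358096))) (L 19114617051886096))⟩,
  ⟨7307686595352438098771267349758584550966292447234, 3380443550241, (Q 338 (L 13480081903626611) (Q 322 (L 8981090776291120) (L 17988290031032112)))⟩,
  ⟨5846184958021535180567582465097062853278679760898, 2337034732081, (Q 407 (L 9007410927203922) (Q 425 (L 9008437656135747) (L 9289912632846403)))⟩,
  ⟨4384683320690632262363897632379987212182957916162, 3448912290049, (Q 16 (Q 277 (L 11268028448786855) (L 9016228635101607)) (Q 32 (Q 277 (L 12393928355629479) (L 10142128541944231)) (Q 64 (Q 277 (L 12956878311016871) (Q 274 (L 10142128543910311) (L 9016228637067687))) (Q 137 (Q 144 (L 35715549822490725) (Q 48 (L 35997024799201381) (L 22527212234361255))) (Q 309 (Q 376 (L 27551126553703456) (L 35995363523769376)) (Q 48 (L 5638713631721895) (L 4512813724879271)))))))⟩,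
  ⟨2923181683359729344160212799663704180432582017026, 3514139091505, (Q 18 (L 22523509138160040) (Q 20 (L 35927116511330592) (Q 100 (L 25901208858687912) (Q 291 (L 18547703125513319) (Q 323 (L 19145865285761448) (L 18019965378918824))))))⟩,
  ⟨14619097412403403471705707089879347969813113798658, 3299072934416, (L 6756843465058114)⟩,
  ⟨10230667569255756897125832548008507413936489955330, 3449145070096, (L 26986974329328689)⟩,
  ⟨8769165931924850409221461807706264575320303665154, 3307158507808, (Q 52 (Q 35 (L 35466987197122186) (L 31529664751642997)) (Q 259 (L 24771056430910103) (Q 258 (L 14640277039323782) (Q 356 (L 6762138299836789) (Q 54 (L 32627463271089559) (L 24774337788160373))))))⟩,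
  ⟨7307664294593947491014372691827978071474495881218, 3513568535329, (Q 154 (L 25303203773576768) (Q 424 (L 26429103698114112) (L 26992053634823744)))⟩,
  ⟨5846162657263044572810687807166456373786883194882, 1310270239234, (Q 169 (L 9011680409843232) (Q 168 (L 10137580316685856) (Q 137 (L 9011680425571872) (Q 167 (L 10700530268141088) (L 10982005244851744)))))⟩,
  ⟨4384661019932141654607002974449380732691161350146, 9180487939, (Q 371 (Q 391 (L 7283309348861014) (Q 3 (L 9009490244956932) (Q 394 (L 8972159209124950) (Q 101 (L 9009468162025587) (L 25301006393238848))))) (Q 323 (L 7001834372150358) (L 18015508544973224)))⟩,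
  ⟨14619075111658204738261564367742584532666342768642, 2207614313267, (L 4741952674435)⟩,
  ⟨8769143631179651675828384112190023074513121509378, 1113255314209, (L 26987527024440914)⟩,
  ⟨7307641993848748757570229969691214634327724851202, 3371818815504, (Q 121 (Q 135 (L 9018749318947872) (L 10587991467040)) (Q 120 (L 9018818038359072) (Q 117 (L 18303162995135520) (Q 133 (L 18021688018424864) (L 1700468644865056)))))⟩,
  ⟨5846140356517845839366545085029692936640112164866, 1172813513505, (Q 120 (L 9007416847328577) (Q 118 (L 9570366800749889) (L 9851841777460545)))⟩,
  ⟨14619052810913006207635328029149763262314041114626, 2414580204082, (L 27025314380678176)⟩,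
  ⟨7307619693103550226943994410288863037466883457026, 146886828291, (L 9009468179912787)⟩,
  ⟨10230712224850302587771292691291436476891988557826, 2341079167264, (Q 410 (L 22483041777256258) (L 22483041778239298))⟩,
  ⟨8769210587519396099866921950989193638275802267650, 206966886448, (Q 87 (Q 89 (L 2253150737622048) (L 3379050644464672)) (Q 340 (Q 67 (L 32094753328036264) (Q 163 (Q 120 (L 32519164853330758) (L 13941816390427462)) (Q 147 (L 36003518523017041) (Q 115 (L 7886898434958368) (Q 135 (L 13521802950297208) (L 13520703436597348)))))) (Q 390 (L 15730721790929269) (Q 424 (L 15730722900449089) (Q 406 (L 15449246818396533) (Q 149 (L 15730721795175784) (L 8883962225440)))))))⟩,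
  ⟨7307708950188493181659832835110907134429994483714, 150611173906, (Q 121 (L 13512218527552288) (Q 118 (L 14638118434394912) (L 15201068387816224)))⟩,
  ⟨5846207312857590263456147950449385436742381797378, 3513820258323, (Q 169 (L 13511022615369298) (Q 408 (L 13512057419302723) (L 13793532396013379)))⟩,
  ⟨4384705675526687345252463117732309795646659952642, 3372106195251, (Q 70 (Q 355 (L 4471002864435984) (Q 49 (L 4400337785480240) (L 31638529304468048))) (Q 134 (Q 323 (L 18690603047356837) (Q 49 (L 4259600297124912) (L 4224347205559315))) (Q 90 (Q 116 (L 33745618787214608) (L 3344719566963815)) (Q 355 (L 4402450826626610) (Q 72 (L 4365068235458103) (Q 150 (L 33331090018440464) (Q 423 (L 3422784892397634) (Q 309 (L 1100616027502692) (Q 154 (L 3379905012794467) (L 22064064261420304))))))))))⟩,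
  ⟨8769165931583823576456021309679978984030082236418, 150644863264, (Q 39 (Q 410 (Q 344 (L 31455255015827233) (Q 326 (L 23608925541145202) (Q 104 (L 12388276235704944) (Q 346 (L 12887389857228577) (Q 152 (L 12951226189126256) (L 13232701165836912)))))) (Q 344 (L 31455255015888673) (Q 326 (L 23608925541149042) (Q 67 (L 31490091741776535) (Q 275 (L 13339653129185178) (Q 274 (L 12671150059497385) (L 12387407340075429))))))) (Q 288 (L 13483667911387526) (Q 416 (L 12920717957966214) (Q 137 (Q 352 (L 12920717957949609) (Q 54 (L 12639242981238938) (L 31490091741776295))) (Q 352 (Q 41 (L 12498505493487720) (Q 134 (L 12529311504794177) (Q 168 (L 12920717957949609) (L 12498505492899945)))) (Q 54 (L 12392952376617129) (Q 304 (L 12392952376617129) (Q 131 (L 12532610039497217) (Q 425 (L 4514600708567636) (L 13475693232294311))))))))))⟩,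
  ⟨7307664294252920658248932193801692480184274452482, 3367792288528, (Q 89 (Q 90 (L 4506292934313536) (L 22526944950703680)) (Q 86 (Q 169 (L 22808419927414336) (Q 340 (L 30934970173859938) (Q 360 (L 4509166515825011) (Q 356 (L 12948959282961011) (L 12948959251503731))))) (Q 154 (L 22521366000933510) (L 22521366000937350))))⟩,
  ⟨5846162656922017740045247309140170782496661766146, 2199864226320, (Q 121 (Q 408 (L 4796139321259602) (Q 328 (L 5359089274680914) (Q 122 (L 22518213244307610) (L 4504974966367826)))) (Q 410 (L 4511511316437056) (Q 120 (L 22527963342284370) (L 22526863829800530))))⟩,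
  ⟨4384661019591114821841562476423095141400939921410, 3371569320496, (Q 377 (Q 137 (L 31360421045245777) (Q 134 (L 31078946068535121) (Q 423 (L 13204185535773265) (Q 292 (L 4542633760875553) (Q 150 (L 13484415526803011) (L 31078946068596561)))))) (Q 376 (L 13485660512483921) (Q 154 (L 13484561000802641) (L 13484561000798801))))⟩,
  ⟨2923159382260211903637877643706812109650564022274, 8891994145, (Q 338 (Q 291 (L 5567106597100166) (Q 360 (Q 422 (L 13481773871088416) (Q 278 (L 23051270991809175) (Q 276 (L 12918744525390624) (Q 120 (L 4504017439462691) (Q 48 (L 4508446407073811) (Q 16 (L 4649183895429139) (L 22554696361792052))))))) (Q 362 (L 13481765283250976) (Q 121 (L 12384986863408419) (L 4504154863662371))))) (Q 345 (L 5004156643678854) (Q 122 (Q 425 (L 22771165036911224) (L 22630427548555896)) (Q 121 (L 22524874432288650) (Q 394 (L 22524874432281225) (L 22524874432280745))))))⟩,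
  ⟨14619075111317174863134683321965735349288428437506, 77881938721, (Q 154 (L 4503823680304721) (Q 329 (L 3377917230347857) (L 217336804945)))⟩,
  ⟨8769143630838621800701503066413173891135207178242, 142271906065, (Q 390 (Q 137 (L 22486775744512528) (L 26990306669183504)) (Q 152 (Q 410 (L 26990426930364944) (Q 168 (L 22486569604956688) (Q 422 (L 22486569604956688) (L 22486827302994448)))) (Q 101 (Q 310 (L 11263025472684545) (Q 362 (L 24463615195492880) (L 9263885383774736))) (Q 406 (Q 425 (L 24738630859112976) (Q 313 (L 24742904317821456) (Q 100 (L 26712998568079888) (Q 362 (L 24738562975285776) (L 24738562140684816))))) (Q 422 (L 24738631677985296) (Q 374 (L 22486630537708048) (Q 425 (L 24738356804272656) (Q 377 (L 22486556990587408) (Q 117 (L 11796270328267280) (L 22486548366377488))))))))))⟩,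
  ⟨7307641993507718882443348923914365450949810520066, 3513838145795, (Q 394 (Q 72 (L 28114033241122098) (Q 378 (L 14611964147426610) (L 32064580935443762))) (Q 148 (L 21921652473881906) (Q 72 (L 27560429137454386) (L 29812228951139634))))⟩,
  ⟨5846140356176815964239664039252843753262197833730, 2418386546946, (Q 154 (Q 328 (L 22484338554283858) (Q 137 (L 24735919859341941) (Q 104 (L 23891494929209973) (L 24454444882631285)))) (Q 289 (Q 66 (L 4476468388276614) (L 15730719118878874)) (Q 104 (Q 326 (L 11790072131520935) (L 23645204324588119)) (Q 326 (L 29529665465526098) (Q 328 (L 22484544745940818) (Q 330 (L 21921594792519506) (Q 152 (L 24172969909054069) (L 24735919859341941))))))))⟩,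
  ⟨4384638718845913046035979206535768112166475988994, 3375880151089, (Q 394 (Q 423 (L 22486731440284993) (Q 116 (L 24209128713333126) (L 12244304101222501))) (Q 154 (Q 164 (L 14496451273524819) (Q 408 (L 11259141682796645) (L 11259141682792805))) (Q 378 (L 30368030788183361) (Q 116 (L 15622488616240723) (L 11259141682735205)))))⟩,
  ⟨2923137081515010127832294373819485080416100089858, 2409781854769, (Q 89 (Q 116 (L 31492625239943505) (Q 101 (L 13440642295957314) (L 10062942575429442))) (Q 116 (L 15693750445058387) (L 14567850538215763)))⟩,
  ⟨14619052810571976332508446983372914078936126783490, 211276661537, (Q 134 (L 31491388305090930) (Q 101 (L 29802538444826994) (L 30365488448383346)))⟩,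
  ⟨7307619692762520351817113364512013854088969125890, 73588085536, (Q 117 (Q 71 (L 21357077409933699) (Q 374 (L 24734756226050436) (L 24734756241779076))) (Q 374 (L 11373357231076931) (L 22482973055686723)))⟩,
  ⟨5846118055431617433613427700660022482909896179714, 2414613770800, (Q 151 (Q 53 (L 11269999072614500) (Q 117 (L 12395898979457124) (Q 325 (L 14647707131418722) (Q 55 (L 25895776849983912) (Q 293 (L 14647707097864292) (Q 408 (L 31536673868842562) (L 8806067619461280))))))) (Q 359 (Q 356 (L 35996121085470001) (L 35998182669772081)) (Q 325 (Q 52 (L 30507642488501329) (L 6203788524755042)) (Q 356 (L 30929854953571633) (L 30648379976860977)))))⟩,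
  ⟨4384616418100714515409742867942946841814174334978, 2268584747536, (Q 325 (Q 308 (Q 154 (L 22555452276040517) (L 26570867308272245)) (Q 355 (L 15728523336780199) (Q 154 (L 22625821020218181) (Q 339 (L 27549507132806281) (Q 87 (L 33741976485835913) (L 15622971275381158)))))) (Q 328 (Q 339 (L 17417373952018855) (L 27127295456269447)) (Q 371 (Q 310 (L 22063423169389429) (Q 406 (L 27901351642223751) (Q 169 (L 13375702995003200) (Q 403 (L 12249803103889216) (L 11686853150467904))))) (Q 310 (L 27056926712091783) (L 22485635634459478)))))⟩,
  ⟨2923114780769811597206058035226663810063798435842, 2409530200864, (Q 86 (Q 305 (L 24249867515029928) (Q 132 (L 29801653144758339) (Q 337 (L 23123967608187304) (Q 82 (L 6265256070616416) (L 24242271184753238))))) (Q 72 (L 14007160290256961) (Q 87 (L 11753860981495383) (L 24734758154369091))))⟩,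
  ⟨14619030509826777801885305400431697177818547945474, 3513285542419, (Q 169 (L 4503883456616291) (Q 393 (L 29522236012140608) (Q 424 (L 4503883456616291) (L 29522236012136768))))⟩,
  ⟨5846095754686418902990286117730695084808575451138, 3307982762272, (Q 100 (L 13513617259866193) (L 11261211318917765))⟩,
  ⟨4384594117355515984786601285001729940696595496962, 3298538160387, (Q 165 (Q 391 (L 13370346598671665) (Q 393 (L 12244446691829041) (Q 89 (L 22599503788345684) (Q 390 (L 9992647129802033) (Q 101 (L 13511297812948273) (Q 394 (L 20376845596199248) (Q 410 (L 22628091090668181) (L 22628091090667941)))))))) (Q 340 (Q 36 (L 26466350350489754) (Q 35 (L 25903400397068442) (L 27032662764104071))) (Q 310 (L 15739032267359554) (L 20302492820194149))))⟩,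
  ⟨14619008209081579271262163864712703964511778963458, 206193229856, (Q 306 (Q 293 (L 31491546360023700) (L 35995145987394196)) (Q 311 (L 30365646453181076) (Q 322 (L 6620847816542561) (L 8872647630227809))))⟩,
  ⟨4384571816610317454163459749282736908809245097986, 9160425491, (Q 391 (Q 339 (L 22489690600482688) (Q 84 (L 24702753906005314) (L 24736839571772241))) (Q 339 (L 22489690600482928) (L 22485220683584833)))⟩,
  ⟨8769210587179113550458147446369699257276884385794, 2203351777586, (L 13511924845737283)⟩,
  ⟨7307708949848210632199993303870890817091487727618, 3436831703840, (Q 167 (L 31534007015085377) (Q 394 (L 32379531457885505) (L 31816581504464193)))⟩,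
  ⟨5846207312517307713996308419209369119403875041282, 1099514916897, (Q 393 (L 13510962987964993) (Q 391 (L 14073912943475265) (L 14355387918096961)))⟩,
  ⟨4384705675186404795792623586492293478308153196546, 3367274426880, (Q 154 (L 13517401143945538) (Q 134 (L 4370786968765968) (L 21401122571380496)))⟩,
  ⟨14619075110976892313721266542198920792258638839810, 1241245749251, (L 4503914110477601)⟩,
  ⟨7307641993167436333029932144147550893920020922370, 1113218756657, (Q 150 (L 31501283641362225) (Q 425 (L 31494824013760305) (Q 357 (L 23050170679077255) (Q 166 (L 25301971668469553) (Q 137 (L 13203211131983665) (L 13204310643607345))))))⟩,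
  ⟨5846140355836533414826247259486029196232408236034, 1306240688897, (Q 393 (L 4514599648401251) (Q 389 (L 4796074625111907) (Q 169 (L 4504154288007011) (Q 359 (L 31493999110485570) (L 31493999110481730)))))⟩,
  ⟨4384638718505630496622562426768953555136686391298, 2268581605392, (Q 325 (L 4507405398856736) (Q 389 (L 4648142887212064) (Q 328 (L 4507405398852896) (Q 420 (L 31497232897641075) (L 4507405398607136)))))⟩,
  ⟨14619052810231693783048607452132897761597620027394, 2413807415603, (Q 154 (Q 115 (L 4222203658992280) (Q 52 (L 3377778728860312) (L 3940728682281624))) (Q 115 (L 4222203658992040) (Q 52 (L 3377778728860072) (L 3940728682281384))))⟩,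
  ⟨7307619692422237802357273833271997536750462369794, 2272877621776, (Q 327 (Q 326 (L 23608928778877592) (L 26988682045393319)) (Q 330 (L 12632302621600133) (Q 329 (L 22483050636286033) (Q 133 (L 12491565133224090) (Q 101 (L 9008314242598242) (L 9008314242598482))))))⟩,
  ⟨5846118055091334884153588169420006165571389423618, 2410302025986, (Q 327 (Q 36 (L 8977718970710440) (Q 52 (L 16298404761344646) (L 27550474272257401))) (Q 66 (L 14041869543823258) (Q 388 (L 32053382177105747) (Q 329 (L 14604820071733065) (L 25861106614806355)))))⟩,
  ⟨4384616417760431965949903336702930524475667578882, 3380426776592, (Q 118 (Q 354 (L 9149056026830675) (Q 322 (L 25443868172777896) (L 26569768079620520))) (Q 295 (Q 386 (L 9289793515189843) (Q 169 (L 14497070621226579) (L 13934120667805267))) (L 9008318538479187)))⟩,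
  ⟨14619030509486495252425465869191680860480041189378, 2280663286034, (Q 406 (L 4513083222824771) (Q 357 (L 5357508152956739) (L 4794558199535427)))⟩,
  ⟨5846095754346136353530446586490678767470068695042, 2212748079632, (Q 360 (Q 152 (L 13514278167930688) (L 14077228121352000)) (Q 425 (Q 89 (L 22485360757598323) (L 26988719862605939)) (Q 135 (L 13514260989183808) (L 13514260989179968))))⟩,
  ⟨14619142067317384245967603915871792348206621327362, 1237504295202, (L 3943150243190544)⟩,
  ⟨13153716457066685187453721909602417744784919691266, 1315102143026, (Q 121 (L 22527520403842080) (L 18023920776471584))⟩,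
  ⟨7307708949507928265276270297010892123359463669762, 206695370787, (L 13510898549884498)⟩,
  ⟨5846207312177025347072584633158900752180390723586, 73585926146, (Q 423 (L 3946735949477424) (L 4228210926188080))⟩,
  ⟨14619052809891411416124884374437401824820917764098, 1306241609746, (L 31492774792111425)⟩,
  ⟨5846118054751052517229865091724510228794687160322, 77580075794, (Q 359 (Q 169 (L 13230640490509632) (L 13230640474780992)) (Q 393 (L 31494007412004705) (Q 169 (L 31496824910682225) (Q 135 (L 13342788424472673) (L 13341688912844913)))))⟩,
  ⟨8769210587860420772609280566811671776073148858370, 3517866651936, (L 20232269700175955)⟩,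
  ⟨7307708950529517854351126424312863335887752200194, 2413772673283, (Q 408 (L 1689001703077441) (L 151828067905))⟩,
  ⟨5846207313198614936147441539651341638200139513858, 2280947516210, (Q 138 (L 20231312243328545) (Q 154 (L 19671441462691668) (L 20234391415068500)))⟩,
  ⟨8769188232683335814593834035682500009231532490754, 206427984672, (Q 360 (Q 406 (L 24734757902906691) (L 29247019526288707)) (Q 393 (L 29244821039904067) (Q 362 (L 24734757869483331) (Q 67 (L 24706170602607664) (Q 359 (L 20196012524524593) (L 24734757904934211))))))⟩,
  ⟨7307686595352432896335679893183691569046135832578, 2276869611555, (Q 361 (Q 342 (L 10700586117334833) (Q 422 (L 9011736257070897) (L 6765579862705969))) (Q 346 (L 9011736244291377) (Q 298 (L 9017525701084977) (Q 154 (L 24776679841433393) (Q 394 (L 11263536863209265) (Q 275 (L 10173065487479568) (Q 357 (L 25060353837213489) (Q 378 (L 11263536594774065) (Q 311 (L 25827533311874408) (L 10812066421699344))))))))))⟩,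
  ⟨5846184958021529978131995008522169871358523146242, 1103823438081, (Q 323 (Q 50 (Q 377 (L 29380774284567360) (L 27128974470882112)) (Q 152 (L 1977197341800617) (Q 407 (L 2223487946422696) (L 2082750458067338)))) (Q 343 (Q 377 (L 30365936703058976) (Q 309 (L 27551186935952416) (L 27269711959241760))) (Q 339 (Q 377 (L 29802986749637664) (L 27551186935952416)) (Q 371 (Q 377 (L 29521511772804128) (L 27269711959118880)) (Q 377 (Q 137 (L 20232828668556320) (L 23896172520825888)) (Q 152 (L 34024638955082784) (Q 425 (L 27269239514027040) (Q 138 (L 22766090858222624) (Q 134 (L 26988176566858784) (L 28402667442824224))))))))))⟩,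
  ⟨4384683320690627059928310175805094230262801301506, 3509558772243, (Q 72 (Q 292 (L 29281507034573139) (L 18022371598838099)) (Q 323 (Q 169 (L 10978969745113954) (L 25340454706121125)) (Q 339 (L 25305270335002793) (Q 346 (L 16018176651516560) (Q 344 (L 25023795358292137) (L 24883057869936809))))))⟩,
  ⟨7307641993848743555181065264589523412716285394946, 3307696361522, (Q 86 (L 10697162624497833) (Q 100 (Q 292 (L 20266409401940137) (Q 306 (L 6756705736489129) (Q 374 (L 6758803832981104) (Q 88 (L 6792166044641571) (L 6758803832981344))))) (Q 67 (L 15200757737748649) (Q 165 (L 29238357428234152) (Q 25 (L 15730850743478149) (L 29238840684406612))))))⟩,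
  ⟨5846140356517840636977380379928001715028672708610, 2272877621760, (Q 281 (Q 321 (L 25016305089517957) (Q 137 (Q 369 (L 10983036582926434) (Q 353 (L 29240426843363482) (Q 305 (L 15732921379096999) (Q 167 (L 29203478054376530) (L 29203478101562450))))) (Q 138 (L 6759326744736784) (Q 369 (L 10983036582922594) (Q 305 (L 15486630791252390) (Q 289 (L 10983048008206714) (Q 120 (L 29203482631410770) (L 29203478054376530)))))))) (Q 338 (Q 359 (L 2261259267494928) (Q 133 (L 10981211698787344) (Q 292 (L 25022273634575497) (Q 101 (L 10981417854071824) (L 24990324248433200))))) (Q 276 (Q 325 (L 33748969595181683) (L 24770014484710808)) (Q 133 (L 24805198856983945) (Q 277 (L 33748969592232563) (L 24770014484895128))))))⟩,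
  ⟨4384638719186937718773695547210926073932950863874, 2276621099267, (Q 118 (Q 393 (L 29240001313732162) (Q 169 (L 29242002464348752) (L 29240001314715202))) (Q 70 (L 11120530810304067) (Q 71 (L 11120530810303587) (Q 151 (L 10979793321948259) (L 28825012679449168)))))⟩,
  ⟨2923137081856034800570010714494643042182574964738, 2268582654480, (Q 259 (Q 54 (L 11233853480913063) (Q 288 (L 11226431817937668) (Q 120 (L 11190183633552466) (Q 169 (L 11197569667630201) (L 29249351555499907))))) (Q 115 (Q 67 (Q 167 (L 28994539722798128) (Q 260 (L 11190183633552466) (Q 261 (L 6827101666164818) (Q 362 (L 29238356426257972) (L 28718287439954992))))) (Q 393 (L 25227892276884289) (Q 291 (L 29242616188479877) (Q 294 (L 28816624929366583) (Q 298 (L 28957362417706551) (Q 362 (L 28713270836356912) (Q 328 (L 29167987695711048) (Q 326 (L 29036046148974505) (Q 260 (L 7047329731327910) (Q 65 (L 7294788907044979) (L 2468614769756310))))))))))) (Q 359 (Q 122 (L 28745793471472449) (Q 54 (L 29027268448183105) (L 29168005936538433))) (Q 408 (Q 361 (L 7038662256007250) (Q 360 (L 6757187279296594) (Q 133 (L 6757187279292754)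 (L 6827556023474258)))) (Q 394 (L 24805679811818305) (Q 362 (L 28713270836356912) (Q 120 (L 25087154788528961) (L 24805679811818305))))))))⟩,
  ⟨14619052810913001005199740572574870280393884499970, 146317386000, (Q 89 (L 34305464080102945) (Q 261 (L 8973128512677730) (Q 266 (L 7083022522435) (Q 257 (L 17980327767418722) (L 35994726276900706)))))⟩,
  ⟨7307619693103545024508406953713970055546726842370, 3298587456272, (Q 118 (Q 342 (L 10134208141228186) (Q 99 (L 15764180089477716) (Q 163 (L 26986569514837889) (Q 326 (L 9014905252776357) (Q 325 (L 21357065277962394) (L 20231165522114705)))))) (Q 346 (L 10134208159123876) (L 10134208142346661)))⟩,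
  ⟨5846118055772642106304721289861978684367653896194, 2268582654464, (Q 89 (Q 340 (L 34030022725835379) (Q 135 (Q 393 (L 15766594719872016) (L 7603751674868752)) (Q 54 (Q 359 (L 6484517271855888) (L 19142882517988368)) (Q 359 (L 20128387125699344) (Q 362 (L 10136559171302416) (Q 101 (L 16047546595439632) (L 34202046624584464))))))) (Q 135 (Q 393 (L 15766594719872016) (L 7603751674868752)) (Q 133 (Q 394 (L 7603614304982032) (Q 115 (L 17885284886147856) (Q 359 (L 8448246129583120) (L 26461562307294224)))) (Q 325 (L 36000347562809971) (L 34311497702546035)))))⟩,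
  ⟨4384616418441739188101036457144903043271932051458, 1305721638944, (Q 165 (Q 87 (L 26565507275925860) (Q 86 (L 24771104231238023) (Q 84 (L 26459954122959239) (Q 292 (L 18015704821639559) (Q 260 (L 18015712874703239) (Q 105 (Q 393 (L 19142099476243458) (L 19705049429664770)) (Q 83 (L 16193058108974385) (L 16263426853152049)))))))) (Q 118 (L 27023288426783776) (Q 154 (L 26987719740991844) (L 26846982252636516))))⟩,
  ⟨2923114781110836269897351624428620011521556152322, 3436260176400, (Q 103 (Q 121 (L 15763735311770946) (Q 86 (L 16608160241902914) (Q 84 (L 16748897730258242) (L 16819266474435906)))) (Q 134 (Q 394 (L 24805199615386945) (Q 101 (L 29240898639792787) (Q 408 (L 20233561947212435) (L 20233561947216035)))) (Q 84 (Q 394 (L 25860730778051905) (Q 101 (L 10387229160934035) (L 19952224408341139))) (Q 151 (L 16819266474435906) (L 16256316521014594)))))⟩,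
  ⟨14619030510167802474576598989633653379276305661954, 3376414790448, (Q 376 (L 29238561743612227) (Q 424 (L 28675611790190915) (L 28394136813480259)))⟩,
  ⟨5846095755027443575681579706932651286266333167618, 8877244947, (Q 103 (L 15763158407293251) (Q 167 (L 16326108360714563) (Q 106 (L 15763158408276291) (Q 120 (L 25764865930470979) (L 15764124493051986)))))⟩,
  ⟨4384594117696540657477894874203686142154353213442, 2204157161985, (Q 373 (Q 410 (L 24876667082732864) (Q 122 (L 25439617035171136) (L 25721092011881792))) (Q 83 (L 34024878703727424) (Q 410 (L 20062171296339250) (Q 359 (L 27128389064603002) (Q 152 (L 28225976413037874) (Q 390 (L 10664301817259431) (L 10382826840548775)))))))⟩,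
  ⟨2923092480365637739274210041487403110403977314306, 3518383657730, (Q 342 (Q 169 (L 6758080635831889) (Q 137 (L 7039555610453585) (L 7602505565963857))) (Q 152 (L 24806220524713555) (Q 120 (L 25087695499335251) (L 25650645454845523))))⟩,
  ⟨4384571816951342126854753338484693110267002814466, 3436294705952, (Q 388 (Q 52 (L 24740597277960546) (L 26996795673709154)) (Q 134 (Q 121 (L 25297706666255498) (Q 410 (L 26986556613551219) (L 26986556612568179))) (Q 52 (Q 166 (L 25825490571265073) (Q 135 (L 14639246514558632) (Q 66 (L 10706646687032913) (Q 98 (L 10988121663743569) (Q 258 (L 19643269170629221) (Q 150 (L 25860656688702595) (L 24734893379004531))))))) (L 26996795673709154))))⟩,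
  ⟨7307708949848205429806186323621879419449176555522, 3436510720018, (Q 23 (L 33495677758699944) (Q 67 (L 33497751762453864) (Q 344 (Q 360 (L 15200903784606064) (L 15200903818029424)) (Q 342 (L 15200903818029424) (Q 393 (Q 394 (L 15202977788224834) (L 15202977754801474)) (Q 425 (L 15202977754801474) (Q 361 (L 15730745751786529) (Q 377 (L 33504361612482354) (Q 394 (L 11262338164876610) (Q 20 (L 15210799410210064) (L 20555512795408688)))))))))))⟩,
  ⟨5846207312517302511602501438960357721761563869186, 3307963887904, (Q 73 (Q 116 (L 15484517456759120) (Q 424 (Q 120 (L 11262385154730320) (L 2259720042228048)) (Q 132 (L 15484517442144080) (Q 276 (L 15488314125009200) (Q 120 (L 11543860131440976) (Q 100 (L 15203042465433424) (L 15735133206645394))))))) (Q 116 (L 20276252896634977) (L 15483345043954310)))⟩,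
  ⟨14619052810231688580654800471883886363955308855298, 2418622398723, (Q 377 (L 33743152954844738) (Q 312 (L 6450358066378306) (Q 103 (L 29805187820905794) (Q 275 (Q 401 (L 6439313109226306) (Q 152 (Q 100 (L 15727917426715009) (Q 343 (L 11787126406879250) (L 11791515863455760))) (Q 100 (L 15736713519737104) (Q 373 (L 11791515863451920) (L 11787126406875410))))) (Q 276 (L 6298575620878658) (Q 314 (L 29803432403773284) (Q 66 (L 6193022504604227) (L 6193022504612162))))))))⟩,
  ⟨7307619692422232599963466853022986139108151197698, 2268582654481, (Q 362 (Q 359 (L 24743908733523216) (Q 390 (L 24739228963800336) (Q 327 (L 11508749446837264) (L 11368011958481936)))) (Q 393 (Q 360 (L 24739536456684816) (Q 120 (Q 424 (L 11515473753040144) (Q 361 (L 24739228963800336) (Q 340 (Q 65 (L 11470187617605272) (Q 64 (L 11260112143669670) (Q 133 (L 11509112841458689) (Q 129 (L 11302062115000387) (Q 16 (L 11403560782151698) (Q 32 (L 11473929526329602) (L 11265159183343640))))))) (Q 388 (L 11509112841454864) (Q 65 (L 24736817840744871) (Q 64 (L 24736882248476826) (Q 169 (L 11513686961783824) (L 11513618242372609))))))))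 (Q 406 (L 24739228934432016) (L 24739228963800336)))) (Q 354 (Q 122 (L 11370339546718736) (Q 135 (L 11375020152087056) (L 11370340348879376))) (Q 386 (Q 18 (L 11508658107222439) (Q 2 (L 24739218155088261) (Q 135 (L 24600834918093313) (Q 54 (L 11370365551260176) (Q 169 (L 24739258361734416) (L 24739262655653136)))))) (Q 402 (Q 18 (L 24735740277725811) (Q 135 (L 24741572406448656) (Q 101 (L 11370338218186256) (Q 21 (L 11435510541472035) (L 11365940171675216))))) (Q 154 (Q 88 (L 24739227873290256) (Q 135 (L 24604133318764048) (Q 21 (L 11505578148202849) (L 24743624577623361)))) (Q 361 (L 24739536456746256) (Q 121 (L 11514374241477904) (L 24739228145911056)))))))))⟩,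
  ⟨5846118055091329681759781189170994767929078251522, 2405486826032, (Q 362 (Q 86 (Q 327 (L 24314806702397097) (L 29775398243313472)) (Q 327 (Q 88 (L 24455544190756250) (Q 325 (L 24463584268741235) (Q 424 (L 11754883800922278) (L 11543777585165976)))) (L 24206926269466536))) (Q 424 (Q 388 (L 33744455048145233) (Q 89 (L 20484395568245074) (Q 90 (L 20414026824066450) (Q 340 (L 11754883800922278) (L 6238010807461219))))) (Q 133 (L 6194176994215232) (Q 99 (L 11618819237258800) (L 11548450493081136)))))⟩,
  ⟨4384616417760426763556096356453919126833356406786, 2212210348547, (Q 405 (Q 84 (L 6622569126271586) (Q 83 (Q 100 (L 11407502533155238) (L 11267864522881685)) (Q 99 (L 29662730584929856) (Q 67 (L 24218289827969361) (Q 425 (L 15731954227046569) (Q 343 (L 29803467049890624) (L 15731954227046554))))))) (Q 422 (Q 69 (L 11724161882102371) (Q 357 (L 6231623922640279) (Q 361 (L 24454830859310195) (L 6193008763114817)))) (Q 406 (L 29669372531742016) (Q 70 (L 33743483613653363) (Q 389 (L 20374444792456768) (Q 277 (L 11786934714515795) (Q 84 (L 6200356627646882) (Q 151 (L 11684580537235874)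 (L 11786915417572760)))))))))⟩,
  ⟨2923114780429523845352411523737636095082980507650, 1113201836833, (Q 325 (Q 168 (L 6195134004225347) (Q 410 (L 2254514512553283) (Q 120 (L 11756674385221203) (Q 40 (L 29593425919246917) (Q 36 (L 29734163407602245) (Q 323 (L 11754949270209093) (L 11757149099664198))))))) (Q 135 (Q 137 (L 24245475482232128) (Q 342 (L 20276111952214177) (L 11331672609350979))) (Q 406 (Q 356 (L 29802950759454834) (Q 373 (L 11751795436373658) (L 11786979789531560))) (Q 122 (L 24245906991387968) (Q 137 (L 29593776812496192) (L 24738054009226836))))))⟩,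
  ⟨14619030509486490050031658888942669462837730017282, 211312251424, (Q 154 (Q 132 (L 33743084953704293) (L 33743067778029413)) (Q 138 (Q 118 (L 6477499343677473) (L 6477499327948833)) (Q 164 (L 29520938157119333) (Q 118 (L 6477774221583393) (L 6477774205854753)))))⟩,
  ⟨5846095754346131151136639606241667369827757522946, 1108692119585, (Q 100 (Q 101 (L 11259639610386545) (Q 150 (L 24631470080738970) (L 15199804188957319))) (Q 86 (L 11259149749230215) (Q 166 (L 15200276685695089) (L 15199808482876039))))⟩,
  ⟨4384594117015228232932954773512702225715777568770, 2268548051472, (Q 67 (L 15622971870098518) (Q 115 (Q 259 (L 6475035127002198) (Q 298 (Q 370 (L 33328830525698729) (Q 18 (L 15633338253519238) (Q 306 (L 15351884131019142) (Q 154 (L 24488499481097302) (L 24488503775016022))))) (Q 167 (L 33223277409434153) (Q 154 (L 33469568014056082) (Q 402 (L 33469568014056082) (L 33331029548954264)))))) (Q 163 (Q 359 (L 15628467279902548) (Q 121 (L 33214743449121878) (Q 343 (L 15627367768274788) (Q 169 (L 33287190886193712) (L 33427928374552880))))) (Q 169 (L 29273541586859094) (Q 57 (L 29273541587842134) (Q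 122 (L 33214223759127638) (Q 374 (L 24209700214514496) (Q 259 (L 11716569155146561) (Q 342 (L 33217522294023488) (Q 326 (L 33325106962056824) (L 6202916595989042)))))))))))⟩,
  ⟨2923092479684325314729269940796419193965401669634, 2199878906114, (Q 328 (Q 340 (L 11472386052671642) (Q 393 (Q 167 (L 2255605199373633) (L 2255540774864193)) (Q 135 (L 11262338984797505) (Q 425 (L 2537015751574849) (Q 151 (L 6196161021572417) (Q 122 (L 11262308502693185) (L 6477635998160193))))))) (Q 325 (Q 118 (L 24489629342721112) (L 33742522061199203)) (Q 118 (L 24489629342721352) (Q 329 (L 24734756793591651) (L 33742474816358243)))))⟩,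
  ⟨14619008208741291519408517353223676249530961035266, 2268599423504, (Q 89 (Q 53 (L 6199536455621252) (Q 340 (Q 122 (L 6228941181977689) (L 6726339964209782)) (Q 154 (L 6481011432331908) (Q 90 (L 6621748920691076) (Q 122 (L 29348740455896368) (Q 121 (L 29348740458845488) (L 29519989394741123))))))) (Q 120 (L 33742123723035953) (Q 394 (L 33742119429117233) (Q 393 (L 33742119431083313) (Q 133 (L 33742119431144753) (L 33742119431133233))))))⟩,
  ⟨4384571816270029702309813237793709193828427169794, 2268582654480, (Q 165 (Q 133 (Q 340 (L 24741837986433651) (Q 327 (Q 122 (L 24741837987686211) (L 11265050732374370)) (Q 388 (L 24741837987416691) (Q 406 (L 11266837438813865) (Q 167 (L 11262439459231400) (L 15201024045909394)))))) (Q 135 (Q 327 (L 24455407255127450) (L 11265050732374370)) (Q 340 (Q 362 (L 15200779164615829) (L 24462149716109225)) (Q 359 (Q 169 (L 11262441641637440) (L 11262441608029760)) (Q 154 (L 11266837438813850) (Q 361 (L 24734864606069841) (L 11262439493904260))))))) (Q 151 (Q 167 (Q 135 (L 11265050732374370) (Q 406 (L 15485118446999360) (Q 327 (L 24736882231838106)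 (Q 328 (L 24736882234787226) (Q 149 (L 11548871266752576) (L 20794196392257412)))))) (Q 372 (L 11260112092624010) (L 11265050732558690))) (Q 340 (Q 362 (L 15200779164615829) (Q 167 (L 11260112163800165) (L 15200792117609554))) (Q 154 (Q 406 (L 15484912154352260) (L 11262749134333760)) (Q 167 (Q 86 (L 24739226647439241) (L 11262753429296960)) (Q 327 (L 11546525709085026) (Q 359 (L 24734864338682961) (Q 101 (L 15484585737037640) (Q 408 (L 15201023978805349) (L 15485118413510720))))))))))⟩,
  ⟨2923070178939126784106128405077425980658632687618, 219060314881, (Q 69 (Q 132 (L 24665496408917072) (Q 137 (L 24524758920561744) (Q 118 (L 29278002090518919) (Q 169 (L 24243283943851088) (Q 166 (L 33747796314593888) (Q 376 (L 24243283993064528) (Q 73 (L 15305550343014250) (L 11751958541608803)))))))) (Q 66 (L 15692313295159877) (Q 106 (L 29279376479132259) (Q 103 (L 24737917083940521) (L 11331774460893249)))))⟩,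
  ⟨2923047878193928253482986869359153321304946442242, 2268582654480, (Q 340 (Q 67 (Q 260 (L 24736909652078661) (Q 291 (L 24741584582101146) (Q 292 (L 20372126874219073) (Q 20 (L 24743891601270441) (Q 120 (L 24736263759893826) (Q 149 (L 11262718867253360) (Q 154 (L 24745923072823431) (L 15482233337116745)))))))) (Q 115 (L 15205704919120534) (Q 163 (L 15487179896076950) (Q 147 (L 15628054823465878) (Q 54 (L 11260122379990850) (Q 291 (L 11261614842288695) (Q 361 (L 24744105729275541) (L 24734856020321601)))))))) (Q 422 (Q 394 (Q 327 (L 20796510875126122) (Q 154 (L 20515035965598051) (Q 406 (L 20515035965598051) (L 11260407875807570)))) (Q 154 (Q 388 (L 20796510942308707) (Q 120 (L 24734829826779201) (L 11265119451843170))) (Q 133 (L 15622978812942418) (Q 101 (Q 408 (L 15482241257478230) (Q 122 (L 15200766347872594) (Q 135 (L 11543914470615156) (Q 372 (L 11262475329899120) (L 24321816525252177))))) (Q 327 (L 20796266061998422) (Q 388 (L 20794458385066372) (L 20374053597062743))))))) (Q 394 (Q 154 (L 15484843435075700) (Q 149 (L 15203368458365044) (Q 90 (L 15203368458426484) (Q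 327 (L 24736882231839066) (Q 135 (L 20512721420523636) (Q 151 (L 15622978830690898) (L 24741906707219571))))))) (Q 408 (Q 374 (L 11541617638283346) (Q 404 (L 24737190832088931) (Q 149 (L 11262439477323620) (Q 169 (L 15203106468505444) (Q 101 (L 24735112640174721) (Q 372 (L 15201298855447189) (L 24734828735145801))))))) (Q 89 (L 15203368458357364) (Q 374 (L 15484598621873780) (Q 404 (L 20372314640591173) (Q 122 (L 24317014182553512) (Q 420 (L 24736882235180121) (Q 121 (L 20374642007497078) (Q 372 (L 11541588227688786) (L 15201092762052754))))))))))))⟩,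
  ⟨13153716457066679985018134453027524762864763076610, 2268582654480, (Q 408 (Q 54 (Q 422 (L 22065523369351249) (Q 291 (L 11235316891593093) (Q 293 (L 10952742403253642) (L 10812004914898314)))) (Q 52 (L 16854431549323928) (Q 49 (L 34869917844195477) (Q 327 (L 22203628109724312) (Q 329 (L 34304914896492625) (Q 325 (L 21957337505106298) (Q 86 (L 12357424628779162) (L 15730876340341159)))))))) (Q 135 (Q 67 (Q 325 (L 21957337505102488) (L 34867864836474177)) (Q 99 (L 16854431549323418) (Q 83 (L 17980331488668297) (Q 117 (L 20840796787270464) (Q 86 (L 34867865388934977) (Q 169 (L 32686432335604103) (L 32651247963510906))))))) (Q 359 (Q 388 (L 1981702478526002) (Q 89 (L 20831437549299624) (L 12315652350650210))) (Q 55 (Q 99 (L 16713694060968090) (Q 101 (L 33038276056479898) (L 17980622923868502))) (Q 362 (Q 328 (L 19248433081132659) (L 15165581908548197)) (Q 86 (L 2263031712487488) (Q 291 (L 19246002197665914) (Q 295 (L 22670384401179968) (Q 388 (L 14743369443485273) (L 25297787582715473))))))))))⟩,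
  ⟨7307708949507923062840682840435999141439307055106, 2203606717186, (Q 425 (Q 420 (L 21358172338559094) (L 20232500551452515)) (Q 330 (L 20232496256550755) (L 21358172338497654)))⟩,
  ⟨5846207312177020144636997176584007770260234108930, 5117051441, (Q 370 (Q 298 (L 1971452427531587) (Q 294 (Q 18 (L 13800181034297684) (Q 296 (Q 65 (L 7907175475540) (L 9015106430216532)) (Q 168 (L 1980319329322307) (L 4223252492875075)))) (Q 168 (L 1980319329322307) (L 19714342373594435)))) (Q 138 (L 2252927639496003) (Q 106 (L 3106219676566851) (Q 357 (L 31782706721679511) (Q 48 (L 16827310102175796) (Q 356 (L 16862494474265648) (Q 293 (L 32064181698390167) (Q 328 (L 2822472945150290) (L 18264077971375753)))))))))⟩,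
  ⟨4384705674846117226433312343866932129164512264194, 1318842470450, (Q 344 (Q 132 (L 20233939096983395) (Q 167 (L 20233317133166435) (Q 121 (L 21357146484999489) (L 20233317133154915)))) (Q 154 (L 21359198836660854) (Q 137 (L 20936986371594870) (L 21218461348305526))))⟩,
  ⟨2923204037515214308229627511150649097414136365058, 69558350352, (Q 340 (Q 406 (L 19176007620199745) (L 19738957573621057)) (Q 406 (L 2255622895142208) (Q 402 (L 3824151004480) (Q 344 (L 19809326317798721) (Q 81 (L 1764141482738960) (Q 154 (L 14637816394123922) (Q 33 (L 30370851971238311) (L 21363652716497319))))))))⟩,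
  ⟨14619052809891406213689296917862508842900761149442, 219849761056, (Q 387 (L 30364555799992916) (L 31490461595706690))⟩,
  ⟨5846118054751047314794277635149617246874530545666, 1181922501377, (Q 327 (L 23896936064252073) (Q 120 (Q 374 (L 30370788301834901) (L 12355290280663687)) (Q 359 (Q 340 (L 12352120209827722) (L 12355290280663687)) (Q 361 (L 25017339641030992) (Q 328 (L 23898035575884438) (Q 101 (L 23894591584692648) (Q 98 (L 31494754984696455) (Q 89 (L 24806233408498000) (L 25017339641030032)))))))))⟩,
  ⟨4384616417420144396590592802432541605778808700930, 2199846400528, (Q 106 (Q 325 (L 12251999857109656) (L 5640564216452745)) (Q 408 (Q 356 (L 29249367508945267) (Q 101 (L 12111262368754328) (Q 394 (L 12251999857125766) (Q 410 (L 30366660083223191) (L 30366660083222951))))) (Q 105 (Q 356 (L 29108630020593779) (Q 101 (L 12111262368754328) (L 30234512529385863))) (Q 325 (L 30375250017741191) (L 24877621334792819)))))⟩,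
  ⟨2923114780089241478386907969716258574028432801794, 3518168567843, (Q 86 (Q 404 (L 29239837547136592) (Q 104 (L 30365707087288421) (Q 152 (L 30295338343110757) (Q 376 (L 23826765716097344) (Q 423 (L 12103506301781588) (L 5876138881025609)))))) (Q 104 (Q 330 (L 30365707087288421) (L 23686993767868806)) (Q 329 (L 30155481107753114) (L 29169468802958928))))⟩,
  ⟨14619030509146207683066154626566319511336400257026, 73318535474, (Q 388 (Q 67 (L 34873652716800417) (L 34310702763379105)) (Q 420 (Q 67 (L 4787767978788432) (Q 404 (L 3788591367760) (Q 66 (L 4788863195448912) (Q 169 (L 3098637048772176) (Q 65 (L 7039286455334480) (Q 422 (L 20829291409983864) (L 21357009833707314))))))) (Q 154 (L 1972736638613072) (L 1972736622884432))))⟩,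
  ⟨5846095754005848784171135343865317418326427762690, 2272844067344, (Q 406 (Q 356 (L 20233784478046835) (Q 390 (Q 372 (L 23048032441620120) (Q 133 (L 21359203130444199) (L 21359460828481959))) (Q 101 (L 25299852804393383) (Q 133 (L 14743369443334298) (L 25299832405514663))))) (Q 340 (Q 67 (L 24736884113753481) (Q 362 (L 10134213481612696) (L 10802716551300489))) (Q 356 (Q 88 (L 23048032407017895) (Q 149 (L 21359667037182579) (L 23048032423794855))) (Q 101 (L 25299852804393383) (Q 362 (L 25297800453834833) (Q 133 (L 11937539531572858) (Q 372 (L 24177230749141354) (L 25860731075774545))))))))⟩,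
  ⟨4384594116674945865967450511136352274214447808514, 1237774774560, (Q 106 (Q 357 (Q 37 (L 3948977886423684) (Q 356 (L 11831857819109032) (Q 135 (L 21122245489682545) (L 21192614233860209)))) (Q 37 (L 4230452863134340) (Q 373 (L 13091964570720064) (Q 53 (L 25062916889077824) (Q 55 (L 31173433289495412) (Q 135 (L 32897776889656130) (Q 67 (L 31208617661584199) (Q 38 (L 25731393938155637) (Q 424 (L 24489579145356592) (Q 356 (L 28395614178281299) (Q 393 (L 32901996946487450) (L 16011094119368360)))))))))))) (Q 356 (Q 121 (L 7602616158217297) (L 7039666204795985)) (Q 343 (Q 122 (L 31210264758495059) (L 11830822479222682)) (Q 121 (L 12253657967334976) (Q 372 (L 13090798750353064) (Q 167 (L 21192550061996384) (L 3099136786725201)))))))⟩,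
  ⟨2923092479344042947763765678420069242464071909378, 68989158162, (Q 101 (Q 323 (Q 74 (L 19140378286634358) (L 19703328240055670)) (Q 164 (L 3350289400944260) (L 19984803445299096))) (Q 100 (Q 308 (L 20090356332971607) (Q 310 (L 19808881356322391) (Q 374 (L 1764796032890480) (Q 339 (L 9017674985464992) (Q 117 (L 20019994295490458) (Q 371 (L 13521266023031968) (Q 135 (L 2820324796413560) (Q 393 (L 11261923963668035) (L 2182708663567184))))))))) (Q 117 (L 5922051773061016) (Q 121 (L 6062789261416344) (Q 122 (L 24076088259270568) (Q 394 (L 6167242866055080) (Q 120 (L 21216799985334436) (L 24181641375537034))))))))⟩,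
  ⟨14619008208401009152443013090847326298029631275010, 3517629727506, (Q 154 (Q 328 (L 29242019088472657) (Q 104 (L 29945688830151077) (Q 152 (L 6756873460554304) (L 7038348437264960)))) (Q 104 (L 7742035879041600) (L 7179085925620288)))⟩,
  ⟨4384571815929747335344308975417359242327097409538, 3299122160385, (Q 423 (Q 71 (L 12110227534281368) (Q 134 (L 24177311528494744) (Q 69 (L 11828752557570712) (Q 377 (L 23893492154800038) (Q 166 (L 11822027264906377) (Q 393 (L 24172945194190144) (L 10696128212784243))))))) (Q 134 (Q 164 (L 24142127156590217) (L 15765322515187281)) (Q 74 (Q 323 (L 12110502412110488) (Q 425 (L 10698471620900433) (Q 377 (L 10135521667479121) (L 10698484383127173)))) (Q 69 (L 11828752557582232) (Q 393 (L 10133178259362931) (L 10696128212784243))))))⟩,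
  ⟨2923070178598844417140624142701076029157302927362, 2276333789954, (Q 323 (Q 84 (Q 407 (L 33741910150960178) (L 8869348341156214)) (Q 423 (L 26887595125607033) (L 8869348325427574))) (Q 423 (Q 387 (L 25198745281071737) (Q 403 (L 32758325999801172) (Q 394 (L 23791371136764537) (Q 117 (L 25086771206793266) (Q 169 (L 24776532816005753) (L 13444906459231824)))))) (Q 387 (L 7180498480892278) (Q 408 (L 5632386848229750) (L 5773124336585078)))))⟩,
  ⟨14619142066977096676611077953332874931374230929410, 8606716417, (Q 54 (L 33786519688213825) (L 32653889047533396))⟩,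
  ⟨13153716456726397618097195947063500327952529293314, 2272324100115, (Q 340 (Q 314 (L 3342597595900295) (Q 313 (L 18122193973295495) (Q 135 (L 24737999395195296) (Q 103 (L 24175049443862944) (L 23893574465063328))))) (Q 404 (Q 169 (L 10661114158553206) (L 15164713785923702)) (Q 118 (L 15727637969664154) (Q 101 (L 14883213039532186) (L 15446162992953498)))))⟩,
  ⟨5846207311836737777716058670631872838364258435074, 2211944996913, (Q 133 (L 15763118946297411) (Q 326 (L 14636866634029667) (L 14636866617252452)))⟩,
  ⟨4384705674505834859512373837902907694252278480898, 3509576597538, (Q 88 (Q 168 (L 15626411315987728) (Q 154 (L 14781986385855760) (L 15344936339277072))) (Q 407 (Q 378 (L 16754364699539762) (Q 90 (L 15628463819487538) (Q 278 (L 32686434804908393) (Q 321 (L 34023440157852009) (L 32756803549086057))))) (Q 323 (L 31562587391353669) (Q 310 (L 31773693623886661) (L 31632956135531333)))))⟩,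
  ⟨2923204037174931941308689005186624662501902581762, 1314280046898, (Q 328 (Q 169 (L 20301546801178689) (Q 423 (L 20864496756750401) (L 21145971731372097))) (Q 154 (L 21360302625430134) (Q 377 (L 21289933881244070) (L 21149196392900982))))⟩,
  ⟨14619030508805925316145216120613103715529855664130, 8641389328, (Q 84 (L 5632124032223895) (L 6758045967559024))⟩,
  ⟨4384594116334663499046512005183136478407903215618, 1176873468690, (Q 357 (Q 394 (L 11120467442685507) (Q 408 (L 12246366861940291) (Q 389 (L 10557517489264195) (L 11683416908518979)))) (Q 372 (L 22556618928968822) (Q 340 (L 22626987673146486) (Q 323 (L 11226050623591473) (L 12351920230781767)))))⟩,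
  ⟨2923092479003760580842827172466853446657527316482, 2340794073889, (Q 69 (Q 423 (L 29239759452411202) (Q 425 (L 5638309070338710) (Q 168 (L 29802675919557954) (L 23756061672831625)))) (Q 406 (L 6755980105066849) (Q 410 (L 6826348849244513) (Q 137 (L 24876481486629254) (L 11753850076226883)))))⟩,
  ⟨14619008208060726785522074584883301863117397491714, 2281199308835, (Q 72 (Q 305 (L 3106808167221366) (Q 154 (L 5633150277953910) (Q 321 (L 2543858213800054) (Q 377 (L 3352016354441555) (L 31641341999220563))))) (Q 423 (L 2255481142290273) (Q 305 (L 3247545655576694) (Q 321 (L 2684595702155382) (L 3352016354441555)))))⟩,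
  ⟨4384571815589464968423370469453334807414863626242, 3303417127681, (Q 150 (Q 72 (L 15765322515125841) (Q 376 (L 23895836551837338) (Q 152 (L 21327648764106817) (L 14639597913344357)))) (Q 355 (Q 308 (L 10423722439829927) (Q 378 (L 21367222086940584) (Q 138 (L 21367222086941319) (Q 376 (L 21368321598568329) (L 9017808364271697))))) (Q 339 (L 21358183701689664) (Q 168 (L 21363055966791744) (Q 69 (L 9007277747418522) (L 12947929016185991))))))⟩,
  ⟨4384705674165552492591435374438884759789192151042, 138027340336, (Q 394 (Q 372 (L 21357008939096229) (L 20231460934359635)) (Q 372 (L 21357008939096709) (L 20231469524293715)))⟩,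
  ⟨14619008207720444418601136121419278912161636745218, 1314260070416, (Q 377 (L 30364265761695041) (Q 423 (L 29238366090782017) (Q 374 (L 29801315808273729) (L 28675416137360705))))⟩,
  ⟨7307708950529512662051792826376065581290246701058, 211275678499, (L 20232562879853600)⟩,
  ⟨5846207313198609743848107162524074210111173754882, 3375844429857, (Q 377 (L 33788080372151890) (Q 362 (L 1698760268097601) (Q 374 (L 1980234976438337) (L 1980235244808257))))⟩,
  ⟨7307686595352427704036346295246893814448630333442, 1242053095682, (Q 422 (L 6764338936976704) (Q 152 (L 11261281435161920) (Q 425 (L 11261281435223360) (L 11261281434240320))))⟩,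
  ⟨5846184958021524785832660631394902443269557387266, 2268582642192, (Q 359 (Q 326 (Q 120 (L 28965677401663401) (L 25194864980747312)) (Q 393 (L 33788483581084720) (Q 86 (L 25194297614226992) (Q 135 (L 24777093243499568) (Q 388 (L 29275945729287984) (Q 339 (L 24772066658314148) (Q 323 (L 25299832237480103) (Q 149 (L 22555451722393667) (L 27026139317241136))))))))) (Q 135 (Q 408 (L 24772712376857648) (Q 361 (L 24781284326343728) (L 27024391931327536))) (Q 362 (Q 327 (L 28965677401667241) (Q 325 (L 11059031031707288) (Q 322 (L 2222530151876521) (Q 86 (L 24772101557089328) (Q 371 (L 29273541084394584) (L 6200215899302552)))))) (Q 327 (L 10707187310818968) (Q 325 (L 10988662287529624) (Q 133 (L 29419776130909232) (Q 387 (L 29519848868906033) (Q 322 (L 1981668385912472) (Q 101 (L 30933802947205543) (Q 65 (L 27270100705105530) (Q 21 (L 17850049710290194) (L 6485272039814808))))))))))))⟩,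
  ⟨4384683320690621867628975798677826802173835542530, 2204157161985, (Q 425 (Q 72 (L 29244948810865267) (Q 406 (L 24736818063121011) (Q 137 (L 6763312386185809) (L 7044787362896465)))) (Q 360 (L 7185524851255633) (Q 100 (L 24596080574769523) (L 15766061522261841))))⟩,
  ⟨14619052810912995812900406903802575282751700795394, 2268584751635, (L 29240831333004592)⟩,
  ⟨5846118055772636914005387621089683686725470191618, 3440588763424, (Q 152 (L 29238914917697362) (Q 106 (L 25016300226389842) (Q 121 (L 6759253139757664) (Q 425 (L 11090788306557010) (L 6762208077322864)))))⟩,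
  ⟨4384616418441733995801702788372608045629748346882, 1245811127074, (Q 389 (L 6760307015386384) (Q 393 (L 6901044503741712) (Q 53 (L 6906170316118182) (L 6758835758139814))))⟩,
  ⟨14619030510167797282277264612506385951187339902978, 1104076152848, (Q 361 (L 34304915921265985) (L 34023440944555329))⟩,
  ⟨5846095755027438383382245329805383858177367408642, 81605632019, (Q 423 (L 20234936638744640) (Q 87 (L 25300940991453608) (Q 101 (L 10697287281301923) (Q 374 (L 9008437424252307) (L 21923786499008576)))))⟩,
  ⟨4384594117696535465178560497076418714065387454466, 142541402161, (Q 138 (Q 389 (L 8320161516130) (Q 373 (L 34034911622420544) (Q 53 (L 19816567901009306) (Q 69 (L 852745091648098) (Q 357 (L 27270613814368320) (Q 122 (L 2226031124182321) (L 11262921720506210))))))) (Q 122 (L 29244330353403697) (L 28822117888337713)))⟩,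
  ⟨14619008209422598751654123076787392737880570920962, 150594588707, (Q 410 (L 28817458654255168) (L 7181401682651473))⟩,
  ⟨4384571816951336934555418961357425682178037055490, 2337318908432, (Q 135 (L 15766076031268416) (Q 121 (L 10699490871309888) (Q 118 (L 10980965848020544) (L 16047551007979072))))⟩,
  ⟨5846207312177014952337663436976215529573372198914, 2203603575075, (Q 328 (L 33747971836512098) (Q 425 (Q 118 (L 15481205968644485) (L 15481205984373125)) (Q 372 (L 15727496555436679) (Q 345 (L 15586759084910936) (L 6588432607978614)))))⟩,
  ⟨4384705674846112034133978604259139888477650354178, 2268582654480, (Q 169 (Q 120 (L 33750626951735633) (Q 117 (L 33539666175424931) (Q 422 (L 11262479625193280) (L 11262463519065920)))) (Q 99 (Q 151 (L 11266709094046340) (L 29277809068636329)) (L 20268489816761152)))⟩,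
  ⟨14619030509146202490766820886958527270649538347010, 69525909537, (Q 120 (L 29522312837956928) (Q 393 (Q 89 (L 6614946250381706) (Q 86 (L 6474208762026378) (L 2255622607832658))) (Q 88 (L 2255824471033698) (L 24737182801955136))))⟩,
  ⟨5846095754005843591871801604257525177639565852674, 146065593090, (Q 117 (Q 325 (L 24630298377864570) (Q 378 (L 24630298377869220) (L 24700667122047604))) (Q 88 (Q 372 (L 11263474481330840) (Q 325 (L 23609952291866522) (L 11266773016201880))) (Q 340 (Q 89 (L 11262375022118825) (Q 90 (L 24735851494136391) (Q 390 (L 24735852317398851) (L 24735852854138691)))) (L 24640266575312265))))⟩,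
  ⟨4384594116674940673668116771528560033527585898498, 2268582654480, (Q 393 (Q 406 (L 2260197034072128) (Q 86 (L 6661056462416263) (Q 424 (Q 133 (L 24741837986433651) (Q 99 (L 20339115185182256) (Q 327 (L 29343910381040758) (L 24490610691429232)))) (Q 89 (L 24601169217558643) (Q 340 (L 29526427044174248) (Q 327 (L 6484989145536903) (L 11400850740561298))))))) (Q 133 (L 15737731108145779) (Q 340 (L 29385689555818650) (Q 390 (Q 372 (L 11506402768405864) (L 6659811495414373)) (Q 388 (L 11409980111751778) (Q 372 (L 11400850725881938) (L 6725782192032167)))))))⟩,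
  ⟨4384571815929742143044975235809567001640235499522, 3513854792240, (Q 84 (Q 132 (L 11260249065674360) (Q 87 (L 24737019155031126) (L 24701834782942294))) (Q 86 (L 24701834782942294) (Q 70 (Q 169 (L 24737019173885046) (L 24737021302559841)) (Q 133 (L 11260249065735800) (Q 71 (L 24737021302559841) (L 24737019121476711))))))⟩,
  ⟨14619142066977091484311743576205607503285265170434, 1305957577266, (Q 408 (L 34304924493321265) (L 31771649434616881))⟩,
  ⟨13153716456726392425797861569936232899863563534338, 1314280046898, (Q 169 (Q 166 (L 11261431921616960) (Q 356 (L 22482969366587473) (Q 377 (L 20266362359749252) (Q 165 (L 19741823623145842) (L 15448374866451078))))) (Q 424 (Q 165 (L 11231739184261218) (Q 118 (L 15202079966853784) (Q 356 (L 20794119351134377) (Q 423 (L 15237268633921926) (L 20234412617214050))))) (Q 423 (Q 165 (L 33745751591397218) (Q 371 (L 24319148779993752) (Q 325 (L 31711050864239937) (Q 388 (L 12350838043879222) (L 13758207826045317))))) (Q 420 (L 16187440508676480) (Q 355 (L 13758206806551192) (Q 106 (L 11683649218455104) (L 24769961987123588)))))))⟩,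
  ⟨5846207311836732585416724293504605410275292676098, 3445119726112, (Q 73 (L 15206289586296949) (Q 67 (L 14643951381542177) (Q 292 (L 15769921667762001) (L 16895821542098770))))⟩,
  ⟨4384705674505829667213039460775640266163312721922, 1306210152976, (Q 390 (Q 424 (L 20231244041848385) (L 19809031576782401)) (Q 393 (L 2262880885311858) (L 2685093350377842)))⟩,
  ⟨14619030508805920123845881743485836287440889905154, 1100351550001, (Q 151 (L 6755778492340834) (Q 327 (L 29803819870745649) (Q 362 (L 6228949606229824) (Q 167 (L 6756715317590404) (L 6756735718435204)))))⟩,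
  ⟨4384594116334658306747177628055869050318937456642, 1237774774560, (Q 373 (Q 345 (L 11121639180293952) (Q 342 (L 6200357063907752) (Q 134 (L 13373439010690880) (Q 150 (L 13373439563159360) (L 13373439496312640))))) (Q 121 (L 24286223829194650) (Q 122 (L 24215855085017721) (L 6201456575535017))))⟩,
  ⟨5846207313198604551551248589929979780426244358146, 2280644477729, (L 20232132309260930)⟩,
  ⟨11692191507579075393608686583284327998267023491074, 1309984038931, (Q 378 (L 26988653004040289) (Q 134 (L 9008467890832707) (Q 391 (L 24776474218890563) (Q 169 (L 11231651187501153) (Q 19 (L 26109039445958964) (Q 150 (L 9289947160417603) (L 11094212234012785)))))))⟩,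
  ⟨5846184958021519593535802058800808013584627990530, 320938768, (Q 346 (L 6762148198328704) (Q 104 (L 24734765607913281) (L 29247019555657537)))⟩,
  ⟨14619030510167792089980406039911210657591841587202, 2268582654480, (L 29240830187838067)⟩,
  ⟨7307708950529523056707351130928730195325774528514, 131633, (L 16888727965571650)⟩,
  ⟨7307686595352438098691904599799558428484158160898, 1112414360338, (Q 377 (Q 391 (L 23613251433096497) (L 28122494385415473)) (Q 137 (L 23613251466519857) (L 28122494385415473)))⟩,
  ⟨5846184958021535180488218935947567057305085214722, 3445118533923, (Q 103 (Q 278 (L 4503751047411866) (Q 165 (L 26424714432505737) (Q 314 (L 27841285663859522) (Q 35 (L 6725992397301632) (L 27594995059237443))))) (Q 391 (L 28116301580297538) (Q 408 (L 31494001300825410) (L 29242201487140162))))⟩,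
  ⟨7307664294593947490935009941868951948992361594882, 3298587386627, (Q 116 (Q 357 (L 28017824659490697) (L 28115712842818848)) (Q 391 (Q 118 (L 10137566573992531) (Q 132 (Q 357 (L 28123377775757193) (L 28115716869350688)) (Q 164 (Q 134 (L 27873788642740819) (Q 321 (L 8137912270223392) (Q 357 (L 27982640287401865) (L 21366356949029664)))) (Q 84 (L 25871110580438560) (Q 393 (L 25862049617101600) (L 25862049632830240)))))) (Q 103 (L 10137566588738131) (L 10137566573009491))))⟩,
  ⟨5846162657263044572731324278016960577813288648706, 2268599431696, (Q 169 (Q 149 (L 25862782394672995) (L 26988682301515619)) (Q 103 (Q 106 (L 9573590979209024) (L 9855065955919680)) (Q 122 (L 9573590979212864) (L 9855065955923520))))⟩,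
  ⟨4384661019932141654527639445299884936717566803970, 219866477314, (Q 135 (Q 327 (L 9826358671996978) (Q 154 (L 28116789578209893) (Q 115 (L 9994583954523953) (Q 137 (L 27694577113143909) (L 27835314601629797))))) (Q 340 (L 28253129029469546) (Q 388 (L 28393866517824874) (L 18683543309027122))))⟩,
  ⟨5846118055772647308660945925642348300760998019074, 1319397036832, (Q 361 (Q 374 (L 28112873105824323) (Q 137 (L 28118993215260498) (Q 135 (L 9963857217423186) (L 28114045412865618)))) (Q 152 (L 9968182468580931) (L 28113839254505298)))⟩,
  ⟨4384616418441744390457261092925272659665276174338, 1310505238561, (Q 391 (Q 138 (L 26143097479661396) (Q 149 (L 9996830459467058) (Q 84 (L 34874937748858992) (L 27867605564478514)))) (Q 138 (L 26002359991306068) (Q 378 (L 26002359991183188) (Q 154 (L 26002359992219988) (L 26002359991171668)))))⟩,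
  ⟨2923114781110841472253576260208989627914900275202, 1177659908624, (Q 355 (L 7883018500474418) (Q 371 (L 25933151140939319) (L 25897966768850487)))⟩,
  ⟨5846095755027448778037803634358048472212895236098, 2268582654480, (Q 362 (Q 120 (L 9573590979209024) (Q 408 (L 10136540917884736) (Q 133 (L 26425732346976867) (L 26425732376320422)))) (Q 89 (L 26425732400502387) (Q 361 (L 25862782394657395) (Q 90 (L 26988682352940659) (Q 115 (Q 388 (L 21816858829743920) (Q 356 (L 9679144069917095) (Q 404 (L 9684513351878225) (Q 424 (L 14114706569202017) (L 26425732350175347))))) (Q 291 (L 21823824887977280) (Q 294 (L 19572025074292032) (Q 169 (L 25831996069095218) (L 19571801534866752)))))))))⟩,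
  ⟨4384594117696545859834118801629083328100915281922, 146331934978, (Q 325 (Q 330 (L 17313006886733104) (L 17031531910022448)) (Q 37 (Q 35 (L 35149284512514613) (Q 339 (L 35149284512514613) (Q 135 (L 25621164388022426) (Q 165 (L 16755870852733592) (L 26750398329203265))))) (Q 36 (L 35114100140425811) (Q 86 (L 27584653388161878) (L 17881702107073176)))))⟩,
  ⟨7307664294252920658169569443842666357702140166146, 2268582720016, (Q 135 (Q 393 (Q 359 (L 23608931213874497) (Q 361 (L 23620259468973377) (Q 101 (L 23617854287550017) (Q 132 (L 12500489505121875) (L 23617579409643092))))) (Q 406 (L 12639999223227713) (Q 359 (L 23608930947532097) (L 23620328188446017)))) (Q 406 (Q 100 (Q 101 (L 23610982832446067) (Q 393 (L 12529077901035872) (L 23610983635589747))) (Q 69 (L 12388339316857464) (Q 360 (L 23619297396294977) (Q 424 (L 12388340412680544) (L 12386013396165954))))) (Q 374 (Q 422 (L 23618197884671297) (Q 260 (Q 384 (L 12501941772451905) (Q 400 (L 12642679263921473) (Q 262 (Q 259 (L 23611293495078977) (Q 393 (L 12642679260807233) (Q 167 (L 23620328188446017) (L 12631684148790593)))) (Q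 393 (L 23608930159072577) (Q 167 (L 23620328188446017) (Q 151 (L 23619297396294977) (Q 169 (L 23608931228681537) (L 23608930158150977)))))))) (Q 65 (L 12396388656185364) (Q 272 (L 12396388656185364) (Q 167 (L 23620362548171777) (Q 169 (L 23617726252143617) (L 23617726251160577))))))) (Q 424 (L 12638899693847873) (L 23608930410730817)))))⟩,
  ⟨5846162656922017739965883779990674986523067219970, 2280930882096, (Q 362 (Q 70 (Q 52 (L 30654389070097047) (Q 49 (L 5494743484482322) (Q 84 (L 31498814000228250) (Q 86 (L 31499020170259095) (Q 390 (L 23620258864850297) (L 5603523893176693)))))) (Q 67 (L 23609276650400117) (Q 99 (L 5603386454354293) (Q 72 (L 30935864046930583) (Q 291 (L 5173548348220234) (Q 151 (L 30933665023761028) (L 30652190047050372))))))) (Q 54 (Q 52 (L 30927342831831703) (L 30927274129132183)) (Q 70 (L 30927274129132183) (Q 169 (Q 167 (L 5181173989288309) (Q 149 (L 31501494104987715) (Q 86 (L 5113004268283800) (L 30647824315409457)))) (Q 121 (Q 86 (L 5075620872939433) (Q 165 (L 13485996083882051) (L 30647824063751217))) (Q 361 (L 22766834172912689) (Q 137 (L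 23336309987121781) (Q 167 (L 30929696007558193) (Q 165 (L 13485996083882051) (Q 291 (L 12491985523385160) (Q 416 (L 5603396173799473) (Q 86 (L 5075620872939898) (L 5355996338084489)))))))))))))⟩,
  ⟨4384661019591114821762198947273599345427345375234, 69004898832, (Q 389 (Q 342 (L 5604700762507843) (Q 74 (L 12421196357993831) (Q 73 (L 12386014131225954) (Q 408 (L 13265623428203879) (Q 69 (L 30513788515297654) (L 23329944876911011)))))) (Q 394 (L 5323225785797187) (Q 84 (L 22764506081416289) (Q 83 (L 23337624295135396) (Q 132 (L 23619099271973027) (Q 135 (L 23608931181426017) (Q 52 (L 23617999760340137) (L 23477262271984809))))))))⟩,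
  ⟨5846118055431617433534064879865499117383083687938, 2409513419281, (Q 423 (Q 362 (L 21642327966250000) (L 26145641443456016)) (Q 371 (Q 360 (L 21508256262812432) (L 5741178457322256)) (Q 360 (Q 87 (L 21648993751167760) (Q 362 (L 32619381793379344) (L 32619930216465424))) (Q 354 (L 5740014807441936) (Q 377 (L 21642259264594960) (L 26145641443456016))))))⟩,
  ⟨4384616418100714515330380047148423476287361843202, 2268581605904, (Q 344 (Q 422 (L 5633288074593600) (Q 374 (L 3381716154156352) (L 7885315781526848))) (Q 340 (Q 362 (L 21498145915176257) (Q 424 (L 5774025562948928) (Q 329 (L 12350827659564712) (L 23679297542116506)))) (Q 394 (L 5639464738458210) (L 5780202226813538))))⟩,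
  ⟨2923114780769811597126695214432140444536985944066, 3440823705649, (Q 86 (Q 148 (L 14567026172986963) (Q 72 (L 10062874107610707) (L 12314673921295955))) (Q 73 (L 30367004506031696) (Q 376 (L 28115174086379088) (Q 103 (L 23653875359124034) (L 32622106608502624)))))⟩,
  ⟨14619030509826777801805941871282201381844953399298, 81640235537, (Q 376 (Q 113 (L 5640090945029715) (Q 33 (L 4514191038187091) (L 10591410816595))) (Q 390 (Q 138 (L 3377809146275122) (Q 377 (L 5629613741466930) (Q 362 (L 5629603797955890) (Q 137 (L 7881413051835698) (L 113703937330))))) (Q 377 (L 3096312398976306) (L 5629603797955890))))⟩,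
  ⟨5846095754686418902910922588581199288834980904962, 150377537585, (Q 103 (Q 378 (L 23612600787363137) (Q 377 (L 19109005438182721) (Q 70 (Q 84 (L 12385042127288979) (L 14636858047101587)) (Q 86 (L 14636853768911507) (L 9007358512888467))))) (Q 419 (Q 403 (L 9016635633674082) (Q 101 (L 21323999267210602) (Q 100 (L 14753736988984208) (Q 3 (L 14682373455425569) (Q 19 (L 14682502304444704) (Q 138 (L 21359184444605799) (L 21359183909832039))))))) (Q 403 (Q 137 (L 9014367890938482) (L 23611013804016992)) (Q 138 (Q 423 (L 21360831529387329) (Q 88 (L 14109424014108977) (Q 418 (L 19109031364429396) (Q 72 (L 14109424281495857) (Q 387 (L 19107592298583721) (Q 425 (L 24174972200720449) (Q 323 (L 21359226588972384) (L 24737173705616016)))))))) (Q 425 (L 21360243106157889) (Q 354 (L 9053860892412209) (Q 293 (L 12385385419541139) (Q 49 (L 9124323135755028) (L 24175340240912809)))))))))⟩,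
  ⟨4384594117355515984707237755852234144723000950786, 82142502931, (Q 378 (Q 71 (Q 292 (L 28119464456518293) (Q 308 (L 9159481939491170) (Q 391 (L 23751665660675665) (Q 311 (L 985255457010786) (Q 3 (L 14788981473704290) (Q 138 (L 23751665659692625) (L 22625765752850001))))))) (Q 169 (L 23615869157878097) (Q 406 (L 5603807110600273) (Q 168 (L 32200855947553105) (Q 165 (L 22626928800995136) (Q 422 (L 21501298420127552) (L 21219823443416896))))))) (Q 87 (Q 339 (L 4515153157773206) (Q 362 (L 14673610921375024) (L 30649510041122112))) (Q 138 (Q 132 (L 32204017043547985) (Q 308 (L 20941303388255370) (Q 312 (L 4362954877711458) (Q 292 (L 27700709440128849) (Q 293 (L 18967746031277993) (L 18123321100347305)))))) (Q 71 (Q 390 (L 3379439820384067) (L 21220029585925696)) (Q 137 (L 32200993386498385) (Q 407 (L 21220167021729856) (Q 149 (L 29953106844940352) (L 3382785885968482))))))))⟩,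
  ⟨2923092480024613066503552923135951112972625051650, 146567012371, (Q 87 (Q 391 (Q 72 (L 30833128474183507) (Q 70 (L 30410916009117523) (L 23506536477644681))) (Q 100 (L 12314741299369865) (Q 164 (L 21360307496179824) (Q 308 (L 13652264234607666) (Q 19 (L 34910980878381449) (Q 24 (L 35051718366736777) (Q 362 (L 14320693469881889) (L 12882089322633097)))))))) (Q 338 (Q 71 (L 17312400768529699) (Q 70 (L 20836914460763529) (L 25934286685480304))) (Q 148 (Q 322 (L 30551443330376856) (Q 391 (L 9009004584015987) (Q 90 (L 34943133289915936) (Q 393 (L 19111990324070821) (L 9220110816548979))))) (Q 32 (L 30410723021889688) (Q 144 (L 30551460510245016) (Q 408 (Q 292 (L 9576063415134599) (Q 407 (L 21227241084180376) (L 21156872340002712))) (Q 425 (Q 71 (L 11822160104868262) (Q 422 (L 12808782820840563) (L 6123532547954803))) (Q 339 (L 18619405103888538) (Q 423 (L 30366725334214481) (Q 292 (L 18585392973638281) (Q 71 (L 5138046198956627) (L 5419521175667283))))))))))))⟩,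
  ⟨4384571816610317454084096220133241112835650551810, 78115909650, (Q 89 (Q 325 (L 12393158265903714) (Q 52 (L 16900073591167330) (Q 406 (L 11868708918286689) (L 24171741851505799)))) (Q 359 (Q 326 (L 12423386809074791) (Q 388 (L 24174069148055194) (L 19108031233296721))) (Q 328 (Q 67 (L 21364228774725969) (L 26993715491080529)) (Q 52 (L 26430550186429077) (Q 169 (L 21357193658476659) (Q 408 (L 14640014912235362) (Q 424 (L 21889168321259904) (L 11863073921206929))))))))⟩,
  ⟨2923070179279414535880411387416957899665856069634, 2418604573442, (Q 323 (Q 376 (L 27056862257505093) (Q 137 (L 22491219084142978) (Q 169 (L 13443131740744344) (Q 362 (L 13232025508227462) (L 27901319414637381))))) (Q 137 (Q 355 (L 21365319177300354) (Q 361 (L 30927142399861573) (Q 50 (L 12043659596936839) (Q 169 (L 29950305966975362) (Q 422 (L 12319007610397520) (L 9785733354775376)))))) (Q 423 (Q 320 (L 6062162247419814) (Q 384 (L 14859217342302359) (Q 130 (L 14648111109769367) (L 12325959207430295)))) (Q 130 (Q 35 (L 12114852974897303) (Q 360 (L 32336020011125028) (Q 362 (L 29949824930580137) (L 29879456186402473))))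 (Q 114 (L 12325959207430295) (Q 377 (L 30371281481443226) (L 3317797880014758)))))))⟩,
  ⟨5846207312177025346993221741528880143608900026370, 2277171540496, (Q 408 (L 3388931699152192) (Q 135 (L 14358685986354496) (Q 115 (L 30551043613362516) (Q 405 (L 21609891804841778) (L 16713694031747190)))))⟩,
  ⟨4384705674846122428789536908811804502513178181634, 1113218818306, (Q 135 (L 14500372879673169) (Q 138 (L 14359635391317841) (Q 167 (L 14500372879669329) (Q 116 (L 30510434119813474) (Q 311 (L 21392262941012801) (L 16862200588642658))))))⟩,
  ⟨14619030509146212885422379191511191884685066174466, 1237774774560, (Q 167 (L 3380345491138897) (Q 424 (L 30645876214442082) (L 30645876214434402)))⟩,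
  ⟨5846095754005853986527359908810189791675093680130, 2418355081986, (Q 325 (Q 103 (L 12492664396465545) (L 12492664379753865)) (Q 330 (Q 329 (L 23610466639325027) (Q 118 (L 12492664379754885) (L 12492664396466565))) (Q 326 (L 23609951535782042) (Q 103 (L 23608926715463762) (L 23608926716446802)))))⟩,
  ⟨4384594116674951068323675076081224647563113725954, 3307443720962, (Q 151 (Q 373 (Q 340 (L 32627458672261474) (Q 106 (L 30647314742159187) (Q 53 (L 34879274843732322) (L 30469746366756212)))) (Q 104 (L 12536227923658577) (Q 394 (L 12532860669437777) (Q 52 (L 32580819397210952) (Q 425 (L 21468385509943665) (Q 388 (L 7606559206312597) (L 30509261894683234))))))) (Q 425 (Q 421 (L 14499608374449984) (L 14499350676412224)) (Q 150 (Q 135 (L 12387690774763089) (L 12388923714471744)) (Q 122 (L 3380345491138897) (Q 104 (L 12536227923658577) (Q 326 (L 12635600874604178) (Q 67 (L 25866148809828730) (L 14498201298482769))))))))⟩,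
  ⟨2923092479344048150119990243364941615812737826818, 3307443720962, (Q 388 (Q 166 (L 3381518301308992) (Q 425 (L 12529515174143552) (Q 424 (L 3381578431047232) (Q 405 (L 30440056800320115) (L 30435933631715955))))) (Q 410 (Q 167 (L 21427519184545858) (L 21427776882583618)) (Q 120 (Q 424 (L 21427527774537538) (L 30575713625679938)) (Q 122 (L 21427527774533698) (Q 424 (L 30438893150505570) (L 12527848734042182))))))⟩,
  ⟨14619008208401014354799237655792198671378297192450, 3380141371425, (Q 376 (L 3388283127494737) (Q 407 (L 30506294317578664) (Q 359 (L 30647031805933992) (L 3529020615850065))))⟩,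
  ⟨4384571815929752537700533540362231615675763326978, 2272627003952, (Q 342 (Q 118 (L 12386148887852454) (L 12386148887852394)) (Q 373 (Q 407 (L 21640828454270305) (Q 404 (L 14358565668492421) (Q 169 (Q 106 (L 21638668636039555) (L 23608791881180297)) (Q 137 (L 14358539904129106) (L 21640944418330465))))) (Q 377 (L 21640828454270305) (Q 166 (L 12388785989265234) (Q 118 (L 12388785989510994) (L 12386148887852394))))))⟩,
  ⟨2923070178598849619496848707645948402505968844802, 1314849424144, (Q 314 (Q 424 (L 3380544148048432) (Q 376 (L 3521281636403760) (Q 343 (L 21431792375007058) (Q 408 (L 12598483581695331) (Q 104 (L 3520060759574100) (Q 310 (L 12597114476979111) (L 32480162331453266))))))) (Q 394 (Q 104 (L 21639017065253425) (Q 376 (L 3596031247223344) (Q 343 (L 21431792375007058) (Q 169 (L 21427704705886513) (L 23503315536414266))))) (Q 391 (L 3591650380581424) (Q 104 (L 21427910832720433) (Q 129 (L 30442188195639690) (Q 154 (L 21427704668064163) (L 21427704675412273)))))))⟩,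
  ⟨2923047877853651088873707171927675743152282599426, 3504726880784, (Q 327 (Q 343 (L 12388580401514304) (Q 376 (L 21497896798684997) (L 21497939757729617))) (Q 373 (L 12386012020442949) (Q 391 (L 12386012020442439) (L 21497896798685012))))⟩,
  ⟨13153716456726402820453419874488897513899091361794, 3367842616080, (Q 103 (Q 423 (L 12923152936367409) (L 17426752563737905)) (Q 378 (L 17145277587027249) (Q 407 (L 26151510474126641) (Q 87 (L 21507173358400817) (Q 394 (L 8959630342720) (Q 388 (L 574108601776512) (L 574108597582212)))))))⟩,
  ⟨5846207311836742980072282598057270024310820503554, 211261915171, (Q 390 (L 14183850407585961) (Q 362 (Q 86 (L 21921273148254581) (L 21921273153497456)) (Q 169 (L 14113481663408552) (L 14183850407586456))))⟩,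
  ⟨4384705674505840061868597765328304880198840549378, 1237490807042, (Q 86 (Q 98 (L 35994336232629571) (Q 149 (L 21674896176797322) (Q 162 (L 35149707785446723) (Q 394 (L 14076043220847255) (Q 410 (L 31745195086551584) (Q 41 (L 32202591916370215) (L 32089694406025879))))))) (Q 407 (L 32335031294072643) (L 32194293805717315)))⟩,
  ⟨2923204037174937143664912932612021848448464650242, 219079053872, (Q 360 (Q 391 (L 19108039789872721) (L 13512058190063728)) (Q 376 (Q 362 (L 13652795678419056) (Q 343 (L 18894734016087619) (Q 357 (L 16892523106035010) (L 18615458580629073)))) (Q 357 (L 18967302301517393) (L 18896933557339729))))⟩,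
  ⟨14619030508805930518501440048038500901476417732610, 13475328528, (Q 137 (L 28115036644410963) (Q 104 (L 5067924862044583) (Q 101 (L 31490370166220865) (L 5630874835524210))))⟩,
  ⟨4384594116334668701402735932608533664354465284098, 2268581605904, (Q 344 (Q 393 (L 7885122507998528) (Q 406 (L 30929678771784103) (L 30933801940388263))) (Q 329 (Q 340 (L 9993476093856098) (Q 345 (L 9993479298505058) (Q 154 (L 12810990435018048) (Q 388 (L 23086515301665122) (Q 121 (L 13371176601077090) (Q 327 (L 12843408855352730) (L 11119376032417122))))))) (Q 328 (L 22523565347326050) (Q 340 (Q 53 (L 25444967405406631) (Q 346 (L 6765381004253794) (Q 356 (L 23188771777627703) (L 12810553196635968)))) (Q 154 (L 12810990435018048) (L 9993496478434658))))))⟩,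
  ⟨2923092479003765783199051099892250632604089384962, 1100335882259, (Q 122 (Q 342 (L 23089757406255002) (Q 425 (L 23118778283496769) (Q 370 (L 10630667130349139) (L 4505156704171331)))) (Q 410 (Q 342 (L 5074259385146008) (Q 120 (L 7882850502681923) (Q 314 (L 30929633470423873) (L 11228350509577818)))) (Q 346 (L 5144628129323672) (Q 69 (Q 120 (L 30935997471881878) (L 13441668607473219)) (Q 405 (L 23189147027674433) (L 10062942054210162))))))⟩,
  ⟨14619008208060731987878298512308699049063959560194, 3436294705952, (Q 394 (Q 122 (L 7883949698689088) (L 8306162163755072)) (Q 106 (Q 105 (L 8025855131952721) (L 31349559362414707)) (Q 425 (L 7885113348499793) (L 3803726186195281))))⟩,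
  ⟨4384571815589470170779594396878731993361425694722, 3504693518640, (Q 84 (Q 308 (L 12387104316863574) (Q 394 (L 23330706428299921) (Q 378 (L 23331113376447121) (L 26423547864257637)))) (Q 73 (Q 164 (L 9572353508459879) (Q 424 (L 12387103243126119) (L 13230639903450192))) (Q 169 (L 12105628298855783) (Q 164 (L 13231528188986727) (Q 419 (L 9572355001697639) (Q 323 (L 9853829828003175) (L 12387104613545319)))))))⟩,
  ⟨2923070178258567252575909564162448780191631212546, 69004886307, (Q 74 (Q 276 (L 27699103728604329) (Q 342 (L 9642925173130593) (Q 394 (L 3659823608859203) (L 3800561097214531)))) (Q 276 (L 27628734984426665) (Q 69 (Q 169 (L 23541649494352978) (Q 37 (L 27972883519784230) (Q 342 (L 9924400149841249) (Q 35 (L 27867330403517029) (Q 339 (L 30159741817340759) (L 26364665638638743)))))) (Q 308 (Q 169 (L 5561335845331781) (Q 408 (L 4752095289316180) (Q 135 (L 21855130510439542) (L 21855130491696262)))) (Q 169 (L 5490967101154357) (Q 373 (L 5565878343714161) (Q 135 (L 15694678239708257) (Q 118 (L 23504410550879861) (Q 38 (L 9676284981568835) (Q 151 (L 27693992226747714)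 (L 14320143143577239)))))))))))⟩,
  ⟨2923047877513368721952768028444176120837944967170, 69275422752, (Q 373 (Q 83 (L 26151063767963561) (L 26995488697235369)) (Q 377 (Q 393 (L 22343407760873300) (Q 354 (L 26994750242580644) (Q 386 (L 23610333780413012) (Q 132 (L 9854966279149665) (L 11826716754479482))))) (Q 354 (Q 104 (L 26995506156824489) (L 26992559809259684)) (Q 370 (Q 394 (L 11263478863636055) (Q 393 (L 9573483350037089) (L 21920181998032931))) (Q 376 (L 14078495680919970) (Q 408 (L 14077057207732065) (Q 154 (L 14078839278229890) (Q 405 (L 14501051743295874) (Q 346 (L 22484145248172628) (L 12388704354605649))))))))))⟩,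
  ⟨2923070177918284885654971100698425829235870466050, 2276635718160, (Q 420 (Q 121 (L 25931123390913089) (Q 169 (L 26212598367623745) (Q 101 (L 25370217375429987) (L 23116379022785089)))) (L 12878594333844562))⟩,
  ⟨5846184958021524785753297668929384591653388484610, 146618257968, (Q 103 (Q 164 (L 25835303420077688) (Q 342 (L 34877130011928387) (Q 373 (L 34877130011997507) (Q 52 (L 34841945643054130) (Q 116 (L 28297037195080873) (Q 410 (L 25862921460991825) (L 12317835854956370))))))) (Q 71 (Q 84 (L 7606500143167642) (L 10140182941829536)) (Q 72 (L 5636188714338720) (Q 105 (Q 373 (L 12104675252201888) (Q 161 (L 23857410672644521) (Q 81 (L 23787041928466857) (Q 134 (L 5633118314071890) (Q 33 (L 23646304439047849) (Q 164 (L 34878168620115537) (Q 425 (L 12357980587188517) (L 28402735768049269)))))))) (Q 166 (L 10137036037457746) (Q 164 (L 25764934675900024) (Q 408 (L 25762735652637034) (L 7604431286081362))))))))⟩,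
  ⟨14619030510167797282197901650040868099571171000322, 2345910997520, (Q 148 (L 28396542165817189) (Q 163 (L 34877136989038437) (Q 293 (L 7601132852036197) (Q 292 (L 7706685968302678) (Q 121 (L 28394498598343729) (Q 150 (L 1164702526117921) (Q 101 (L 5736840741419331) (L 3136372387308833))))))))⟩,
  ⟨5846095755027438383302882367339866006561198505986, 9180357378, (Q 150 (Q 117 (L 25861751317157545) (L 10138088322266416)) (Q 89 (Q 37 (L 14641166148803207) (Q 309 (L 10137575329471111) (Q 90 (Q 106 (L 14641720149256307) (Q 98 (L 14641790780344112) (Q 117 (L 25756198200891034) (Q 376 (L 25755456511824529) (L 10141502552835376))))) (Q 86 (L 25756198200891034) (Q 166 (L 25756198200891049) (Q 118 (L 25764038084765299) (L 25758777053111584))))))) (Q 104 (L 25861751367424420) (L 25861751317158310))))⟩,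
  ⟨4384594117696535465099197534610900862449218551810, 3436799078688, (Q 121 (Q 87 (L 34879258737604962) (Q 410 (L 10136476760831296) (L 10136476761814336))) (Q 150 (Q 104 (L 25721014149736787) (Q 410 (L 10282097233733184) (Q 424 (Q 326 (L 19215560489936992) (L 19175978071336040)) (Q 117 (L 25731321994508642) (Q 88 (L 7602505556264617) (L 7602436841114257)))))) (Q 394 (L 10141428464658496) (Q 86 (L 7643324925438594) (L 12247539606250816)))))⟩,
  ⟨2923092480365632546895512701894617830698842652674, 1250140762400, (Q 356 (Q 133 (Q 89 (L 1128621309003329) (Q 137 (L 10135949412763201) (L 1128625067103809))) (Q 167 (L 34869449551489107) (Q 406 (L 1135328721397664) (Q 410 (L 34869243661686867) (Q 372 (L 1129840021633664) (Q 360 (L 10346418671094388) (L 28395173145307219))))))) (Q 152 (Q 122 (L 19177074616473155) (L 19176752493925955)) (Q 120 (L 19176761083852355) (Q 121 (L 25650646980589123) (Q 360 (L 16864929215965298) (Q 86 (L 5711088094447984) (L 19140655991655033)))))))⟩,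
  ⟨4384571816951336934476055998891907830561868152834, 1113254339329, (Q 342 (L 10170689814898023) (Q 168 (Q 122 (Q 84 (L 10178258109036708) (L 21360490107663714)) (Q 74 (L 19389928381588562) (Q 421 (L 19389907176301922) (Q 152 (Q 405 (L 19388179830642752) (Q 118 (L 10133736983525971) (Q 166 (L 10133736983587411) (L 10135505442809191)))) (Q 121 (L 10133178258265171) (L 19388110832568212)))))) (Q 389 (Q 69 (L 19388179820075162) (Q 120 (L 10137576178809256) (Q 346 (L 21358522360244544) (Q 104 (L 16647230730963536) (Q 345 (L 10135505444886631) (Q 308 (L 21365032152750249) (Q 35 (L 25862120344344745) (Q 74 (L 10141355750017681) (L 10170826986137718))))))))) (Q 373 (L 10170689814898038) (L 10135505576035681)))))⟩,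
  ⟨13153716456726392425718498607470715048247394631682, 77880885809, (Q 329 (Q 89 (L 21112844584261750) (Q 424 (L 10133329279616866) (Q 338 (L 3102831236372871) (Q 169 (L 12103650045891878) (L 12103652731426658))))) (Q 154 (Q 89 (L 19142520040233078) (Q 340 (L 12361300028314672) (Q 338 (L 12349940651610727) (Q 2 (L 21360919208022114) (Q 5 (L 21255366091755558) (Q 90 (L 23646119667603574) (Q 308 (L 21225635785888816) (L 21366373274243124)))))))) (Q 424 (Q 133 (L 10133397982316386) (Q 293 (L 14777660010566950) (L 14883213140464231))) (Q 407 (Q 149 (L 16853611414460258) (L 14848028736792914)) (Q 149 (L 16749303548975747) (Q 101 (L 14636922524177762) (L 12350975447967847)))))))⟩,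
  ⟨5846207311836732585337361331039087558659123773442, 3371836780802, (Q 346 (L 14745568181377688) (Q 345 (Q 152 (L 14745568181377418) (L 14675199437199514)) (Q 404 (L 21358262516750454) (Q 343 (L 30373019314837346) (Q 342 (L 21358668939556194) (L 21358668939556434))))))⟩,
  ⟨4384705674505829667133676498310122414547143819266, 2199577047057, (Q 118 (Q 342 (L 21115026190722985) (Q 134 (L 30366967710311696) (L 34870567337682192))) (Q 356 (Q 340 (L 3244663704471209) (L 32900241543349520)) (Q 344 (L 3099528204412026) (Q 342 (L 3099528254547066) (Q 21 (L 19148080934120088) (L 19148012483078808))))))⟩,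
  ⟨2923204037174926748929991665593839382796767920130, 146584711186, (Q 103 (Q 357 (L 21251447238317688) (Q 69 (L 16751639488911002) (Q 70 (L 32661573530379426) (Q 408 (L 25871736253999000) (L 7819954349172634))))) (Q 408 (Q 116 (L 14640019107248282) (Q 425 (L 23892625238288553) (Q 391 (L 19245948743550789) (L 16819412230702656)))) (Q 391 (Q 116 (L 14851125339781274) (L 14849085818836544)) (Q 70 (L 16819411962271296) (L 14710387851425946)))))⟩,
  ⟨14619030508805920123766518781020318435824721002498, 3372407067184, (Q 420 (Q 404 (L 30366696586127201) (Q 169 (L 30366692559595361) (L 30366668645763446))) (Q 327 (L 30366668641569191) (Q 357 (L 5633348134652565) (L 5633348184984210))))⟩,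
  ⟨4384594116334658306667814665590351198702768553986, 2276653671184, (Q 389 (Q 134 (Q 424 (L 5631121423762755) (Q 388 (L 30364534847081111) (Q 373 (L 23756198829705385) (Q 166 (L 5631125450294595) (Q 120 (L 23752821004858690) (L 5631986598631530)))))) (Q 346 (Q 325 (L 23756198831932840) (L 12358520113752727)) (Q 326 (Q 373 (L 23760596876215945) (L 23749601893108375)) (Q 408 (L 30364809724979591) (L 30375117646489751))))) (Q 393 (Q 328 (L 30364827456407921) (Q 394 (Q 135 (L 23749885540207255) (L 30364534849165466)) (Q 372 (Q 151 (L 12352124257518982) (L 12352124255552902)) (Q 346 (L 30364534850214551) (L 5636247206184330))))) (Q 120 (Q 104 (L 12245922462730051) (Q 372 (L 5640929030731920) (Q 371 (L 5632908130158420) (L 5631804059579205)))) (Q 325 (L 23752850901992770) (Q 328 (L 23752850901992530) (Q 346 (L 30364534849165976) (Q 166 (L 12246572999395936) (L 12246572999394976))))))))⟩,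
  ⟨2923092479003755388464129832874068166952392654850, 1306478718994, (Q 84 (Q 120 (Q 408 (L 12317870128657730) (Q 121 (L 12317874155189570) (Q 169 (L 12317834798998850) (Q 117 (L 30300491789976952) (Q 359 (L 12350978447997097) (Q 360 (L 12350982742960297) (L 30370866730994081))))))) (Q 70 (L 23687956629055386) (Q 117 (L 30300491938874737) (Q 374 (L 12255711246706576) (L 12350964562741417))))) (Q 73 (Q 71 (L 23681490423989601) (Q 154 (L 12317870128657490) (L 12317874155189330))) (Q 394 (Q 71 (L 12316064131348640) (Q 135 (L 23749547028412585) (Q 408 (L 12317870128657490) (Q 169 (L 12317834765444930) (Q 72 (L 12351248494004887) (L 23679178284239511)))))) (Q 121 (L 12318352775615570) (Q 169 (L 5704472860338514) (Q 86 (L 5633073327150930) (L 5703442071328594)))))))⟩,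
  ⟨14619008208060721593143377245290516583412262830082, 2340758434305, (Q 152 (Q 73 (L 34874834116974672) (Q 89 (L 3242060896639094) (Q 71 (L 30224901019879248) (Q 138 (L 5629874827208850) (Q 67 (L 7746476577469575) (Q 378 (L 1126279494793874) (Q 321 (L 25792590815667216) (Q 305 (L 3242885540025479) (Q 58 (L 1126269585672074) (L 5875868918911814)))))))))) (Q 88 (L 3099837349595766) (Q 117 (L 5633081560369575) (Q 386 (L 3345951665576090) (Q 410 (L 5773819052919158) (L 5773819051870838))))))⟩,
  ⟨4384571815589459776044673129860549527709728964610, 2199041151746, (Q 105 (Q 100 (Q 101 (L 14639585834592647) (L 12106284501657713)) (Q 86 (L 10135960955414641) (L 12106284502640753))) (Q 100 (Q 84 (L 12106331743086983) (Q 134 (L 12106823509828928) (Q 87 (L 21357137507079849) (L 21358595640288579)))) (Q 104 (Q 86 (L 14639560582785137) (Q 73 (L 25860725961807010) (L 12106814650344608))) (Q 165 (Q 86 (L 10135316194548376) (L 12106823509828928)) (L 25860725861278810)))))⟩,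
  ⟨2923070178258556857840988297144266314539934482434, 2405486826032, (Q 362 (Q 86 (Q 327 (L 30163052834092394) (L 32766074379589287)) (Q 340 (L 23819899236934979) (Q 406 (L 30232322063496858) (L 21154960219862682)))) (Q 393 (Q 328 (L 3100240560556386) (Q 293 (L 19175566349066840) (Q 133 (L 23679162249807171) (L 25798545716382051)))) (Q 325 (Q 292 (L 19175566416175685) (L 3240978048911714)) (Q 326 (Q 374 (L 23899191211542183) (L 5781438609049448)) (Q 327 (Q 149 (L 12177097359971442) (L 5781438609049448)) (L 5778286597925258))))))⟩,
  ⟨2923047877513358327217846761425993655186248237058, 2203621393170, (Q 362 (Q 326 (L 23759484530017960) (Q 325 (L 23900222018373288) (Q 168 (L 21360839480339079) (L 12104898022311488)))) (Q 359 (Q 330 (L 23753338643588725) (Q 326 (Q 360 (L 21360730239034449) (Q 86 (L 12106327420922003) (L 23900222018380968))) (Q 325 (L 23900222018373288) (Q 137 (L 12104898022311488) (L 12111335350643078))))) (Q 138 (Q 420 (L 12104762183550548) (L 12104762187744848)) (Q 356 (L 12114015410218883) (Q 86 (L 10143691626080131) (Q 87 (L 25863966663469720) (Q 137 (L 25870563729042055)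 (L 25869464217414295))))))))⟩,
  ⟨13153716456386110058797560144006691932364889718786, 2268582850832, (Q 101 (Q 100 (Q 89 (L 19396112845923617) (Q 90 (L 32906847303525665) (Q 394 (L 1381649911932193) (Q 133 (L 10391039599994145) (L 14894639227364641))))) (Q 52 (Q 37 (L 12350837360325682) (L 21357267815920689)) (Q 36 (L 14638153046058032) (L 3308784445977648)))) (Q 100 (L 23758974984938785) (Q 82 (L 12350824976651587) (L 16854424604022083))))⟩,
  ⟨4384705674165547300212738034846099480084057489410, 2341310967826, (Q 376 (Q 389 (L 16610340970530714) (Q 138 (Q 388 (L 16610841875221074) (Q 425 (Q 378 (L 14678639951248024) (Q 152 (L 14643884574746432) (L 14643948999255872))) (Q 106 (L 14640304415484242) (L 14637958146139712)))) (Q 410 (L 14637958148228672) (L 14637958147245632)))) (L 14637959533393472))⟩,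
  ⟨14619008207720439226222438781826493632456502083586, 1173098606880, (Q 373 (Q 374 (L 30364401184111256) (Q 377 (L 28394106931018114) (L 28394077668342424))) (Q 359 (L 30364432602593666) (Q 362 (L 28394094042901144) (Q 377 (L 28394106932001154) (L 28394077399972504)))))⟩,
  ⟨2923070177918274490920049833680243363584173735938, 3513854796560, (Q 70 (Q 69 (L 12316939867804775) (L 12316939867800935)) (Q 87 (Q 69 (L 12321337796830295) (Q 74 (Q 101 (L 30370920678401111) (L 12316939867800935)) (Q 101 (L 25650062003952193) (Q 424 (L 10346615954638183) (L 25652776964498518))))) (Q 165 (Q 424 (L 23682452212569186) (Q 149 (L 23647265980240999) (Q 423 (L 23682452228297826) (Q 84 (L 25617592593568871) (L 12315670585255235))))) (Q 164 (L 25650062003952193) (Q 133 (L 12315670585236035) (Q 84 (L 30370920678401111) (Q 359 (L 30367690862994806) (L 12321406516307315))))))))⟩,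
  ⟨5846207313198604551471885060780483984452649811970, 3444582789153, (Q 134 (L 16328934428150183) (L 16888668945409345))⟩,
  ⟨5846184958021519593456438529651312217611033444354, 2268582838800, (Q 312 (Q 403 (Q 361 (L 23609016368838737) (L 23608999193163857)) (Q 362 (Q 394 (L 28112551739304273) (Q 86 (L 11826490304522032) (Q 89 (L 12396393953335344) (Q 371 (L 7364813978441783) (Q 71 (L 7329629606352951) (L 16337035019524148)))))) (Q 355 (L 23611293084904052) (Q 419 (Q 49 (L 29245452406831732) (L 20231333701105745)) (Q 371 (L 24171949082687569) (Q 360 (Q 133 (L 16432219382503529) (Q 154 (L 7326429855916866) (L 29248251890993767))) (Q 361 (Q 70 (L 29238795763476817) (Q 424 (L 16441015475537489) (Q 149 (L 24736882724738631) (L 29244953356114567)))) (Q 101 (L 24068379738990388) (Q 70 (L 28574251404060464) (Q 424 (L 16367348196477265) (L 29244953356114567))))))))))) (Q 362 (Q 394 (L 28115644115757393) (Q 86 (L 11826490304522032) (Q 89 (L 12396393953335344) (Q 169 (L 7326331074619776) (L 7326331074615936))))) (Q 169 (Q 120 (L 7323916547099046) (Q 149 (L 28648894067288403) (L 7889299296327728)))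 (Q 314 (L 20231325111171665) (Q 394 (L 28114948546865268) (Q 120 (L 6760966602066274) (L 29241530843048017)))))))⟩,
  ⟨4384683320690616675252753696922347073499053490178, 1173332435248, (Q 406 (Q 101 (Q 340 (L 24849101328176787) (Q 339 (L 19677487962543738) (Q 152 (L 29950702230591122) (Q 154 (L 12639103061695073) (Q 326 (L 9853828705379715) (L 23608797331809362)))))) (Q 326 (L 10669876927818151) (L 5604774783511153))) (Q 374 (Q 356 (L 7570276090341530) (Q 362 (L 5599951253366938) (L 18686842245507697))) (Q 371 (Q 326 (L 1172721494157106) (Q 314 (L 986435226842976) (Q 122 (L 9896933976205937) (Q 154 (L 27979502206610065) (Q 19 (L 565731301696272) (Q 23 (L 856062177863443) (Q 152 (L 30368517186033746) (L 34449930017478738)))))))) (Q 326 (L 609771573241649) (L 891246549952305)))))⟩,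
  ⟨2923181683359713757049068864206064041748677591042, 2268582654480, (Q 133 (Q 340 (Q 322 (L 6904548942824832) (L 7856226956499111)) (Q 338 (L 1415488617077160) (Q 359 (L 12879174820976482) (Q 117 (L 12808806076798818) (Q 327 (L 28156436843625110) (L 25792413717656931)))))) (Q 169 (Q 328 (L 28470897169172903) (Q 135 (L 27626472303200675) (Q 359 (L 25869379424385685) (Q 393 (L 7535023031290278) (L 7394285542934950))))) (Q 135 (Q 408 (L 8096419530770240) (Q 327 (L 29104215874107539) (Q 394 (L 27696841047378579) (L 8097991189047650)))) (Q 422 (Q 388 (L 25377897726839397) (Q 129 (L 27629645195610725) (Q 165 (L 28580298576136034) (Q 394 (L 23548310378220133) (L 28682003401706135))))) (Q 388 (L 5605938702878563) (L 1630100348241762))))))⟩,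
  ⟨14619030510167792089901042510761714861618247041026, 8861647379, (Q 165 (L 7882908132288578) (Q 328 (L 7319944442518146) (L 7319944440420996)))⟩,
  ⟨4384594117696530272802338395331747624496294592514, 137710739715, (Q 422 (Q 101 (L 10663133617673896) (Q 165 (Q 84 (L 3385956275346067) (L 25449851801327986)) (Q 424 (L 28116262556443968) (L 28116263093306688)))) (Q 101 (L 10557580501407370) (Q 88 (Q 390 (L 28116263093306688) (Q 311 (L 11155732377003824) (L 10663133735052181))) (Q 69 (L 25449851801327986) (L 21401385576979091)))))⟩,
  ⟨2923092480365627354598653562615464592745918693378, 2409494622226, (Q 134 (Q 420 (L 28677958614165605) (Q 101 (L 28115034748257873) (Q 391 (L 10063982841329232) (Q 133 (L 28115034748257633) (Q 169 (L 14569904819047063) (Q 106 (L 25438380263843416) (Q 329 (L 28675612792556180) (L 10630427957496464)))))))) (Q 168 (Q 420 (L 28675543804635305) (L 28679666973239465)) (Q 420 (L 28607589869987941) (L 28609298229061801))))⟩,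
  ⟨14619008209422593559277900975031913009205788868610, 2414043337010, (Q 359 (Q 422 (L 987573397382976) (Q 361 (L 1550523336058688) (Q 135 (L 27971860245674065) (Q 99 (L 35149472135210833) (L 30650568643144017))))) (Q 135 (L 27127435312654417) (L 28253335205799761)))⟩,
  ⟨4384571816951331742179196859601945953503255003138, 2337052696595, (Q 104 (Q 356 (L 10978762442434729) (Q 103 (L 14918420627219538) (Q 101 (L 16890261720622915) (Q 150 (L 16327346097580403) (L 10977736584225874))))) (Q 101 (L 10134854226503491) (Q 294 (L 9853379221284675) (Q 325 (L 9571799083084439) (L 16327370255722868)))))⟩,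
  ⟨2923070179620428823975512026885662740333460520962, 2268582654480, (Q 362 (Q 394 (Q 328 (L 20022730861873763) (Q 154 (L 21427778173380673) (L 21849990638446657))) (Q 328 (L 19565334020524647) (Q 393 (L 21852043064543587) (Q 54 (L 8023825463863621) (L 28534700063893047))))) (Q 120 (Q 328 (L 19573099321395042) (Q 394 (L 3806033591372386) (Q 86 (L 7540520589428073) (Q 88 (L 24912804316677481) (L 29101888571353169))))) (Q 327 (L 28157948672113250) (Q 86 (L 16890235920557650) (Q 169 (L 27974416948558435) (Q 406 (L 7882761787910498) (L 18896587493505379)))))))⟩,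
  ⟨13153716456726387233421639468190480946383901753346, 3436008645392, (Q 89 (Q 148 (L 21392254511192711) (L 3380330708183152)) (Q 73 (L 11824373011159687) (Q 133 (L 20266353771768232) (L 33751940643379778))))⟩,
  ⟨4384705674505824474836817359029888312683650940930, 1112950382851, (Q 423 (Q 118 (Q 405 (L 2823563884526225) (L 2823563880331925)) (Q 357 (L 2823563880261545) (Q 70 (L 15067931239344041) (Q 310 (L 6056123629529169) (Q 377 (L 15166755907801952) (L 20277504290027857)))))) (Q 137 (Q 405 (L 32623860261427264) (Q 410 (L 21501113451259712) (Q 344 (L 20375213546444608) (Q 84 (L 15070357895796851) (Q 105 (L 33186791943412356) (L 15174596752140932)))))) (Q 132 (L 21402158402669171) (Q 344 (L 21501115528423232) (Q 425 (L 21501114449435252) (L 20938164631283520))))))⟩,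
  ⟨2923204037174921556633132526313605280933275041794, 1306226860336, (Q 328 (Q 106 (L 3379183416158272) (Q 393 (Q 169 (L 15170198689835657) (L 15064645573569176)) (Q 407 (L 33182879212398741) (L 20833637356697994)))) (Q 393 (Q 326 (L 2825908112410775) (Q 65 (L 15738916786227349) (Q 50 (L 21392190964663331) (L 21430658608416373)))) (Q 326 (L 2896276856588439) (Q 149 (L 15130905159174480) (L 32619737091705169)))))⟩,
  ⟨14619008208060716400846518106010282481548769951746, 2268582654480, (Q 424 (Q 388 (L 32618564280420979) (Q 133 (L 33186087286626471) (Q 372 (Q 120 (L 20268745300068502) (L 20831695253489814)) (Q 361 (L 6053156025223314) (L 6721659026688167))))) (Q 89 (L 3381523887003712) (Q 165 (L 6055519791196224) (Q 340 (L 29276013272188329) (L 30507466312276339)))))⟩,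
  ⟨4384571815589454583747813990580315425846236086274, 3513588388400, (Q 329 (Q 340 (Q 154 (L 11830345702132102) (L 11830276982655622)) (Q 101 (L 24180941059934869) (L 24171741848294554))) (Q 361 (Q 360 (L 23611430825924177) (Q 330 (L 24171772378514599) (Q 65 (L 24737530671876486) (Q 88 (L 11825252566324342) (Q 167 (L 24172303880718919) (L 12429030848099921)))))) (Q 328 (Q 330 (L 11267395756050530) (Q 67 (L 24741934115539281) (Q 154 (L 24136592372831282) (L 23615517254829962)))) (Q 330 (Q 390 (L 24171772378514599) (L 24174105046853269)) (Q 149 (L 12388202487305334) (Q 393 (Q 65 (L 24706744346298754) (Q 81 (L 24139256607053072) (Q 154 (L 23611558869641297) (Q 88 (L 11262302611919990) (Q 374 (L 24142055003875472) (L 23611369891076177)))))) (Q 154 (L 11825252533884022) (Q 372 (L 12388203289547874) (Q 120 (L 11825951950608502) (Q 86 (L 11829650494215322) (Q 374 (L 23608791862306202) (Q 54 (L 11830239401711152) (Q 88 (L 24148110329927792) (Q 65 (L 12390546883769994) (Q 90 (L 12424486330063271) (Q 326 (L 23611119216707432) (Q 360 (L 23608791914800532) (L 11865534369208419)))))))))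)))))))))⟩,
  ⟨2923070178258551665544129157864032212676441604098, 2268582654480, (Q 89 (Q 340 (L 11833085929145752) (Q 374 (Q 101 (L 12458708133566068) (Q 362 (L 24180949616187049) (Q 406 (L 6063197013694104) (L 6133565757871768)))) (Q 326 (L 6696095379244440) (L 12491565167174745)))) (Q 90 (Q 340 (L 29846384926999976) (L 15137397758253480)) (Q 340 (Q 394 (L 11339405210371494) (Q 67 (L 6730463135877287) (Q 393 (L 29385689559156120) (Q 133 (L 29951938043266442) (L 20303667745424739))))) (Q 154 (Q 88 (L 15137397758253480) (Q 394 (L 15172582130342282) (L 33186087286626471))) (Q 422 (L 6055600858768704) (Q 393 (L 32616224095906129) (L 32616481793943889)))))))⟩,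
  ⟨13153716456386104866500701004716730055306276569090, 2268583703056, (Q 52 (Q 115 (Q 122 (L 25335038892208960) (Q 362 (L 14365714018481746) (Q 121 (L 34342582683792192) (Q 408 (L 25897989868974912) (Q 120 (L 12817316317575078) (L 31527832255038272)))))) (Q 99 (Q 406 (L 23371946905581138) (L 18868347278210642)) (Q 422 (Q 83 (L 25897989633106752) (Q 406 (L 19565066800686912) (L 21535117833496384))) (Q 374 (L 19002116862011200) (Q 394 (L 18016956455626304) (Q 388 (L 17139223531580049) (L 18861381378418292))))))) (Q 362 (Q 49 (L 34025492629316424) (Q 374 (L 16336038050100818) (Q 326 (L 564777328002642) (Q 135 (L 33777148899189880) (Q 342 (L 18861665118877232) (L 4408468251559505)))))) (Q 406 (L 25342270937200210) (L 20838671309829714))))⟩,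
  ⟨4384705674165542107915878895556137603025444339714, 219046551601, (Q 374 (Q 423 (L 19107405564114496) (Q 117 (L 21641706194959000) (Q 391 (Q 70 (L 19109139504855121) (L 19109138498222161)) (L 21923181171669656)))) (Q 377 (L 21640680261121600) (Q 86 (L 21086451734505353) (Q 422 (L 19671381626415768) (Q 309 (L 20233297169188160) (Q 164 (L 20234356549581185) (L 20234630353746305)))))))⟩,
  ⟨14619008207720434033925579642536531755397888933890, 150594588707, (Q 138 (Q 422 (L 28113796994607168) (Q 344 (L 6474204486989208) (Q 72 (L 10629363070838849) (Q 425 (L 28677891792669335) (Q 152 (L 7885123513256273) (L 28677891792669095)))))) (Q 132 (L 7885123513256273) (Q 362 (L 7322139167591061) (L 7322155273718421))))⟩,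
  ⟨14619008209422588366981042440203708191679993413634, 2272074404355, (Q 372 (L 28114961466423888) (L 28677889641970085))⟩,
  ⟨14619142066636798732717724476157899824709508333570, 3312008114209, (Q 104 (L 2815046708529575) (L 3377998526319217))⟩,
  ⟨13153716456386099674203842469888525221287806697474, 1108153151506, (Q 70 (Q 149 (L 11823209376934312) (Q 74 (L 20266289113360282) (L 20829239066781594))) (Q 89 (L 21392190340360616) (L 3379304196237952)))⟩,
  ⟨5846162657263044572652096082458524766306751807490, 1310502957874, (Q 377 (L 25860876017496865) (Q 169 (L 28112818130031393) (Q 376 (L 25860876018479905) (Q 168 (L 21357418688975649) (L 28122232396358433)))))⟩,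
  ⟨4384661019932141654448411249729559622194771853314, 4328591393, (Q 132 (Q 376 (L 35996200752022576) (Q 138 (L 25863217604887600) (Q 71 (L 10001227360598438) (L 34979387963311938)))) (Q 377 (L 9860489872243110) (L 10001227360598438)))⟩,
  ⟨14619030510167807676853594721499533889805761970178, 1250392347424, (L 28113010561619523)⟩,
  ⟨5846207312857590263297556225741453829262250409986, 3380679287088, (Q 378 (L 3386586933339712) (Q 133 (L 32622527531944594) (Q 87 (L 14638026598286912) (Q 371 (L 3378952100402752) (L 5635079361168960)))))⟩,
  ⟨5846162656922017739886655584432239175016530378754, 2268314219024, (Q 361 (Q 377 (L 12396388651735104) (L 12395495298529344)) (Q 423 (Q 89 (L 12388358405335104) (L 12388341229660224)) (Q 86 (Q 340 (L 23505429181585016) (L 12388339334871684)) (Q 88 (L 12388340697036864) (Q 325 (L 23610982580972147) (L 23580195966982770))))))⟩,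
  ⟨4384661019591114821682970751703274030904550424578, 2268582654480, (Q 122 (Q 327 (L 23617579359042197) (Q 359 (L 30509262180087889) (Q 394 (Q 169 (L 31494424612153425) (L 31212949635442769)) (Q 154 (L 31072212147087441) (Q 330 (L 31498823946119505) (Q 133 (L 12386013109855314) (L 22518214614688905))))))) (Q 393 (Q 361 (L 12393296275281984) (Q 86 (L 13373503905032000) (Q 169 (L 4511512736929856) (L 13373503116449600)))) (Q 120 (Q 327 (L 4509166787524706) (Q 151 (L 31494426755242065) (L 23613731118688337))) (Q 327 (L 5599882314676378) (L 31494426755242065)))))⟩,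
  ⟨14619030509826777801726713675722684706427847639042, 219046621217, (Q 388 (L 5633146039666530) (L 3383760255620962))⟩,
  ⟨4384594117355515984628009560292717469305895190530, 2406021607952, (Q 408 (Q 88 (L 32623206133434739) (Q 338 (L 10109485733665139) (Q 374 (Q 325 (L 23751719786141305) (L 23644113172264069)) (Q 328 (L 29804053759560054) (L 21392592790525016))))) (Q 362 (L 3386028301068352) (Q 388 (L 3389042799905122) (Q 101 (L 23751719785223800) (L 5631287120926290)))))⟩,
  ⟨4384571816610317454004868024562915798312855601154, 1314280046898, (Q 104 (Q 424 (L 14639136620512832) (L 13513236713670208)) (Q 408 (Q 407 (L 12387811887257664) (Q 328 (L 21642035331499930) (Q 117 (L 14637816158525267) (Q 133 (L 24460904510162330) (L 21642172787100070))))) (Q 133 (L 23617041965812322) (Q 325 (L 19105279840322881) (Q 328 (L 12104533016216663) (Q 106 (L 13511916220163443) (L 20767098970344035)))))))⟩,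
  ⟨4384705674505840061789369569767707340871165870082, 3517579395363, (Q 378 (L 3378288469059427) (L 14612596056816000))⟩,
  ⟨14619008208060731987799070316748101509736284880898, 1241298043681, (Q 152 (L 32619736086190144) (L 3380350067968627))⟩,
  ⟨4384571815589470170700366201318134454033751015426, 214749425697, (Q 362 (Q 378 (L 12388717604218434) (L 12388859338126914)) (Q 423 (Q 424 (L 23610393090091667) (Q 147 (L 23583016970778930) (L 23583042738350385))) (Q 55 (L 23584146544944945) (Q 154 (L 25865629380154960) (L 25865431811663440)))))⟩,
  ⟨4384705674165557694868431106293956631212959268866, 2207630037554, (Q 105 (L 16890190856743285) (L 22488412691007043))⟩,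
  ⟨4384683320690616675173525501360668670260809891842, 1169071026704, (Q 406 (Q 328 (L 10144383954676096) (L 10144109076769156)) (Q 424 (Q 133 (L 25870625465981095) (Q 393 (L 30370871529212531) (Q 154 (L 7185524931992128) (Q 89 (L 30370853393046131) (Q 340 (L 23716535742192038) (Q 388 (L 28227905099614374) (L 12245275116209506))))))) (Q 133 (L 25867808772741235) (Q 328 (L 12350828193416602) (Q 135 (L 7781313635842217) (L 25862782358881690))))))⟩,
  ⟨4384571816951331742099968664040267550265011404802, 2268582654480, (Q 133 (Q 393 (L 25872137294469235) (Q 390 (L 10144727552059456) (L 25867739784829555))) (Q 408 (Q 390 (L 25299832476894563) (L 25867738979535475)) (Q 406 (Q 169 (L 10142597248280896) (L 25862782429332835)) (Q 362 (Q 359 (L 10136540914816576) (Q 154 (L 10141497468229696) (Q 360 (L 25863101488596595) (Q 340 (L 10134213477696661) (Q 404 (L 25860752026276945) (Q 120 (L 14640488729909312) (L 25862782359074200))))))) (Q 154 (L 10141497468229696) (Q 424 (L 25863148733237875) (L 10141497468229696)))))))⟩,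
  ⟨5846162656922017740045246098455785585371855781890, 2418102252048, (Q 377 (Q 327 (L 5077614296864338) (Q 330 (L 12948963594970706) (L 12958436097754706))) (Q 372 (L 5077614296864338) (Q 388 (L 12958436144940626) (L 12948963547784786))))⟩,
  ⟨5846140356176815964239662828568458556137391849474, 1314798961426, (Q 393 (Q 406 (Q 326 (L 6203526819125072) (L 12958436901947216)) (Q 329 (L 8446050579941200) (Q 310 (L 9581424091371344) (Q 330 (L 12949165441656656) (Q 154 (L 6193837410654032) (L 14075550114154320)))))) (Q 391 (Q 389 (L 14075969728583235) (L 14076291851130435)) (Q 389 (L 14076429256529475) (Q 50 (L 20758892972036660) (Q 37 (L 17461838120847972) (L 20688524227858996))))))⟩,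
  ⟨4384638718845913046035977995839493412025411895298, 2280912986881, (Q 168 (Q 330 (L 9009606420965457) (Q 326 (L 9572556374386769) (L 3386024317175377))) (Q 356 (L 2260124410332753) (Q 357 (Q 328 (L 12947927119537526) (L 24243282280818023)) (Q 346 (Q 388 (L 24454388513351015) (L 15737864610596704)) (Q 388 (L 24313651024995687) (Q 118 (L 4091970322581347) (L 13169400884643683)))))))⟩,
  ⟨4384594117355515984786600074316263879661220593666, 3298820301603, (Q 121 (Q 66 (Q 37 (L 13940179686037297) (L 9436580058666801)) (Q 162 (L 11688154923370289) (Q 114 (L 21965658233251633) (Q 50 (L 9436355109685041) (L 3945735220787589))))) (Q 373 (Q 36 (L 11690626408228694) (Q 164 (L 12816526315071318) (Q 41 (L 5073857594532913) (Q 308 (L 15068334466901846) (Q 118 (L 35432463735493664) (Q 371 (L 27555513776580451) (L 27520329404622689))))))) (Q 118 (Q 36 (L 11690626408228709) (Q 355 (L 33180341581275936) (Q 73 (L 35434654168814624) (L 12815426803443288)))) (Q 36 (L 29772026407982947) (Q 148 (L 30897926314825571) (Q 37 (L 20910924761692483) (L 22036824668535107)))))))⟩,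
  ⟨2923092480024613066582915241599980847910844694530, 146347663619, (Q 408 (Q 325 (Q 122 (L 6200287875737987) (L 6195133914982787)) (Q 150 (L 24243146789119298) (Q 410 (L 4020304478251363) (L 22064389801683334)))) (Q 340 (Q 134 (L 21991745333470530) (L 21994021057505670)) (Q 151 (L 24315841455225222) (Q 425 (L 24315841454975352) (L 6270656619915651)))))⟩,
  ⟨5846207312517307713996307208524983922279069057026, 2277191656208, (Q 167 (Q 103 (L 32059800990807362) (L 23049167923340610)) (Q 166 (L 32060900502431042) (Q 118 (Q 135 (L 23049167923340610) (Q 393 (L 21923269896992066) (Q 101 (L 32063980174538897) (L 18542320175786369)))) (Q 121 (L 21923268268156226) (L 19672015811142978)))))⟩,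
  ⟨5846140355836533414826246048801643999107602251778, 1246096462595, (Q 118 (Q 166 (L 25303274133943328) (Q 134 (Q 105 (L 23051474320258080) (Q 410 (L 23051474320258080) (L 23051474571916320))) (Q 357 (L 23056240039011360) (Q 84 (L 13056788788634912) (Q 37 (L 13056771608765732) (L 13056780198700352)))))) (Q 99 (L 25306862461817888) (Q 353 (Q 275 (L 23055063151449120) (L 23055062648132640)) (Q 132 (Q 148 (L 23056350850811445) (Q 408 (L 23057381642962515) (L 10698604644158103))) (Q 100 (L 10698604644092058) (Q 36 (L 23046872713766535) (Q 4 (L 12989040508944403) (Q 342 (L 13056780198700352) (Q 38 (L 10704296863820193) (Q 69 (L 10698535923513498) (Q 41 (L 12987994433660263) (Q 289 (L 13053705250808147) (L 23053478375555490)))))))))))))⟩,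
  ⟨4384638718505630496622561216072678854995622297602, 206175281922, (Q 103 (Q 166 (L 12950636423571281) (Q 150 (L 30971739375953745) (Q 313 (L 6758320078874449) (Q 314 (Q 35 (L 13486077410026406) (Q 357 (L 6765432823704199) (Q 424 (L 31493329093364370) (L 6758217278728309)))) (Q 424 (L 31490236716911250) (Q 70 (L 30963701695276080) (Q 310 (L 31179341015168577) (Q 309 (L 31069389852402516) (Q 84 (L 22807617069921601) (Q 35 (L 13381702223143745) (Q 323 (L 31490092599493530) (L 31038603526824769)))))))))))) (Q 408 (Q 313 (L 24883185426536549) (Q 376 (L 31184572484057232) (L 31043834995701904))) (Q 100 (L 31179340914468417) (Q 357 (L 31210127240046164) (L 4796349520775472)))))⟩,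
  ⟨4384594117015233435326760543076247562322713837570, 1318588580131, (Q 377 (Q 406 (L 5067104242538323) (Q 278 (L 5067202976065363) (Q 274 (L 19712663498303315) (L 21964463311988563)))) (Q 389 (Q 390 (L 23084251531019642) (Q 278 (L 24318461336000322) (Q 423 (L 5067241682409043) (Q 373 (L 22063934573540674) (L 32054724521056352))))) (Q 137 (L 22064243810146114) (Q 406 (L 5072052044863603) (Q 390 (L 32061291006880322) (Q 378 (L 14048877294614608) (L 5067241682409043)))))))⟩,
  ⟨5846140356517840636977379169243616517903866724354, 2199863177744, (Q 121 (Q 149 (Q 133 (L 25203075381237602) (Q 55 (L 25269046162859826) (Q 58 (L 25194279372022697) (Q 359 (L 15315373186439290) (L 25264666386786096))))) (Q 81 (L 25266993741006096) (Q 33 (L 25196624996828432) (Q 293 (L 25196624996828432) (L 10707672714409488))))) (Q 422 (L 25308010023921233) (Q 374 (L 25308010023905873) (Q 326 (Q 65 (L 25305810192198293) (L 10702789422904368)) (Q 86 (Q 340 (L 10699490614470528) (Q 120 (L 15203369687808064) (Q 327 (L 25297779797084033) (Q 53 (L 25306429526807843) (L 25308010024183073))))) (Q 89 (Q 99 (L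 15211125740231044) (Q 135 (L 25200876410541362) (L 25202602632578912))) (L 25299832488437603)))))))⟩,
  ⟨4384638719186937718773694336514651373791886770178, 1112953528579, (Q 88 (Q 168 (L 29242003139167552) (Q 391 (L 28825966194690658) (Q 308 (L 10731930909115205) (Q 87 (L 28817582418725218) (L 28817444981868898))))) (Q 138 (L 29248178659756642) (Q 376 (L 28825966194690658) (Q 410 (L 28819790540408128) (L 29239657447795042)))))⟩,
  ⟨4384594117696540657477893663518220081118978310146, 1249854554403, (Q 106 (Q 342 (L 1698265524497011) (Q 391 (L 10663271024194966) (Q 276 (L 7353686932607303) (Q 279 (L 14049054423216448) (Q 277 (Q 1 (L 6238024460555944) (Q 280 (L 7353686932607348) (Q 150 (L 16292788663051536) (Q 134 (L 11791712759539625) (Q 138 (L 29808379011770484) (L 28679181359949650)))))) (Q 116 (Q 425 (L 7318904897709891) (Q 275 (L 7355773700358938) (L 26573624409761600))) (Q 168 (L 11683618670356049) (Q 72 (L 10557718763513425) (Q 355 (L 8446454138356630) (L 26567508426770330)))))))))) (Q 138 (Q 357 (L 28676991228553280) (Q 38 (L 28643859618178593) (Q 39 (Q 391 (L 28641385717068393)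 (Q 72 (L 15059329032495671) (Q 152 (L 16290446593053816) (Q 353 (L 27553005920945266) (Q 71 (L 16290712881038451) (L 25448919522764611)))))) (Q 344 (Q 35 (L 29802882054727764) (L 28676981833312340)) (Q 36 (L 16184893942356135) (Q 137 (L 10669249618351651) (Q 50 (L 34308712621495840) (L 16227243902718512)))))))) (Q 376 (Q 343 (L 10597300323317922) (Q 38 (Q 132 (L 15094444112648308) (L 29769966471714337)) (Q 35 (L 11791232324425610) (Q 71 (L 8444529994008370) (L 25344164737026385))))) (Q 103 (L 10557718042146385) (Q 116 (L 25407520375474019) (Q 37 (L 27515485893911129) (Q 148 (L 25336052119520890) (Q 36 (L 26571903198447785) (Q 425 (L 7318629952956531) (Q 345 (L 19810053060597056) (L 25441605017831266)))))))))))⟩,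
  ⟨4384594117015228232932953562827236164680402665474, 2337302262288, (Q 133 (Q 340 (L 29812803078477939) (Q 87 (L 24209116720813161) (Q 374 (Q 167 (L 24217336581158466) (L 6194211775018562)) (Q 122 (L 11689530941285954) (L 24218401733048676))))) (Q 120 (Q 122 (L 11682325699659074) (Q 89 (L 11683032657728834) (Q 424 (L 11682325716370754) (Q 54 (L 24281685546391090) (Q 325 (L 24209116671661161) (L 29801588919539589)))))) (Q 89 (L 11683032657728834) (Q 340 (L 29775466428011842) (L 24209116687389801)))))⟩,
  ⟨2923092479684325314729268730110953132930026766338, 3376432611634, (Q 69 (Q 134 (Q 424 (L 11754441554756928) (Q 166 (L 11754505979266368) (Q 150 (L 11754441554756928) (Q 89 (L 11753989895334228) (L 24245400839481938))))) (Q 148 (L 11792472785594690) (Q 89 (L 11795032499788385) (Q 169 (L 11683621134444884) (Q 376 (L 11789174250775880) (L 11796209320811105)))))) (Q 166 (Q 424 (Q 72 (L 11682813594667619) (L 11797253788300610)) (Q 73 (L 29811652297782594) (L 11797253788300610))) (Q 73 (Q 118 (L 29809431009270369) (L 11795032499788385)) (Q 74 (L 24242183106807158) (Q 376 (L 24242672910837878)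 (Q 424 (L 24313041655015542) (Q 149 (L 29801653612157574) (Q 87 (L 11687818020149129) (L 29801653612403334)))))))))⟩,
  ⟨4384571816270029702309812027097434493687363076098, 2280662434323, (Q 422 (Q 101 (Q 70 (L 24461397861690005) (Q 117 (Q 84 (L 24421261780878423) (Q 169 (L 20796580350630532) (Q 132 (L 15211163873724514) (Q 308 (L 24455920240120880) (Q 378 (L 24460363060771460) (L 11576964763186538)))))) (Q 391 (L 20796890410088512) (Q 116 (L 20800909676280232) (Q 311 (L 15239822295783216) (L 15235118082459441)))))) (Q 69 (L 15211090573089139) (Q 407 (L 11587101019756913) (Q 391 (L 24736896529110336) (L 20797537876797352))))) (Q 391 (Q 87 (L 20801287382857792) (Q 70 (L 11259141731030120) (L 20802382850058577))) (Q 71 (Q 117 (L 24460363060771460) (Q 100 (L 20802382850058577) (Q 101 (L 11575801113240698) (L 24455419371623780)))) (Q 69 (L 15211163873724514) (L 20802215346334357)))))⟩,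
  ⟨2923070178939126784106127194381151280517568593922, 2204157161985, (Q 167 (Q 343 (Q 84 (L 6201872667072422) (Q 121 (L 11751663637984578) (Q 410 (L 11751663637861698) (Q 406 (L 2678960405772642) (L 15727526838506824))))) (Q 72 (Q 168 (L 11751962856302658) (L 33322525263099974)) (Q 138 (Q 360 (L 20724927146075988) (L 20724935733913428)) (Q 69 (L 15273737016937073) (Q 390 (L 33325725012687494) (Q 345 (L 6411845852219729) (Q 137 (L 24454762944563540) (Q 359 (L 24217848254133381) (L 15280608897103493))))))))) (Q 345 (Q 84 (L 6415109203384694) (Q 425 (L 15410867557930306) (Q 100 (L 29597307372657267) (Q 422 (L 20695557938321986) (L 6615216931904066))))) (Q 69 (L 11329451203269954) (Q 344 (L 24244237744231523) (Q 321 (L 2674251330376722) (Q 342 (L 29313062313432416) (Q 359 (L 24250833602966618) (L 29390083572979320))))))))⟩,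
  ⟨4384705674505834859512372627216360769306334658562, 2337033892368, (Q 132 (Q 117 (L 15132742016136330) (L 33181654881637731)) (Q 116 (Q 117 (L 15062373271958666) (Q 148 (L 16188552636961920) (L 1695009120405346))) (Q 86 (L 15165599085340022) (Q 90 (L 15060045969073511) (Q 52 (L 15066028289074226) (L 32020420414313520))))))⟩,
  ⟨14619008208060726785522073374196754938171453669378, 2268582654480, (Q 424 (Q 362 (L 28816306529216593) (Q 120 (L 31068089012090961) (Q 372 (L 28720914732644962) (Q 406 (L 28816589994829393) (L 34313052128176465))))) (Q 169 (Q 404 (L 28818633828899443) (Q 90 (L 7181417806669888) (L 29944516337818247))) (Q 89 (L 7181417806731328) (Q 406 (L 2818572848306240) (Q 328 (L 2816489283881570) (L 28748217840011619))))))⟩,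
  ⟨4384571815589464968423369258766787882468919803906, 2199863177744, (Q 86 (Q 135 (Q 328 (L 25299832406640038) (L 10702199781030498)) (Q 53 (L 12956258511444356) (Q 121 (L 25264665868731696) (L 24138787872744752)))) (Q 88 (Q 89 (L 10704407966603328) (Q 393 (L 10704472391112768) (Q 394 (L 10704407966603328) (Q 325 (Q 372 (L 24173932281611674) (Q 356 (L 23048032423986570) (Q 167 (L 23045978875126905) (L 25304887010035523)))) (Q 425 (L 24178888033196659) (L 24178956752673139)))))) (Q 87 (L 12951803022890816) (Q 340 (Q 338 (L 10704166876043928) (Q 151 (L 11823064196609122) (Q 374 (L 11826360513885577) (L 24174588770748259)))) (Q 374 (L 11829787392235177) (L 11829787392105112))))))⟩,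
  ⟨2923070178258562050219684426050504669299125321730, 211292324626, (Q 361 (Q 70 (Q 323 (L 5039199585060506) (Q 405 (L 10802938509956424) (Q 138 (L 20829428294199399) (Q 374 (L 10698265645917813) (Q 169 (L 7180317757057363) (L 11823286139394112)))))) (Q 69 (Q 421 (L 11893664010249536) (Q 405 (L 10802938509956424) (Q 151 (L 29879233624426138) (Q 374 (L 13055606325266042) (L 11832949277738647))))) (Q 374 (L 25301589299324993) (Q 342 (L 23049202001470785) (Q 389 (L 20864432278770776) (Q 346 (L 21993709069968705) (L 20867803003901561))))))) (Q 132 (Q 360 (L 32056650511706177) (Q 69 (L 11935203859121818) (Q 345 (L 4928492592982355) (L 11833158910178437)))) (Q 100 (L 11935203859121818) (Q 389 (L 29878343743141258) (Q 373 (L 11928816472126858) (Q 323 (L 23052498666800535) (Q 422 (L 11823642083563072) (L 2816442828822080))))))))⟩,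
  ⟨2923047877513363519596542890332232009945439076354, 2268582654480, (Q 133 (Q 372 (Q 67 (L 12959260693972376) (Q 422 (L 25297810620572993) (Q 169 (L 24171906133562689) (Q 167 (L 19811378739247766) (Q 340 (L 15060046039328066) (L 25299870002227043)))))) (Q 406 (L 11833085927052952) (Q 122 (L 10697166720444498) (L 12951289319676266)))) (Q 122 (Q 424 (Q 328 (L 16188561226238580) (L 16188561226500720)) (Q 359 (Q 356 (L 13936492708923232) (L 13936492708661092)) (Q 420 (Q 325 (L 16188561226222200) (Q 169 (L 10697163502098498) (L 25298154684572993))) (Q 388 (L 25304822585510003) (Q 372 (L 11823062046045322) (Q 65 (L 22067838857726119) (Q 422 (L 20934938243737665) (L 23045979986487105)))))))) (Q 327 (Q 89 (L 25297796019558983) (Q 90 (L 24171898008545089) (Q 422 (L 25297780551019073) (L 12951289319676266)))) (Q 422 (Q 151 (L 10702199781030498) (L 11823062046058312)) (Q 154 (L 19811378739247766) (Q 388 (L 10699506836801898) (Q 149 (L 16185946164078930) (L 24173932281677914))))))))⟩,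
  ⟨14619008207720444418601134910723004212020572651522, 215020081202, (Q 424 (Q 422 (L 28957044017571921) (Q 154 (L 28675569040861265) (Q 388 (L 7319835508181346) (L 29240846294092147)))) (Q 88 (Q 340 (L 28677913521195635) (L 27552013696928371)) (Q 86 (L 6200872763742272) (Q 83 (L 8452658884073860) (Q 306 (L 6763809023809924) (Q 154 (L 7040680318245440) (Q 338 (L 7326773488474176) (L 6763823538186304))))))))⟩,
  ⟨2923070177918279683298745962576753943148244303874, 12888117298, (Q 74 (Q 101 (L 11760389814969513) (Q 359 (L 12041864792601769) (Q 391 (L 10664306362906186) (Q 406 (L 11227256315352648) (Q 132 (L 6194074336053602) (L 12355225606853752)))))) (Q 100 (Q 86 (L 5919985626473641) (Q 168 (L 12037595096253799) (L 9500923835947090))) (Q 101 (Q 168 (L 12036495601403239) (L 25086772767775361)) (Q 99 (L 30364613889635921) (Q 88 (Q 138 (L 23962826102506852) (Q 152 (L 25088727803463011) (Q 58 (L 25053541553505639) (L 8445693071211145)))) (Q 168 (L 6197496919447712) (Q 24 (L 29248612166801572) (Q 410 (L 29808280478976579) (Q 149 (L 24242338157124008) (Q 71 (L 11752694440503378) (L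 29803887801174339)))))))))))⟩,
  ⟨4384683320690616675332116015384215080616135294978, 3375895806738, (Q 424 (Q 328 (L 7184347511229043) (Q 408 (Q 104 (L 5077683767970163) (Q 88 (L 10707260594542743) (Q 106 (L 12809315888498343) (Q 21 (L 29769803764106512) (Q 378 (L 12844500260588150) (L 12914869004633769)))))) (Q 423 (L 7223050284083265) (Q 118 (L 11788969135277735) (L 11722998437612146))))) (Q 104 (Q 310 (L 19816576186673306) (Q 86 (L 1690604949103936) (Q 423 (L 24315865009334097) (Q 38 (L 35434543735662929) (Q 326 (L 25301581511551313) (Q 149 (L 23155797869107296) (L 11682527784244544))))))) (Q 89 (L 28823913685682833) (L 28823913685420693))))⟩,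
  ⟨4384571816951331742258559178063813960620336807938, 2409513419313, (Q 72 (Q 70 (L 25299777480983633) (Q 407 (Q 423 (L 10696260951119748) (Q 117 (L 10697812238944083) (Q 311 (L 20796168121775242) (Q 322 (L 9607096754652976) (Q 169 (L 10732975673345840) (Q 152 (L 10731445322815400) (L 10731445323077540))))))) (Q 117 (L 10697812238944083) (Q 311 (L 21926466020799626) (Q 390 (L 20796438633608842) (L 20796438633412777)))))) (Q 73 (Q 169 (L 25299777341527178) (L 25299777341727878)) (Q 74 (L 25264592969639046) (Q 407 (Q 116 (L 10696260951118983) (L 10696260951119688)) (Q 359 (L 25299803969910353) (Q 116 (L 25304174582462633) (Q 371 (L 20800836679661737) (L 10737394657543985))))))))⟩,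
  ⟨13153716456386104866580063323178598062423358373890, 2281183391777, (Q 376 (Q 388 (L 15305357305215145) (Q 67 (L 24320821687247922) (Q 357 (L 3914283426989722) (Q 105 (L 21925387696556456) (Q 169 (L 15273816407189858) (L 11681375875213649)))))) (Q 118 (L 1689496827692881) (Q 377 (L 24218423761332546) (L 1699338997753666))))⟩,
  ⟨4384705674165542107995241214018005610142526144514, 2272609308723, (Q 422 (Q 423 (L 20796168352524952) (Q 360 (L 20796890657613907) (L 20769780073523090))) (Q 359 (L 20798591607154192) (L 20796890657613907)))⟩,
  ⟨14619008207720434034004941960998399762514970738690, 219582373937, (Q 391 (Q 407 (L 6192769771079507) (Q 389 (L 29803779604306074) (L 29803815323793984))) (Q 343 (L 29803815323793984) (Q 422 (L 6192733280040602) (Q 311 (L 29803815321827904) (Q 421 (L 29808315089442729) (Q 405 (L 29803779604502424) (L 29803815325882944)))))))⟩,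
  ⟨2923070177918269298702553012852149493642642391042, 3368094282256, (Q 372 (Q 135 (Q 408 (L 24242283933435713) (L 24242275611940673)) (Q 328 (Q 424 (L 6198016611087497) (Q 133 (L 24247599492658313) (Q 101 (L 6196274464380992) (Q 406 (L 29810101044528534) (L 6196257551915072))))) (Q 154 (Q 330 (L 6198016610956457) (Q 393 (L 24242283396569153) (Q 359 (L 23116348574500474) (Q 325 (L 11752724944557138) (Q 101 (L 24244301079086183) (L 24248699003237513)))))) (Q 330 (L 24251997539038373) (Q 325 (Q 404 (L 11752694950040658) (Q 89 (L 11752699174758738) (L 29807902021141914))) (Q 101 (L 24244302168556643) (Q 362 (L 29810453731366569) (L 6193865224844882)))))))) (Q 120 (L 11752694446847058) (Q 393 (L 12878595375989842) (L 11752694428968018))))⟩,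
  ⟨2923047877173070768079411477133876669362211979266, 3518385816353, (Q 84 (Q 345 (Q 406 (L 23189944166552903) (Q 374 (L 24315841523328327) (Q 389 (L 20795107209341272) (Q 70 (L 23187614279878313) (L 24315844190836032))))) (Q 360 (L 11681938226505809) (Q 346 (Q 169 (L 24315841492854087) (Q 422 (L 20797780289215072) (L 23189941616485703))) (Q 152 (Q 120 (L 11681667643574609) (L 11681667643636049)) (Q 151 (L 11681667643636049) (Q 71 (L 11683514989057859) (Q 72 (L 10696506856326993) (Q 168 (L 24313528865753682) (Q 167 (L 10696273015711593) (Q 135 (L 25301005153769543) (L 21921003643308626))))))))))) (Q 405 (L 10698319599277383) (Q 169 (L 11683481013033539) (Q 152 (L 10698319599208773) (Q 151 (L 10700518622132568) (L 15209067662451829))))))⟩,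
  ⟨14618985906634953136460861961816752320907066802178, 142541402145, (Q 138 (Q 389 (Q 422 (L 7181430405093538) (L 7181430404831398)) (Q 167 (Q 71 (L 28818627404008048) (L 28818627403745908)) (Q 152 (Q 390 (L 7181413224966298) (Q 121 (Q 116 (L 28818655857899908) (L 28817461070170483)) (Q 374 (L 29802643316696979) (Q 373 (L 6192765207816017) (Q 120 (L 5066834715441793) (L 11790497249134970)))))) (Q 425 (Q 132 (L 28818626866874788) (L 28818626867136928)) (Q 422 (L 6192733783423592) (Q 374 (L 29802647074809459) (Q 354 (L 12912816248493924) (Q 405 (L 29804904348550554) (Q 151 (L 7181344505497978) (Q 342 (L 7181284376480098) (L 7177897309723048))))))))))) (Q 121 (Q 116 (L 28818655857899908) (L 28817461070170483)) (Q 410 (Q 148 (L 28818642973006468) (L 28818642973268608)) (Q 405 (L 6192761449707857) (Q 390 (L 7177898116356193) (Q 373 (L 29803787657450874) (Q 69 (L 30928439913916243) (Q 359 (L 11790497249134970) (Q 422 (L 29804844219008679) (L 7181284376353378))))))))))⟩,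
  ⟨14618985906975230311084941890443275192928750862338, 3303417127681, (Q 423 (Q 166 (L 3940961349692019) (Q 103 (L 29310034459129496) (Q 405 (L 32056787645585762) (Q 346 (L 6685310463878535) (L 6157544882414985))))) (Q 377 (Q 150 (L 6403875717409139) (Q 103 (L 29591509435840152) (Q 71 (L 29837800040330906) (Q 345 (L 11543043245180826) (L 5035189881362786))))) (Q 71 (L 6406179967894649) (Q 346 (L 4998805137237909) (L 4998805137500049)))))⟩,
  ⟨2923047877173065575782552942297024924059190755330, 3444884640544, (Q 325 (Q 372 (Q 120 (L 24454447115957330) (L 24454446328480850)) (Q 342 (Q 150 (L 24453282359043395) (L 24453282090427715)) (Q 346 (Q 389 (Q 425 (L 23050304430843240) (Q 405 (L 11547629786801556) (L 23050304431887720))) (Q 405 (L 23050305703814505) (Q 356 (L 23045907657954660) (L 23045907657954630)))) (Q 345 (Q 344 (L 24454480515213650) (L 11547629786797476)) (Q 344 (L 11547698506270116) (Q 150 (Q 408 (L 12951665548355921) (L 12951669843322961)) (Q 167 (L 24739154172159336) (Q 373 (L 24463451627890055) (Q 420 (L 23608857339733352) (Q 410 (L 23047070502394485) (Q 408 (L 23047070034859125)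 (L 24735919895123061)))))))))))) (Q 328 (Q 420 (Q 329 (L 11548802026939521) (L 24453320623491395)) (Q 404 (L 11548870746412161) (Q 357 (L 11548870746133656) (L 11551478078080326)))) (Q 329 (Q 330 (L 11548870746408081) (L 23047072112804985)) (Q 330 (Q 120 (L 24453316328257610) (L 23047071844369530)) (Q 408 (Q 121 (L 24453320623491395) (Q 327 (L 24453320623491395) (Q 134 (L 11542754784539736) (L 11543782638655041)))) (Q 166 (Q 372 (L 12951158294816321) (Q 342 (L 11543781565957446) (Q 410 (L 11261302571420000) (L 12951156414850631)))) (Q 424 (L 12951157686766151) (Q 52 (L 24177751492676194) (Q 372 (L 24740701447141986) (L 24740700644981346))))))))))⟩,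
  ⟨4384571816610317454004866813874207145545773940738, 2268584751632, (Q 86 (Q 374 (Q 361 (L 11825391600100672) (Q 340 (L 21929145306077846) (Q 394 (L 21920152196573066) (L 9571831124280914)))) (Q 326 (L 24180941632203409) (Q 394 (L 21924841782401681) (Q 408 (L 21924979221354881) (L 21924785947826321))))) (Q 325 (Q 135 (Q 90 (L 14084366380778850) (L 9580616429554274)) (Q 87 (L 24171878753457289) (Q 424 (L 14085126606767970) (L 9579332267886434)))) (Q 406 (Q 169 (L 14082133503076740) (L 14082064783600260)) (Q 87 (Q 165 (Q 422 (L 24136694380406132) (Q 135 (L 11832399868680802) (Q 327 (L 21922685743626851) (Q 408 (L 11823063123981442) (Q 424 (L 14077468701330000) (Q 360 (L 9573628555789904) (Q 404 (L 11825389366842967) (Q 420 (L 14114852092529267) (Q 169 (L 21920220932843396) (L 11825750714984512)))))))))) (Q 154 (L 21893960933989014) (Q 422 (L 21929145306077801) (Q 393 (L 11825390524278352) (L 11825391593825872))))) (Q 133 (Q 424 (L 11825416848377152) (L 21927083721775751)) (Q 424 (L 14075124121237650) (Q 83 (L 24139187667371312) (Q 259 (L 11858508377446569) (Q 404 (L 21892970488808754)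 (Q 154 (L 21891762002101554) (Q 149 (L 26425765611854247) (L 14075124121237650))))))))))))⟩,
  ⟨11692191507579070201153235113047593252551012712450, 73554530339, (Q 406 (Q 101 (L 25440505856300611) (Q 423 (Q 100 (L 9573586341308039) (Q 137 (L 26424874221333072) (L 26424878499523152))) (Q 360 (L 26425702900398147) (Q 100 (L 25449645960349321) (Q 294 (L 9611353649268256) (Q 71 (L 25439633670838096) (Q 87 (L 25442915427309466) (L 26428077928184472)))))))) (Q 100 (L 10672377691260496) (Q 87 (Q 407 (L 10670118552033091) (Q 154 (L 26425707178588227) (L 26425702900398147))) (Q 376 (Q 154 (L 26426050770729027) (L 26426046492538947)) (Q 422 (L 26424878499523152) (Q 71 (L 10660947460515736) (Q 165 (L 10667600614029976) (L 26424788201597082))))))))⟩,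
  ⟨4384683320690611482876665755835108305176055840770, 2212210348547, (Q 69 (Q 148 (Q 132 (L 11822101101515857) (Q 292 (L 19633992667604101) (Q 360 (Q 389 (L 24174092337907264) (L 11867099129669799)) (Q 151 (Q 410 (L 7329574158354786) (L 7322152991738466)) (Q 131 (L 24141986583390257) (Q 389 (L 24172772908968019) (L 24137605783786802))))))) (Q 360 (Q 168 (Q 343 (L 24174075158300224) (L 24174092337907264)) (Q 405 (L 7326257773955496) (L 11829715734325672))) (Q 137 (Q 405 (L 7326257774086566) (Q 83 (L 16333662650385818) (Q 344 (L 24172772912104819) (Q 346 (L 19634014679311666) (Q 121 (L 11825317688281462) (L 11825317688280982)))))) (Q 135 (Q 389 (L 24172772904773749) (L 24172772904772984)) (Q 131 (L 24141986583390257) (Q 389 (L 24172772908968019) (L 24172772908967299))))))) (Q 137 (L 7329849489246306) (Q 292 (L 19669189991634003) (Q 135 (L 16336154853918818) (Q 410 (L 16333629681584738) (Q 121 (L 7326288994912866) (L 7322165826308706)))))))⟩,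
  ⟨2923181683359708564672980923118825092006261358594, 82444292643, (Q 361 (Q 294 (Q 359 (L 7435466443007637) (Q 149 (L 25442703954843256) (Q 101 (L 25442703959021176) (Q 360 (L 25439646859626016) (Q 422 (L 8416766429795978) (L 18617482551187113)))))) (Q 374 (Q 291 (L 566637589722657) (L 16431183995508344)) (Q 149 (Q 278 (L 18616939796141688) (Q 154 (L 10558922201065810) (Q 168 (L 8381583081183876) (L 6055528681793874)))) (Q 154 (L 10629290945243474) (Q 152 (L 28606145761020256) (L 1622305851664722)))))) (Q 295 (Q 120 (L 25378534404073317) (Q 122 (L 34385596756731749) (L 18617521977632613))) (Q 294 (Q 101 (L 18613878674392608) (L 574496739382932)) (Q 291 (L 1559659143308948) (Q 149 (L 29840035167630881) (Q 101 (L 27588509158110753) (L 17416346403247480)))))))⟩,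
  ⟨14619008209422588366901813033944674224390116802562, 1108688831265, (Q 105 (Q 104 (L 7318638534551976) (Q 425 (L 7318638534748551) (Q 73 (Q 132 (L 7320993115687251) (L 7320997897193811)) (L 7320966912100521)))) (Q 357 (L 7318665698633841) (L 7318665715406961)))⟩,
  ⟨13153716456386099674124613063629491253997930086402, 81889730864, (Q 356 (Q 325 (L 2825848802071670) (Q 357 (L 2824800011191670) (Q 373 (L 2856685848397177) (Q 346 (L 24171756019665559) (L 15172182747793577))))) (Q 344 (Q 325 (L 2825087773459880) (Q 328 (L 2824736405415080) (Q 372 (L 24175118390941594) (Q 420 (L 2825848801944725) (L 20834749753287834))))) (Q 330 (Q 388 (L 20864436572480681) (Q 405 (L 15166687688214902) (L 15165787766150777))) (Q 404 (L 15166685193914537) (Q 343 (L 24171756411635554) (L 15165789202045352))))))⟩,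
  ⟨2923204036834633997336106121752615588547303374850, 77846491394, (Q 74 (Q 421 (Q 422 (L 33179380794612291) (L 33179381113378371)) (Q 72 (Q 342 (L 2824808899757480) (L 2824804604790440)) (L 33185550951806121))) (Q 73 (Q 391 (L 33185550957184146) (L 33185550958228626)) (Q 69 (Q 406 (L 15171152442324122) (Q 100 (L 15139266605118570) (Q 405 (L 15170057225663642) (Q 83 (L 29836847534478641) (Q 408 (L 15140305736456340) (Q 169 (L 33187689595820451) (Q 407 (L 29847430744930661) (Q 52 (L 29837462753940566) (Q 260 (L 15165044748081482) (Q 424 (L 29877111241213033) (L 11824229791671382))))))))))) (Q 424 (Q 391 (L 2822624137923200) (Q 423 (L 20838122159032944) (Q 359 (L 20840797604890224) (Q 357 (L 20865655542286181) (Q 422 (L 33179451847427751) (L 15132134561105520)))))) (Q 391 (L 11824601786173552) (L 20829326066010744))))))⟩,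
  ⟨2923047877173065575623961217584769860936783691778, 1112681951745, (Q 405 (Q 84 (Q 373 (L 24183165567518104) (L 11825838771168577)) (Q 148 (Q 373 (Q 132 (L 11822031308297302) (Q 410 (L 24180676446214729) (L 11822031870335062))) (Q 152 (L 24173867887662439) (L 24173867824747879))) (Q 373 (Q 137 (L 24174457333569859) (L 24174590477555779)) (Q 152 (L 24173867887662439) (Q 151 (L 24174457081911619) (Q 168 (L 24173867904435559) (Q 421 (L 24173867904312679) (Q 103 (L 24178265950422394) (L 24179365462050154))))))))) (Q 84 (Q 421 (L 11825842797700417) (Q 168 (L 24173867926127719) (Q 121 (L 24172979938498624) (L 24172980727019584)))) (Q 389 (Q 151 (L 11829027449357722) (Q 167 (L 11829164888311162) (Q 150 (L 11830058241508762) (Q 346 (L 11829164888311207) (Q 132 (L 11829164894733682) (L 11829164890555762)))))) (Q 150 (Q 118 (L 24183148387784344) (Q 425 (L 24174506913585064) (L 24174575633061784))) (Q 121 (L 11825559598295377) (L 11825559380191057))))))⟩,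
  ⟨14619008209081579271024342766781839585745841487874, 2204158145040, (Q 138 (Q 328 (L 6193893479000162) (Q 135 (L 8445712425777250) (Q 89 (L 21676120193005992) (L 30366729906067571)))) (Q 420 (Q 425 (L 27551998711712371) (Q 362 (L 32057912808598097) (Q 121 (L 3703846722500965) (L 3383751406221922)))) (Q 88 (L 32341731156641943) (Q 425 (L 29803778881833114) (L 30085255247645335)))))⟩,
  ⟨2923070179279414535721953818635589316873513140226, 3368093298721, (Q 100 (Q 73 (Q 373 (L 24243142442783843) (L 26494942256469091)) (Q 406 (Q 74 (L 24243141368849513) (L 12036423121802869)) (Q 393 (L 3667571727550853) (Q 154 (L 32055735276890432) (Q 362 (L 21714749427436184) (L 12353082471319162)))))) (Q 405 (Q 389 (L 12033207315371329) (L 3944473957517394)) (Q 389 (Q 424 (L 11751732340688193) (L 23963265808812112)) (Q 394 (L 6196257413417042) (L 32341657859086503)))))⟩,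
  ⟨13153716456386120453374023842243505798731569102850, 1306226860336, (Q 165 (Q 309 (Q 89 (L 12392084523857319) (Q 424 (L 1127151480382784) (Q 340 (L 23054187895997745) (L 23335662870676786)))) (Q 325 (Q 89 (L 21998386702009650) (Q 88 (L 19746856917615922) (Q 86 (L 32063984197121417) (Q 82 (L 32337745418032518) (Q 169 (Q 105 (L 21958510065572263) (L 21673660031265432)) (Q 106 (L 3946235164781184) (L 3664759079594408))))))) (Q 154 (Q 150 (L 21673664326166952) (L 21955140411091588)) (Q 166 (L 12950350898223731) (Q 149 (L 21958511135119783) (L 12949453790144576)))))) (Q 424 (Q 328 (L 25297650330347618) (Q 407 (L 23049506952071505) (Q 89 (L 14044299991730833) (L 25304315305621898)))) (Q 149 (Q 104 (L 21677035019131047) (Q 81 (L 16860220558505378) (Q 355 (L 3385546694624857) (Q 325 (L 14331069255021974) (L 21392189349849476))))) (Q 154 (Q 104 (L 21395560042289321) (Q 355 (L 3977083958756981) (Q 330 (L 12667703129041480) (L 12667703129303680)))) (Q 104 (L 21395560042289306) (Q 388 (L 12667703146080640) (L 10698274247235738)))))))⟩,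
  ⟨4384616418100714515330380047129954401132492161026, 1237774774560, (Q 106 (Q 356 (Q 67 (L 26147623786555031) (Q 357 (L 23901807160199283) (Q 135 (L 14357698647201361) (Q 38 (L 12107836400637473) (Q 321 (Q 274 (L 9858578290866345) (L 12105912255288848)) (Q 353 (L 12143020772726290) (Q 373 (Q 151 (L 21613795922613608) (L 23890399732410468)) (Q 83 (L 23856277643216176) (L 26153602374846581))))))))) (Q 372 (Q 167 (L 12105638717199953) (Q 410 (L 9862113132820305) (L 9853838903514705))) (Q 135 (L 14357440949163601) (Q 342 (L 21650015665916020) (Q 55 (L 12105641135478353) (Q 66 (Q 167 (L 26116102731111009) (L 26153537666045846)) (Q 410 (Q 167 (L 12106190009375318) (Q 276 (L 9862233375393555) (Q 105 (L 14357973473850961) (Q 394 (L 14398728157177923) (L 23859613406816896))))) (Q 122 (L 14357973471762001) (L 12145772427979090))))))))) (Q 356 (Q 357 (L 21639840609511795) (Q 104 (Q 67 (L 26147623785498281) (Q 373 (L 14366838327944836) (Q 410 (L 14358110911494481) (L 12148581360630355)))) (Q 410 (Q 67 (L 26147623784450711) (Q 408 (L 14358110909528401) (Q 103 (L 12114496499103893)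 (Q 344 (L 21638883119240770) (L 26152476876412226))))) (Q 67 (L 26147623784450471) (Q 103 (Q 394 (L 12114496499103893) (L 12112297475848853)) (Q 421 (L 14359177230362176) (Q 167 (L 12111683583092288) (L 9862217252484945)))))))) (Q 121 (Q 373 (L 23860640154560881) (L 23862839177816401)) (Q 345 (Q 343 (L 23891426480138613) (L 23891426480138583)) (Q 342 (L 23891426480137623) (Q 53 (L 26153602374780551) (Q 98 (L 14364725204309536) (Q 336 (L 14364725204309506) (Q 352 (L 14399909576398338) (Q 372 (Q 120 (L 23890400605865058) (L 21649959547246930)) (Q 320 (L 9890199545410562) (Q 304 (L 21644036993886580) (L 9855277166326785)))))))))))))⟩,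
  ⟨2923047877173075960296908297943501431163524808706, 2203889898032, (Q 74 (Q 71 (Q 84 (Q 86 (L 12112843449394343) (L 12107099014763618)) (Q 165 (Q 168 (L 23890777367411283) (L 23890850381854803)) (Q 133 (Q 100 (L 23896992187197783) (L 23898091696728408)) (Q 100 (Q 374 (L 12107099014763618) (Q 168 (L 12114037955769728) (L 12105242986821008))) (Q 52 (Q 304 (L 12103795389109298) (Q 87 (Q 137 (L 12104676425622848) (L 12104673992926538)) (Q 152 (L 23898091696724058) (L 12107972396811623)))) (Q 87 (Q 168 (L 12104673996072263) (L 12114928356046208)) (Q 152 (L 23898091696724058) (L 23898091696728408)))))))) (Q 101 (Q 117 (L 23890771305571923) (Q 137 (L 23897380339648833) (L 12106727456941193))) (Q 137 (L 23898479582841153) (L 12112225015051418)))) (Q 101 (Q 117 (Q 73 (L 23900162376431178) (Q 72 (L 12107244993254498) (Q 69 (Q 376 (L 12112946528588918) (L 12106728583361618)) (Q 422 (Q 423 (L 12114569465202023) (Q 360 (L 12105041492456768) (Q 425 (L 12107100514986338) (L 12107100517071458)))) (Q 374 (L 12105179149514048) (Q 391 (L 23890266855810633) (L 12105179132802368)))))))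 (Q 168 (Q 410 (L 23892630607002198) (Q 359 (L 23899511144588883) (Q 148 (L 23892634633534038) (L 12112224979428503)))) (L 23890289080248393))) (Q 73 (Q 425 (L 12107179813835858) (Q 152 (L 23895305602009233) (Q 168 (L 23890289080240713) (L 23900184684857418)))) (Q 168 (L 23890289080244808) (L 23890289080248393)))))⟩]
/-- hints for `n = 11`. -/
def hints11 : List ℕ := [
  11649936536080, 46834308624912, 98451225588240, 80987888562704, 187571796980240,
  133623518081552, 238145842197008, 116043411632656, 433797977092624, 221596527899152,
  484307597799952, 855044074517008, 466920764879376, 168806883537424, 273329207652880,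
  519490963255824, 907614272893456, 1046225752437264, 151215704125968, 256768820392464,
  660232729801232, 642834572259856, 1222151891071504, 890087517991440, 502028632863248,
  1207846109983248, 1030825006346768, 695400744104464, 1257319905374736, 2473396341584400,
  1785153937748496, 2578949457850896, 677825670820368, 1911473153782288, 1769640448766480,
  1240775624241680, 140815681021833, 308513501098512, 554675256701456, 942798566339088,
  1081410045882896, 730585037550096, 1292504198820368, 2526155708314128, 1820338231194128,
  2630678032429584, 1960878419489296, 2736029822104080, 3229710274540048, 158407961438089,
  291952185848336, 925270883447312, 537211998319120, 1066008371802640, 800954049114640,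
  1433241954562576, 783378032112144, 2263316371354128, 1416696729711120, 2066431803142672,
  2876767577846288, 2295408366989840, 3296854034100752, 2508567627444752, 2614120743711248,
  713005009744400, 1804815761158672, 1275954963165712, 2312726701683216, 2859449258881552,
  2049113484177936, 3741188848103952, 3212255069221392, 2718643067826704, 1943491665211920,
  3283723308249616, 836137147183632, 1468425052631568, 2101614901211664, 2911950675915280,
  3332037132169744, 5745530866250256, 5780715238339088, 2347909784023568, 4742641797575184,
  3789438247514640, 5867515190456848, 5850053190365712, 4809853740790288, 6132558959227408,
  818546298073616, 1451864995672592, 2418282822119952, 2400949403660816, 3930180029788688,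
  4725179797484048, 2330512208441872, 4902200901120528, 4795548541661712, 2894424251314704,
  2084152901120528, 3916969779933712, 3775133048386064, 3316636716380688, 105631304017801,
  343697867289104, 589859622892048, 977982932529680, 1116594412073488, 765769403740688,
  1327688565010960, 2561340074504720, 1855522597384720, 2665862398620176, 1996062785679888,
  2771214188294672, 3264894640730640, 703765729072760, 1503609418822160, 2136799267402256,
  2947135042105872, 3367221498360336, 2515762653058953, 5832459661488656, 2383094150214160,
  4777826163765776, 3824622613705232, 5902699556647440, 6105182500111992, 4845038106980880,
  6183143741207056, 2453446536606224, 3965343744274960, 5973051439723024, 4950574613803536,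
  6253495624282640, 6069414280906360, 5196933921124880, 6570223675781648, 7345379356586512,
  123223494977417, 327136479293968, 960455176892944, 572396291764752, 1101192665248272,
  2543751920890384, 2649305037156880, 748189303190032, 1840000054604304, 1311139256611344,
  3247439362667024, 2753827361272336, 1978675958657552, 633396984895096, 1609162551800336,
  2207168028291600, 3052688175084048, 3472774631338512, 650990937462392, 1592602421113360,
  2251912174388583, 2270085947540839, 4317208134562320, 3035161676755472, 2189705954472464,
  4303997825724944, 3457374141821456, 2357433078400359, 4070896877253136, 4767594728212361,
  5020943374692880, 6359048757260816, 2304686472512871, 5408108889780752, 5389837427423386,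
  4335832123322896, 5267036679254544, 6640322407379472, 7380293464437264, 5636824692437520,
  2498168707372937, 5815898525151760, 6087008733841016, 5885236477178384, 6167742246040080,
  721359681640056, 1487049037459984, 4760363335954960, 2365695998571024, 4830732080132624,
  2929608293102096, 2119336942907920, 3810316838515216, 3351820758168080, 2287064334222695,
  4352372122333712, 4749985431373705, 5401219189455002, 6342508759233040, 2375055216690535,
  5394656989032976, 5005434168816144, 4054356879225360, 5442958808068624, 6921797652460048,
  6904561063440912, 5425718192517648, 7552990341247504, 6051792149497464, 7328826524971536,
  5955476372337168, 6554705914507792, 6236951349047824, 2435871469220368, 5182446952002064,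
  4935061130719760, 3948799469040144, 5654069335503376, 7363048823337488, 6623081792811536,
  5249792038154768, 7541100986511888, 668581262612088, 1644346828534288, 2242352305025552,
  3087872451818000, 3507958908072464, 2427801728206183, 4106081153987088, 6078604477346320,
  5056127651426832, 6394233033994768, 5302220955988496, 6675506684113424, 7415477741171216,
  2462984266471305, 6017219741435512, 5981455548761720, 5999627622237816, 9369520184766992,
  2392617356117351, 4387556398084624, 4714800973760393, 5619146590663184, 8784411805296794,
  5478143083819536, 6956981928210960, 8085080588825104, 7588174616998416, 5946238964418168,
  9420094129713680, 5963863429564024, 9545377620701712, 9403544915685904, 5689253610271248,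
  8858041825505808, 8964694184964624, 8115944492249616, 9595887141138960, 9685148741415440,
  9578500408488464, 8995622512898576, 686173532214904, 1627785534910992, 3070344790553104,
  2224889068270096, 3492557255619088, 2322248344552807, 4493109782721040, 2339868799878503,
  5594940124378198, 4476568605045264, 5548512096367120, 7062535312847376, 5682864899372118,
  7693728001634832, 4732377137235849, 8767866617800858, 2410241837974887, 5604658960937488,
  4371011210588688, 5724438250730000, 8911160990773776, 5707188403450384, 8221497876886032,
  8947307452314128, 8840723543896592, 5671935328662032, 9053960063431184, 8982491824402960,
  6061016418103824, 6377675766903312, 2445426210063719, 5040605203018256, 4089531939959312,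
  5664793472480342, 7045285465567760, 5531262249087504, 8420705774613008, 8067693856174608,
  6939663646601744, 5460824802210320, 8209530839380496, 8102878228263440, 7398022557479440,
  6658119951462928, 5284834223338000, 7681696539619856, 7575043928502800, 70446931683209,
  378882238947856, 625043994550800, 1013167304188432, 1151778783732240, 563030002079352,
  1362872936669712, 967682493347465, 1890706969043472, 2701046770278928, 2031247157338640,
  2806398559953424, 3184847404426616, 527843868382840, 1538793790480912, 2171983639061008,
  2982319413764624, 3402405870019088, 932465909003913, 3160003166102904, 2181543429965159,
  3044142128326008, 3859806985363984, 5937883928306192, 3114510872503672, 4880222478639632,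
  6218328112865808, 2216695589799271, 4000528115933712, 6008235811381776, 4985758985462288,
  6288679995941392, 3078742653298040, 5232118292783632, 6605408047440400, 7311789119460455,
  492659401922168, 1679531200193040, 2146358963504487, 3123056823476752, 3543143279731216,
  2111142379160935, 4141265525645840, 6113788849005072, 5091312023085584, 6429417405653520,
  5337405327647248, 6710691055772176, 7450662112829968, 897279775307401, 3019263916139896,
  5911086804276856, 2973771622540664, 7276156040729703, 2040773634983271, 4422740769743376,
  2867638685689208, 5383902877414486, 7030316407673959, 5513327455478288, 6992166299869712,
  6914390945387623, 7623358988657168, 5875870219933304, 9455278501372432, 2938007429866872,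
  7171053896029287, 7241422640206951, 5418507428918358, 8893226197164560, 6984759689565287,
  8151128863908368, 9631071512797712, 9737719845724688, 7195865922098279, 9030806884557328,
  2075956245464423, 4528292611990032, 5583694925636112, 7097718142116368, 7728910830903824,
  5840684479452792, 9490461552255504, 5524058783577174, 8831626404664952, 8256680690426384,
  9666254563680784, 9772902896607760, 9101174323257872, 9805961259885072, 2902790593865080,
  7135837060027495, 5453685761209430, 6949538575373415, 8467791216878096, 8954515613251209,
  7055160394339431, 9171547361354256, 9946703042159120, 10478966302458710, 7090344766428263,
  9312353568137744, 10193062365209104, 10513119882396502, 88039117973385, 362320845484560,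
  995639543083536, 607580657955344, 1136377031438864, 950058095171209, 2684489403347472,
  580654400624248, 1875184420794896, 1346323622801936, 3166707610174840, 2789011727462928,
  2013860324848144, 914871961474697, 3132101297063288, 3096337104389496, 5920420843368976,
  6202926612230672, 545437816280696, 1522233403650576, 3025968360211832, 2199717198447975,
  4865916446323216, 2964792659292688, 2154521309098512, 3845501204705808, 3387005124358672,
  3061120520045944, 7283859064697959, 5990660738527760, 6589890280698384, 6272135715238416,
  2234317723420007, 5217631318192656, 4970245496910352, 3983983835230736, 422290657744504,
  1714715573326352, 1864883986793831, 1883055991317897, 3613512024953360, 1829667402450279,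
  4211634270867984, 1847291798644105, 5126496396218896, 4195084946051738, 5137032452207702,
  6781059800994320, 5155172244477048, 439882938406520, 1698154274173456, 1864884047725961,
  1883056088040807, 3598110366970384, 650990398498202, 1592599728366490, 633422434682266,
  782882715284634, 1609136900031386, 3035158984008602, 2189703261725594, 1407955075675290,
  3457371449074586, 1829667463382409, 4211634197312154, 1847291895367015, 5110973942280720,
  4195085051310608, 1425068041393306, 2206747776402330, 3052271949726618, 4441342551008137,
  5137032513139832, 6763673062814224, 5155172341199958, 3466105202033562, 1794481268753767,
  4598661357212176, 5066661946422358, 7168086887338512, 7799279576125968, 1812075214300553,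
  4582100959433370, 4996293202244694, 5014466968376440, 8327049435648528, 7150560121918106,
  5084835712554104, 8312743644041882, 7783878819517082, 1196348228912538, 3870974401655945,
  4749998319432790, 2850490172126362, 6342465801167770, 2375046624662665, 2041181163041946,
  5005391210750874, 4054313921160090, 3835210208982153, 4873729325085782, 7009431272563593,
  4416083785302921, 7924616933159440, 5031445362078806, 8538139310395920, 9535051449730407,
  9206710831125008, 9981866260271632, 5049067493348472, 9254115455689541, 9191197331624602,
  8521595018744474, 3272251665626266, 7362361620177818, 6622394589651866, 5249104834995098,
  7635727698633609, 879687495014025, 2991363714336120, 2955599521662328, 5929258779756152,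
  7248706810492007, 2920382937318776, 7213490226148455, 5893494587082360, 7143121481970791,
  9438729203233296, 7177726033474663, 9720333028962832, 9613684696035856, 510251682584184,
  1662969885372944, 3105529141015056, 2164531064751463, 3527741606081040, 2850014193141112,
  7002383993615463, 2058398127900007, 5411835291841622, 4406195545322000, 6966619800941671,
  8875907847172624, 5436647317910614, 9017676127678992, 6096200768565776, 6412860117365264,
  2128766872077671, 5075789553480208, 4124716290421264, 6896251056764007, 6974847981335056,
  5496009136943632, 8138062547268112, 7433206907941392, 6693304301924880, 5320018573799952,
  7610228263236112, 1213939077899674, 3898873172153481, 4855555713889366, 3853380878554249,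
  7940017081254416, 1794482226218377, 4598660214108826, 2058385197585562, 2357839916250249,
  4406156779070345, 5066662903886968, 7168085744235162, 4064237718750106, 7799278433022618,
  1812075059365223, 4582101568008720, 2867630049547418, 4768107506119766, 7030307771532169,
  4996294159709304, 5014466813441110, 5014220059067290, 8327048308273818, 7150560730493456,
  5084835557618774, 6351294916871066, 8312744504275472, 7783879428092432, 4820339129545814,
  8643692443435536, 3817616685880457, 8332138128753528, 8402506872931192, 3800012624835721,
  6974229394498441, 5495390550107017, 8374594890376056, 4837956827690070, 8867018660012869,
  6984622204404617, 8304226146198392, 8627157316678160, 9112866597790533, 10263139927163408,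
  8356950154822520, 7600332547040137, 9025309422003013, 2885196803622264, 7107935348274279,
  7072171155600487, 10460792691630934, 10485669142209366, 5858278002738808, 9473901495726608,
  7036986783511655, 8937179521169033, 10178756631736848, 9755376472437264, 9648792564019728,
  9932397576073744, 9790560844526096, 2093550036075879, 4511732555461136, 6931429389055079,
  5471794947896406, 9299143051325968, 8848962497361528, 5542232394773590, 9158337111929360,
  9086869124559376, 7080191717945872, 5566232925975056, 8454580967453200, 8242375491727888,
  7713510415544848, 3289817836377242, 7663601790894985, 5031460412404856, 5260481707262874,
  8538121306190490, 9552667118941543, 6632740921426842, 9206693078577818, 9965331385233936,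
  5049063060223062, 7371681453720474, 9281010031534917, 9191206496580112, 8521603932041744,
  9007313481524037, 7618109497295753, 8339130422666104, 10245977164755472, 9130862538269509,
  10566961277121040, 457475024918136, 1749899938472464, 2005621470233959, 3193425561756176,
  3648696390099472, 1970404885890407, 4246818636014096, 3254666679186825, 5161680761365008,
  6499786143932944, 5372589693837840, 6816244166140432, 7521030851109392, 1935218752193895,
  4633845722358288, 5312952546128982, 7203271252484624, 7834463941272080, 3219450094843273,
  7487680933094520, 5242583801951318, 7371819895317624, 8362233800794640, 9605446360466791,
  7442188639495288, 9136358689448464, 9876329998164496, 5277735961785430, 8573323675542032,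
  9570235815920999, 9241895196271120, 10017050625417744, 7406420420289656, 9347517015237136,
  10228225560650256, 10545984404300304, 844503119668873, 2815441850635640, 2779677657961848,
  2797849667724664, 6861678714258535, 2744461073618296, 6826462129914983, 2762085475050872,
  6756093385737319, 6854394452857959, 6790697937241191, 10425610077893462, 6808837734749287,
  1900034380105063, 4669030111158800, 5207399429862486, 5225571385963657, 7975201446339088,
  1759297849828745, 4704213323186842, 2410228913374362, 2322655538816137, 4370972400591753,
  4961109783319672, 6597763714471015, 4486450177672090, 8010384658367130, 5172182845518934,
  8678876808520208, 5189807193289865, 9277079585071632, 8662327342768777, 3764828247401609,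
  6939045016019849, 5460206171628425, 8269041768764280, 9323972825408325, 10298324292248080,
  9342112569254776, 7565148168561545, 2709274939921784, 6720907252040807, 6685143059367015,
  9729170985936248, 10380116022686550, 2726868890707320, 6748809124336743, 6614774315189351,
  6632948086559847, 10266829435061078, 9710999479489912, 6703316830737511, 10239378534331222,
  10407566923416406, 3923136528876698, 8508026715927433, 4925907291837560, 5541956677829530,
  8714043159446170, 6561995495265383, 7054953380348826, 9183830208578407, 10122586240549530,
  9288788453319493, 8462534422328201, 8233577301054328, 10186466838856534, 10612857900605968,
  6649926475023463, 10344899438342998, 9675788934944120, 10309715066254166, 10916472836862480,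
  6667548611531879, 10274462243124054, 10337645124272982, 10372829496361814, 7687877226169242,
  9218656219333479, 10333228918604442, 10221651210945366, 10759839413400201, 475067215140472,
  1733338551890448, 3175897807532560, 2023793481041255, 3633294644687376, 3237042284021129,
  6483228783882768, 1988029288367463, 5146158219997712, 4230269329027600, 7503575574458896,
  6798857340531216, 5355202868228624, 1759296875038055, 4704214500020752, 4961108808528982,
  6597761914201225, 8010385835201040, 1776890575209831, 4687654622343696, 4714813909005398,
  4732923005252694, 8784454889210384, 6579591168996489, 4979282329285718, 8772340049981968,
  7994985598693904, 4925892224185430, 8714061197382160, 6561997721527433, 9183815140926277,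
  10122603775169040, 4802772326822998, 8857698177786693, 8964350537245509, 8803079130919440,
  9218419692430149, 10333508681110032, 10221721888248696, 8990124904424261, 1776889033418121,
  4687652943237786, 6579589943100519, 4979280787494008, 7994983919587994, 1917628331935079,
  4652469982867984, 2339860176393353, 2393024286241946, 4476525521150874, 5207400390145161,
  5225573202277462, 4380897069646729, 7959800959218192, 4890707852096598, 8749245837840912,
  4890722919748728, 5706487263564664, 8732700386202266, 4908325711459414, 8902202993763141,
  5717916092875640, 8732710119354896, 9148050948252485, 9166221880877961, 8198392928965496,
  9060493916971845, 10683226661556752, 6544373358756967, 10106046244917914, 4943516594820216,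
  9211747433071463, 8697511720194714, 3905565739005082, 7044598136578970, 5530574920098714,
  8480148004545417, 8215642824274842, 9148287475155815, 9166190714962791, 8198535588881306,
  10823968444813840, 10203582129402710, 10316121685299866, 9236559459140455, 7670701289120666,
  10670095708918426, 3201856150324617, 7459779067065464, 7424014874391672, 9623617869002087,
  9860928504410640, 1952812704023911, 4617285342409232, 7353646130214008, 5260757574366294,
  9122052664013328, 7185744504893968, 5331126318543958, 8347928027017744, 7819063202492944,
  4785154467460182, 8819614850449936, 6544392704046217, 8937455548523333, 10106068056683024,
  4943510083548246, 8831833981215557, 9211740921799493, 8697525478896144, 9077681935704901,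
  9940278335263625, 9922500176913289, 9095678289060677, 10718411302076944, 3782399047718025,
  8296920490591096, 5172197898663049, 5471587941893001, 8678858796642953, 5189804983071830,
  6949400272323465, 9261570381591056, 8662336812888592, 9042497563616069, 8216243824903032,
  9148439697040265, 9166051328140101, 10883616049869328, 10168397757313878, 8251428196991864,
  8444683536835465, 9306857535906629, 10813178587263504, 10738191509426825, 7388798290048120,
  10529431574098448, 9587853676328295, 10212707800789520, 10000506351596048, 5295358099338326,
  9333030047527440, 9226381714600464, 8556779401720336, 8972124524536645, 10203887358452600,
  10316336770593296, 9236420072317765, 10707689894523408, 7582324118143881, 9324209337803640,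
  10281083680076304, 9342041907995461, 10672436804006416, 10600968549249552, 35262559582857,
  414066611005968, 351955981789560, 370127988418681, 1186963155790352, 316739397446008,
  1398057308727824, 334363795744889, 1689543802902631, 1381507994427418, 1724148354406503,
  2841582932011536, 1742288148780904, 281553263749496, 1573978162539024, 1653777848621159,
  3017503785822736, 3437590242077200, 299147211401337, 1557417775276058, 1583409104443495,
  1601582872680296, 3894991357422096, 2999977030918170, 1671951616857960, 3880685576331290,
  3422189495984154, 1618561264277607, 4035712487991824, 6043420183439888, 4680215529998166,
  6323864367999504, 1636183397652328, 4644962706868054, 4708145584883287, 4019168206856218,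
  246368797288824, 1548804458567783, 1513040265893991, 3158241195534864, 3578327651789328,
  1477823681550439, 4176449897703952, 5823125842585721, 4574662319359830, 6464601777711632,
  4609266870863702, 6745875427830288, 7485846484888080, 263961077704825, 1576704660494184,
  3140713512640538, 1531212366894952, 3562925977706522, 1407454937372775, 4457925141801488,
  1425079430043496, 4293187342649174, 4461857245185623, 4398160638330710, 7027350671927824,
  4345931782899287, 7658543360715280, 5805501475744120, 6448044488990746, 1495448174221160,
  4602594733540951, 4159900662046746, 4327791894153046, 7010032352960538, 4416300527076951,
  8186313235966480, 7468391279566874, 6728488673550362, 4627406759609943, 7645412634861594,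
  1442637547853927, 4563476984048144, 4503711992989526, 7132902514174480, 7764095202961936,
  5770315735263608, 9525645924313616, 4468527620900694, 8771942831240773, 8291865062484496,
  9464708877998183, 9482882221561704, 8796819281819205, 9841145631943184, 1460231338219368,
  4567377897539159, 4362970226444118, 4381079412885079, 8502975588936208, 8790116442191174,
  4486701231851095, 8726446259451461, 8824270022128966, 7115376089571354, 4521885603939927,
  8489765339078682, 8277559863353370, 7748694787170330, 211184420284792, 1372882593208423,
  1337118400534631, 2692296546343033, 3683880762157584, 1301901816191079, 4282003008072208,
  2656532353669241, 4187634221467478, 6534970515991056, 4222238772971350, 6851428538198544,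
  6492178380834664, 1266715682494567, 4152448087770966, 4116683895097174, 7238455624542736,
  7869648313330192, 2621315769325689, 6467334142510952, 4046315150919510, 6351473104734056,
  8397418172852752, 9429524500011111, 6421841848911720, 8620897416459845, 9911514370222608,
  4081467310753622, 8608508047600144, 9394313955465319, 8691233948382789, 10052234997475856,
  6386073629706088, 8655981125252677, 10126538886624855, 10161723258713687, 228776611244153,
  1400782705678184, 2674124541679992, 1355290412078952, 3668479015329818, 2638907957336440,
  6509802781100135, 1319526219405160, 4215566546191959, 4285935290369623, 6474038588426343,
  6834041711173658, 4240378572260951, 1196346938316903, 3870973111060310, 3835208918386518,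
  4873727665064057, 7924615170042505, 1213940890883944, 3898874985137751, 2304675797092746,
  2287471166704265, 4335788028476041, 4855556667033976, 3853382691538519, 4345712689297802,
  7940015914166666, 3799992334042966, 8374574599583301, 4837963472390265, 8304205855405637,
  8627142970649225, 3747245728155223, 6903860643904137, 5425021799512713, 8191398426850630,
  8338810406909509, 10245752935754377, 9131006336710504, 7529963796445833, 2603721823639928,
  6439432275314791, 6403668082640999, 9447696009221992, 9896112875053082, 1284309635061608,
  4180349961848407, 6333299338463335, 4064488924071511, 8648348318971206, 7220928875536410,
  4134857668249175, 8383112397660186, 7854247573135386, 3729623589865302, 8163468367050309,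
  4820354175551864, 5436403561544074, 8643674415245706, 3817614472332887, 6914215891974538,
  8332135915205958, 8402504659383622, 8127704174376517, 8145875073513593, 8128024184764792,
  8145773257700678, 10648042272664080, 6368451498297447, 10133793205794646, 9411931816548200,
  10098608833705814, 10035690722238490, 4099089449043543, 8682880392901958, 8719164008183110,
  8591963772362778, 7547139737794954, 9113103103047783, 10262860174403978, 8356879490233670,
  10654286297114745, 1231531216033895, 4011710505043798, 3975946312370006, 7308824290077200,
  8045570095131152, 3940729728026454, 8585680737744453, 7336053842528377, 8515311993566789,
  10157788035099152, 8549916545070661, 10368692941040144, 10538381172094824, 2568537382738296,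
  6298694718146663, 6262930525472871, 6281102598948712, 10063456605058902, 3905545355937622,
  8480127621477957, 4785169717938552, 5671302789216632, 8819596177385866, 8444363428804165,
  9306959287564409, 8092839710439800, 10597453897804152, 6227713941129319, 10028240020715350,
  6245338406274920, 9957871276537686, 10056172407371351, 8409179056715333, 9077918645434471,
  9940246945085015, 10859152702777872, 9992475828041558, 10907368571881575, 10010615689262679,
  10713939284797834, 1249123485636456, 4039610696156759, 7291296628809754, 3994118402557527,
  8030168442675226, 3764807600195414, 8269021121558085, 3782428055520855, 8057846170596933,
  8296949498393926, 8233256928884293, 10186568858155129, 8110586573501766, 10753595560962576,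
  4802745881413753, 8803050989890185, 3923169837794903, 5682694216497273, 8508060024845638,
  8198072556795461, 9042734273345639, 8216143983686982, 10827483814372405, 9922107083863894,
  9095853170243432, 8427318934648134, 10872698729538868, 10703007082687113, 7318429494364536,
  10141230768005146, 3958354209883735, 8543244396934470, 8613613141112134, 8092515146610245,
  10168702918080888, 8251328355775814, 10837510063531316, 8110089741547641, 9289024913160568,
  8462503306736966, 10802325691442484, 10865392579979112, 10520241427855463, 10351306208387098,
  8568056423003462, 10741564098945050, 10608386317166713, 52854745638793, 397505217143312,
  351955981796985, 370127988430456, 1171561403097616, 316739397453433, 1398057308717594,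
  334363795756664, 1717476122723687, 1381507994460688, 1724148354413928, 2824196099121680,
  1742288148792679, 281553263756921, 1573978162528794, 1653777848628584, 3017503785812506,
  3437590242066970, 299147211413112, 1557417775309328, 1583409104450920, 1601582872692071,
  3894991357411866, 2999977030951440, 1671951616869735, 3880685576364560, 3422189496017424,
  1618561264285032, 4035712487981594, 6025845110186512, 4680215530005591, 6307320086897168,
  1636183397664103, 4671861969613910, 4708145584895062, 4019168206889488, 246368797296249,
  1548804458575208, 1513040265901416, 3158241195524634, 3578327651779098, 1477823681557864,
  4176449897693722, 5823125842597496, 4574662319367255, 6464601777701402, 4609266870871127,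
  6745875427820058, 7485846484877850, 263961077716600, 1576704660505959, 3140713512673808,
  1531212366906727, 3562925977739792, 1407454937380200, 4433924831011927, 1425079430055271,
  4321119756842070, 4441379916980752, 4398160638338135, 7027350671917594, 4345931782911062,
  7658543360705050, 5805501475751545, 6448044489024016, 1495448174232935, 4602594733552726,
  4159900662080016, 4327791894160471, 7010032352993808, 4416300527088726, 8173246918926864,
  7468391279600144, 6728488673583632, 4627406759621718, 7645412634894864, 1442637547861352,
  4539476185670743, 4503711992996951, 7132902514164250, 7764095202951706, 5787909258253944,
  9509085867385360, 4468527620908119, 8771942831248198, 8291865062474266, 9464708878005608,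
  9482882221573479, 8796819281826630, 9825745216184848, 1460231338231143, 4546916927119888,
  4362970226451543, 4381079412896854, 8502975588925978, 8790116442202949, 4486701231862870,
  8752801783112517, 8824270022140741, 7115376089604624, 4521885603951702, 8489765339111952,
  8277559863386640, 7748694787203600, 88039117908090, 362320844828970, 985274679646311,
  616418593232745, 1136377030783274, 950058095302759, 2684489402691882, 580654400558953,
  1875184420139306, 1346323622146346, 3166707610306390, 2789011726807338, 2013860324192554,
  914871961606247, 3132101297194838, 3096337104521046, 5920420842713386, 6202926611575082,
  545437816215401, 1522233402994986, 3025968360343382, 2199717198382680, 4865916445667626,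
  2964792658637098, 2154521308442922, 3845501204050218, 3387005123703082, 3061120520177494,
  7283859064829509, 5990660737872170, 6589890280042794, 6272135714582826, 2234317723354712,
  5217631317537066, 4970245496254762, 3983983834575146, 70446935803514, 378882234782506,
  598246590543209, 1003446691202407, 1151778779566890, 563030006199657, 1362872932504362,
  967682498528615, 1890706964878122, 2701046766113578, 2031247153173290, 2806398555788074,
  3184847409607766, 123223572764522, 327136389972538, 960455087571514, 572396202443322,
  1101192575926842, 105632900609386, 343696269976634, 158437723293274, 141362447213658,
  291922239443786, 589858025579578, 977981335217210, 299655961654602, 1116592814761018,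
  2533354938845014, 2649304947835450, 756576343770713, 1839999965282874, 1311139167289914,
  246400167404634, 924725540967242, 536602231329610, 1548835828683593, 3247439273345594,
  2753827271950906, 1978675869336122, 1056185899963210, 527843872503145, 1538793786315562,
  2171983634895658, 2982319409599274, 3402405865853738, 932465914185063, 3160003171284054,
  2181543434085464, 3044142133507158, 3859806981198634, 5937883924140842, 3114510877684822,
  4880222474474282, 6218328108700458, 263962402178650, 1576705984968009, 738975605285977,
  545913850705226, 1327662053532730, 2550977077146710, 933010646381898, 1855496337564730,
  2665836390458426, 3140712188166713, 1531213691368777, 1513508263056201, 3158486319178809,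
  3562924653232697, 2216695593919576, 4000528111768362, 6008235807216426, 4985758981296938,
  6288679991776042, 3078742658479190, 5232118288618282, 6605408043275050, 7311789124641605,
  1073224433939786, 1995641674081338, 2770797103227962, 3264477807322170, 3582236667749433,
  879687495145575, 2991363714467670, 2955599521793878, 5929258779690857, 7248706810623557,
  2920382937450326, 7213490226280005, 5893494587017065, 7143121482102341, 9438729202577706,
  7177726033606213, 9720333028307242, 9613684695380266, 510251682518889, 1662969884717354,
  3105529140359466, 2164531064686168, 3527741605425450, 2850014193272662, 7002383993747013,
  2058398127834712, 5411835291776327, 4406195544666410, 6966619801073221, 8884746822629225,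
  5436647317845319, 9017676127023402, 6096200767910186, 6412860116709674, 2128766872012376,
  5075789552824618, 4124716289765674, 6896251056895557, 6974847980679466, 5507016062022983,
  8138062546612522, 7433206907285802, 6693304301269290, 5320018573144362, 7610228262580522,
  211184506926442, 1372882679850073, 1337118487176281, 2692296635282518, 3683880859341609,
  2498170204997462, 5815896925880890, 879717355054170, 2508020775015242, 2991393574376265,
  6087010231465541, 5885234877907514, 2604296761922378, 6167740646769210, 721359256110681,
  1487046683214394, 492684983886938, 712514025444170, 1679505791198265, 4760361485025850,
  2365693895983674, 1795051925689162, 4830730229203514, 2929605938856506, 2119334588662330,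
  1267217641657162, 3810314735927866, 3351818403922490, 1301901902832729, 4258003052286792,
  2656532442608726, 4187634308109128, 6537735187882821, 5805530960836165, 2956044114481993,
  5929159797924677, 6448020011958841, 1495436915782985, 2146734853739337, 3122640840893497,
  4602583475102776, 4159867628634681, 4222238859613000, 6851428635382569, 6492178469774149,
  7255722703274552, 3536474093200441, 2885196803753814, 7107935348405829, 7072171155732037,
  10474245050738960, 10485669142340916, 5858278002673513, 9473901495071018, 7036986783643205,
  8937179521300583, 10178756631081258, 9746183855028054, 9658804082259544, 9932397575418154,
  9790560843870506, 2093550036010584, 4511732554805546, 6931429389186629, 5471794947831111,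
  9299143050670378, 8848962497296233, 5542232394708295, 9158337111273770, 9086869123903786,
  7080191717290282, 5577416766797127, 8454580966797610, 8242375491072298, 7713510414889258,
  1020426657686618, 3413577853719369, 6051815793047109, 3202402901709642, 7328796739977786,
  5955438534279738, 2709753241424714, 6554672102982202, 6236913510990394, 2435833127846458,
  1935628352770890, 5182412888818234, 4935023041004090, 3948761127666234, 3377813661045577,
  6210735186273093, 7467927910564409, 6727956853506617, 4627189896389688, 7882027182408248,
  211184420292217, 1372882593215848, 1337118400542056, 2692296546358648, 3683880762147354,
  1301901816198504, 4258002965652567, 2656532353684856, 4187634221474903, 6537735098958951,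
  4222238772978775, 6851428538188314, 6492178380850279, 1266715682501992, 4152448087778391,
  4116683895104599, 7238455624532506, 7869648313319962, 2621315769341304, 6467334142526567,
  4046315150926935, 6351473104749671, 8397418172842522, 9429524500018536, 6421841848927335,
  8620897416467270, 9911514370212378, 4081467310761047, 8608508047589914, 9394313955472744,
  8691233948390214, 10052234997465626, 6386073629721703, 8655981125260102, 10126538886640470,
  10161723258729302, 228776611255928, 1400782705689959, 2674124541691257, 1355290412090727,
  3668479015363088, 2638907957347705, 6518413154558480, 1319526219416935, 4215566546203734,
  4265453699703312, 6474038588437608, 6834041711206928, 4240378572272726, 1196346938324328,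
  3870973111067735, 3835208918393943, 4873727665083512, 7924615170069130, 1213940890895719,
  3898874985149526, 2304675797116041, 2287471166723210, 4335788028498826, 4855556667049081,
  3853382691550294, 4345712689324937, 7940015914197641, 3799992334050391, 8374574599590726,
  4837963472409720, 8304205855413062, 8627142970675850, 3747245728166998, 6903860643926922,
  5425021799535498, 8191398426862405, 8338810406916934, 10245752935781002, 9131006336729959,
  7529963796468618, 2603721823651193, 6439432275326056, 6403668082652264, 9447696009233767,
  9896112875086352, 1284309635073383, 4180349961860182, 6333299338474600, 4064488924083286,
  8648348318982981, 7220928875569680, 4134857668260950, 8383112397693456, 7854247573168656,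
  3729623589872727, 8163468367057734, 4820354175566969, 5436403561571209, 8643674415276681,
  3817614472344662, 6914215892001673, 8332135915217733, 8402504659395397, 8127704174383942,
  8145875073536888, 8128024184783737, 8145773257712453, 10632638388863609, 6368451498308712,
  10133793205805911, 9411931816559975, 10098608833717079, 10035690722271760, 4099089449055318,
  8682880392913733, 8719164008194885, 8591963772396048, 7547139737822089, 9113103103062888,
  10262860174434953, 8356879490245445, 10636152917959184, 228776609404778, 1400782703838809,
  2674124545083222, 1355290410239577, 3668479006355753, 2638907960739670, 6509802784503365,
  1319526217565785, 4215566544352584, 4285935288530248, 6474038591829573, 6834041702199593,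
  4240378570421576, 492659463058793, 1679531128197930, 2146359024641112, 3123056751481642,
  3543143207736106, 510252910462554, 1662968472945209, 703791179129945, 721835598099786,
  1503583784215610, 3105527728587321, 2164532292629833, 1478323820188489, 3527740193653305,
  2111142440297560, 4141265453650730, 6113788777009962, 5091311951090474, 6429417333658410,
  1284330553423178, 2136379032675386, 2946718833910842, 4180370880209977, 5337405255652138,
  6710690983777066, 7450662040834858, 3360552086217786, 897279764759911, 3019263905592406,
  5911086856631401, 2973771611993174, 7276156030182213, 897281271809626, 3019265412642121,
  2515790660334678, 2516307562411338, 5832430050485306, 5911088371021381, 2973773119042889,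
  5823602387739461, 7276157537231928, 2040773696119896, 4422740698731306, 2867638675141718,
  5383902938551111, 7030316397126469, 1812096403125578, 2382669905667130, 4777405962462266,
  4582080039699000, 5488876234232647, 6992166228857642, 6914390934840133, 3817949191742522,
  7623358917645098, 5875870272287849, 9455278433309482, 2938007419319382, 7171053885481797,
  7241422629659461, 2621341256070474, 5902210921014330, 6105081658368837, 6467359629255737,
  5418507490054983, 8866812481663849, 6984759679017797, 4838300277220410, 8151128793879338,
  9631071444734762, 9737719777661738, 7195865911550789, 6175375136007226, 9030806815511338,
  2603721827043158, 6439432278718021, 6403668086044229, 9447696007444057, 9896112866079017,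
  1284309633222233, 4180349960009032, 6333299341866565, 4064488922232136, 8648348317131831,
  7220928866562345, 4134857666409800, 8383112388686121, 7854247564161321, 1266716973360217,
  4152449378636616, 6096175196947001, 2920858916639561, 6412834545746489, 2128756020360521,
  2111549907555145, 5075759955329593, 4124682665738809, 4116685185962824, 7238457101914921,
  7220537505432120, 4134608808977465, 7869649790702377, 2621315339220054, 6467333712405317,
  5875893932602949, 5893938416345925, 9455252015239732, 2938000873305417, 6113317421982777,
  7171047339467832, 7241416083645496, 4046316441785160, 6351472674628421, 7150168761254456,
  5084591150277689, 8397419666936617, 9429525658231641, 6421841418806085, 9429991986439476,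
  6421666009064505, 8620898707325495, 9911515897729833, 6368451501700677, 10133793209197876,
  9411931814770265, 10098608837109044, 10035690713264425, 4099089447204168, 8682880391062583,
  8719164006343735, 8591963763388713, 3342620410139465, 7432730364756537, 6692763334230585,
  5319473579573817, 7846833931502136, 6174958394958661, 9630650426544692, 9737302786003508,
  7195726489986104, 7776465187324472, 9915423651877428, 1231531216041320, 4011710505051223,
  3975946312377431, 7308824290066970, 8045570095120922, 3940729728033879, 8585680737751878,
  7336053842547832, 8515311993574214, 10157788035088922, 8549916545078086, 10368692941029914,
  10538381172114279, 2586129635644792, 6326594892563559, 6262930525484136, 6281102598964327,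
  10090905807909718, 3905545355945047, 8480127621485382, 4785169717953657, 5671302789235577,
  8819596177416841, 8444363428811590, 9306959287587704, 8092839710458745, 10597453897826937,
  6227713941140584, 10028240020726615, 6245338406290535, 9985803663209302, 10056172407386966,
  8409179056722758, 9077918645449576, 9940246945100630, 10842561775759976, 9992475828052823,
  10925439982077031, 10010615689278294, 10713939284828809, 1249123485648231, 4039610696168534,
  7291296628843024, 3994118402569302, 8030168442708496, 3764807600202839, 8269021121565510,
  3782428055532630, 8084743755293509, 8296949498405701, 8233256928891718, 10186568858178424,
  8110586573513541, 10753595560952346, 4802745881433208, 8803050989916810, 3923169837806678,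
  5682694216520568, 8508060024857413, 8198072556802886, 9060668798174055, 8216143983698757,
  10827483814384180, 9922107083875159, 9095853170262887, 8427318934659909, 10897921276990004,
  10703007082713738, 7318429494379641, 10141230768038416, 3958354209895510, 8543244396946245,
  8613613141123909, 8092515146617670, 10168702918099833, 8251328355787589, 10862668186473012,
  8110089741570936, 9289024913179513, 8462503306748741, 10802325691449909, 10846086438822416,
  10520241427870568, 10351306208420368, 8568056423015237, 10741564098978320, 10608386317193848,
  1038017217775194, 3441476335318345, 6192561853511237, 3395984041719113, 7909474692441144,
  2075957203133528, 4528291470447402, 1952832081704266, 2453036572681274, 4617263011938872,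
  5559244113335111, 7097717000573738, 3958684602934330, 7728909689361194, 5840685311358057,
  9490460457898794, 2726892561577290, 5972577586062394, 6748832795206713, 5524059741246279,
  8831627504022377, 4943851315340346, 8256679564612394, 9640631570359128, 9764357045252950,
  6245741801055290, 9101173213172522, 9805960165528362, 2902790315930710, 7135836782093125,
  3219478065722698, 6069860276790085, 7487708903973945, 5453686703149895, 6949538281710405,
  5190146214863930, 8467790092047146, 8954515477005159, 7055160116405061, 6562405444756538,
  9171546252251946, 9946701948785450, 10456719183548944, 7090344488493893, 7336530350122042,
  9312352460018474, 10193061272818474, 10513119604462132, 6157345269167685, 9887502604576052,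
  3360219849045321, 7804372547740728, 7874741291918392, 4081487601816392, 7185335627366968,
  5330887998186553, 8608531875369769, 9394332375868249, 9711443590391092, 6703147228079161,
  8691254239445559, 10052259360019241, 6386064627491653, 9605821755696436, 7442087761355833,
  8656001148928567, 10126529884410420, 10161714256499252, 9851738411902260, 10386490431975720,
  7829184573809720, 7811438779908664, 10404240519795496, 9869661061599796, 176000047950200,
  1161776360429671, 1126012167755879, 1144184174377065, 3719065133816336, 1090795583412327,
  3659868639889238, 1108419981703273, 3589499895711574, 3687800959690584, 3624104447215446,
  6886612909857296, 3642244241581912, 1055609449715815, 3554313762015062, 3518549569341270,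
  7273639996201488, 7904832684988944, 1073203397359721, 3582215631169368, 3448180825163606,
  3466354593392472, 7944660872025671, 7256113241262617, 3536723337570136, 7917209974437445,
  7889431938861593, 3483332984997718, 8022730878449221, 9359129583130727, 7987546506360389,
  10087419369134608, 3500955118364504, 7952293683230277, 8015476561237575, 8050660933326407,
  1020424983255143, 3413576179287894, 3377811986614102, 6210733756151913, 7882025507976773,
  3342595402270550, 7846808923633221, 6174969563478121, 7776440179455557, 9915434820396888,
  7811044730959429, 10403877312698896, 9869878102288216, 1038017263663209, 3441476381206360,
  6192561780988007, 3395984087607128, 7909474738329159, 3272226658092886, 7635702691100229,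
  3289851150755672, 5636118416697720, 7663635105273415, 7599938498426437, 9025484310673513,
  7547709642987079, 10582361449317686, 6157345196644455, 9887502532052822, 3360219894933336,
  7804372593628743, 7874741337806407, 7529569754248773, 9007549900888167, 7618078387164743,
  10626408392058164, 9851738339379030, 10386490558384665, 7829184619697735, 10556039647880500,
  3307409268574038, 7741254045759045, 7705489853085253, 10509429422332432, 10788778390231568,
  6122159456163943, 9817132419483478, 7670305480996421, 8972363893020775, 10731959746716980,
  9781368226809686, 9799541570365272, 10696775374628148, 10965872726415888, 3325003058931544,
  7769155757626951, 7564748086539845, 7582857272972871, 10617504801113398, 8989699985340521,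
  7688479091938887, 10661586724349236, 10724226114929974, 10491902997695001, 7723663464027719,
  10591149277472052, 10759410487018806, 10794594859107638, 176000048065145, 1161776360544616,
  1126012167870824, 1144184174630760, 3695085224347735, 1090795583527272, 3659868640004183,
  1108419981956968, 3589499895826519, 3687800959944279, 3624104447330391, 6869226077364250,
  3642244241835607, 1055609449830760, 3554313762130007, 3518549569456215, 7273639996041498,
  7904832684828954, 1073203397613416, 3582215631423063, 3448180825278551, 3466354593646167,
  7944660872279366, 7256113241727002, 3536723337823831, 7917209974552390, 7889431939325978,
  3483332985112663, 8022730878564166, 9359129583245672, 7987546506475334, 10070875088429082,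
  3500955118618199, 7952293683345222, 8015476561491270, 8050660933580102, 475067213773162,
  1733338541005353, 3175897796647465, 2023793479673945, 3633294633802281, 3237042286004054,
  6483228772997673, 1988029287000153, 5146158209112617, 4230269318142505, 7494385382159941,
  6798857329646121, 5366278477010760, 457475090766441, 1749899871861034, 2005621536082264,
  3193425495144746, 3648696323488042, 686174770587994, 1627784100457017, 668606806772313,
  818067087374921, 1644321272121658, 3070343356099129, 2224887633816121, 1443139447765577,
  3492555821165113, 1970404951738712, 4246818569402666, 3254666778920535, 5161680694753578,
  6499786077321514, 1460252413483338, 2241932148492602, 3087456321816890, 4546895667276088,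
  5348138745673799, 6816244099529002, 7512525271151942, 3501289574123834, 3201856152307542,
  7459779069048389, 7424014876374597, 9623617867573337, 9860928493525545, 1952812702656601,
  4617285331524137, 7353646132196933, 5260757572998984, 9122052653128233, 7185744494008873,
  5331126317176648, 8347928016132649, 7819063191607849, 1231532601002585, 4011711890012488,
  6060990824458809, 2885674544216649, 6377650173258297, 2445415368841289, 2076365535132233,
  5040575582841401, 4089498293250617, 3975947697338696, 7308825845643305, 7114984388831544,
  4521636901570617, 8045571650697257, 7388798292031045, 10529431563213353, 9587853674899545,
  10212707789904425, 10000506340710953, 5295358097971016, 9333030036642345, 9226381703715369,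
  8556779390835241, 3307436037716553, 7397545992268345, 6657578961742393, 5284289207085625,
  7741280814901560, 1020424983370088, 3413576179402839, 3377811986729047, 6210733756467048,
  7882025508091718, 3342595402385495, 7846808923748166, 6174969563793256, 7776440179570502,
  9915434820712023, 7811044731074374, 10403877312538906, 9869878102603351, 1038017263916904,
  3441476381460055, 6192561781164392, 3395984087860823, 7909474738582854, 3272226658207831,
  7635702691215174, 3289851151009367, 5636118416996985, 7663635105527110, 7599938498541382,
  9025484311050088, 7547709643240774, 10582361449571381, 6157345196820840, 9887502532229207,
  3360219895187031, 7804372593882438, 7874741338060102, 7529569754363718, 9007549901125992,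
  7618078387418438, 10626408392173109, 9851738339555415, 10386490558849050, 7829184619951430,
  10556039647995445, 1249123449989466, 4039610660509769, 7291296479910184, 3994118366910537,
  8030168293775656, 1935219714574680, 4633844586199338, 2093569569675594, 2428208660429128,
  4511709895338296, 5312953508509767, 7203270116325674, 4099422090840378, 7834462805113130,
  3219449942918743, 7487680781169990, 2902814421637450, 6078130701879610, 7135860887799865,
  5242584764332103, 7371819743393094, 5049404431157562, 8362232680364330, 9605447198062936,
  7442188487570758, 6386479288961338, 9136357584746794, 9876328909191466, 7318429547853381,
  10141230619105576, 3958354174236745, 8543244361287480, 8613613105465144, 3940750113192264,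
  7079782510766392, 5565759294286136, 8585701122910263, 7336047245997382, 10457065333135399,
  7090175320672313, 8515332378732599, 10157812475836457, 10520241481344308, 10351306059487528,
  8568056387356472, 7705885663308088, 10509793635677992, 3307409268688983, 7741254045873990,
  7705489853200198, 10509429422172442, 10767144118920757, 6122159456340328, 9817132419659863,
  7670305481111366, 8972363893258600, 10731959746831925, 9781368226986071, 9799541570680407,
  10696775374743093, 10943066399909702, 3325003059185239, 7769155757880646, 7564748086654790,
  7582857273226566, 10617504801367093, 8989699985717096, 7688479092192582, 10661586724464181,
  10724226115183669, 10491902998159386, 7723663464281414, 10591149277586997, 10759410487272501,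
  10794594859361333, 3325002208467274, 7769154907162681, 5277751017027655, 5295666079353146,
  8573305678281002, 9570249110600024, 6667925293517114, 9241877450668330, 10017033131473194,
  7406415990175046, 7406865825810746, 9347499285362986, 10228208082434346, 10545966941813034,
  10491900906903591, 7723662613563449, 8550236655200311, 10369083009742889, 10538237421823029,
  10773375883614247, 193592234190456, 1189676468180327, 1126012167943529, 1144184174581095,
  3703663381615120, 1090795583599977, 3659868640076888, 1108419981907303, 3617432215716950,
  3687800959894614, 3624104447403096, 6869226077458960, 3642244241785942, 1055609449903465,
  3554313762202712, 3518549569528920, 7273639996686873, 7904832685474329, 1073203397563751,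
  3582215631373398, 3448180825351256, 3466354593596502, 7944660872229701, 7256113241821712,
  3536723337774166, 7917209974625095, 7889431939420688, 3483332985185368, 8022730878636871,
  9376747438511463, 7987546506548039, 10070875088523792, 3500955118568534, 7979192946160453,
  8015476561441605, 8050660933530437, 844503121766503, 2815441852733270, 2779677660059478,
  2797849666676569, 6861678716356165, 2744461075715926, 6826462132012613, 2762085474002777,
  6756093387834949, 6854394451809864, 6790697939338821, 10439061686880528, 6808837733701192,
  862095386649959, 2843342039127126, 2779677738886233, 2797849745527894, 6889127931183941,
  2462985830573910, 6017221305538117, 2480606281180246, 5735677609354821, 6045149677654853,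
  5981457112864325, 5999629119477321, 5788418007540549, 9384920255668788, 2744461154542681,
  6826462210839368, 2762085552854102, 6784025786483525, 6854394530661189, 5770346585368133,
  5981900110189385, 5999528535036741, 9500503920776500, 6790698018165576, 10421674964517392,
  6808837812552517, 9359697712948532, 2709274942019414, 6720907254138437, 6685143061464645,
  9729170984888153, 10380116024784180, 2726868889659225, 6748809123288648, 6614774317286981,
  6632948085511752, 10266829434012983, 9710999481587542, 6703316829689416, 10239378536428852,
  10407566922368311, 2586130960065622, 6326596216984389, 5946262674445893, 5858754036147013,
  9420067633996340, 5963856873739849, 5841162353398602, 9560873825051188, 9403506995053114,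
  6262932168397641, 6281103923385157, 9465176355149108, 9482706381587769, 10090907132330548,
  6649926477121093, 10344899440440628, 9675788937041750, 10309715068351796, 10933017107538211,
  6667548610483784, 10274462245221684, 10337645123224887, 10372829495313719, 6139774014759749,
  9595466045301300, 9702118404760116, 9577886693802554, 9845054899589684, 475067214092137,
  1733338541404458, 3175897797046570, 2023793479992920, 3633294634201386, 3237042286118999,
  6483228773396778, 1988029287319128, 5146158209511722, 4230269318541610, 7494385382274886,
  6798857330045226, 5366278477329735, 457475090904426, 1749899872441129, 2005621536220249,
  3193425495724841, 3648696324068137, 686174770972249, 1627784100790842, 668606806975578,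
  827388714431817, 1644321272636473, 3070343356432954, 2224887634149946, 1443139448034122,
  3492555821498938, 1970404951876697, 4246818569982761, 3254666778870870, 5161680695333673,
  6499786077901609, 1460252413932873, 2241932149007417, 3087456322331705, 4567398973252664,
  5348138745811784, 6816244100109097, 7512525271102277, 3501289574638649, 1776889032370266,
  4687652945336616, 6579589945198149, 4979280786446153, 7994983921686824, 1900035342485848,
  4652469972381994, 2339860175345738, 2393024288340296, 4476525523249464, 5207400392243271,
  5225573201229127, 4380897068599354, 7959800948732202, 1759298450908250, 4704215943942952,
  4732406066272074, 4715330880885578, 8767893350324263, 2410230997136712, 2322656408392522,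
  5604625316528698, 4370973538665018, 4961110384399177, 6597763288957765, 8789867740271399,
  4486452529931320, 8010387279123240, 6544373360854597, 10106046247016744, 4943516593772361,
  9211747432023608, 8697511722293544, 3905565741103432, 7044598138677560, 5530574922197304,
  8480148006643767, 4785184228987722, 8946762439344698, 8840114106417722, 5671321863668282,
  8819636427035431, 10203582131500340, 10316121687398696, 9236559458092600, 7670701291219256,
  8972669682074170, 3201856152422487, 7459779069163334, 7424014876489542, 9623617867953752,
  9860928493924650, 1952812702975576, 4617285331923242, 7353646132311878, 5260757573317959,
  9122052653527338, 7185744494407978, 5331126317495623, 8347928016531754, 7819063192006954,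
  1231532601205850, 4011711890215753, 6060990824792634, 2885674544485194, 6377650173592122,
  2445415369225544, 2076365535400778, 5040575583175226, 4089498293584442, 3975947697541961,
  7308825846158120, 7114984389100089, 4521636902020152, 8045571651212072, 3782399046670410,
  8296920489543481, 5172197900761159, 5471587940845626, 8678858795595818, 5189804982023495,
  6949400271276090, 9261570371105066, 8662336802402602, 3764837170041674, 8067152868753978,
  6939058233688634, 5460215362765370, 8269050691404345, 10168397759411508, 8251428195944249,
  8444683538933815, 9306857534858294, 8093060111483450, 10738191511525415, 7388798292145990,
  10529431563612458, 9587853675279960, 10212707790303530, 10000506341110058, 5295358098289991,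
  9333030037041450, 9226381704114474, 8556779391234346, 3307436037985098, 7397545992602170,
  6657578962076218, 5284289207419450, 7741280815170105, 7582324117096506, 9324209339901750,
  10281083669590314, 9342041906947126, 7565290235249210, 10600968538763562, 1020424983442793,
  3413576179475544, 3377811986801752, 6210733756421223, 7882025508164423, 3342595402458200,
  7846808923820871, 6174969563747431, 7776440179643207, 9915434820666198, 7811044731147079,
  10403877313184281, 9869878102557526, 1038017263867239, 3441476381410390, 6192561781240937,
  3395984087811158, 7909474738533189, 3272226658280536, 7635702691287879, 3289851150959702,
  5647509712642936, 7663635105477445, 7599938498614087, 9025484311008103, 7547709643191109,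
  10582361449521716, 6157345196897385, 9887502532305752, 3360219895137366, 7804372593832773,
  7874741338010437, 7529569754436423, 9007549901206377, 7618078387368773, 10652730193699380,
  9851738339631960, 10386490558943760, 7829184619901765, 10556039648068150, 2568537436890966,
  6298694772299333, 6262930579625541, 6281102570509897, 10063456659211572, 2709276169036889,
  6720908481155912, 5858301695972938, 5946714857296713, 9473874859475513, 6685144288482120,
  9729172558025558, 9412335308522810, 10380117251801655, 2726868465194070, 6748808698823493,
  5840709541406277, 5964307169186629, 9490436394947124, 6614775544304456, 6632947661046597,
  9535613785253172, 10266829009547828, 9711000582841177, 6703316405224261, 9394807594198324,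
  10239379763446327, 10407566497903156, 6227713995281989, 10028240074868020, 6245338377836105,
  9957871330690356, 10056172378932536, 6227738862441289, 9746627927643444, 9648250531693113,
  10028264942027320, 6245327147799365, 9641006108677428, 9772487165710900, 9985792404718132,
  10056161148895796, 9992475882194228, 10907368627017285, 10010615660823864, 9781836899500601,
  9799292325040692, 1249123450373721, 4039610660894024, 7291296480244009, 3994118367294792,
  8030168294109481, 1935219714712665, 4633844586779433, 2093569570125129, 2428208660632393,
  4511709895606841, 5312953508647752, 7203270116905769, 4099422091355193, 7834462805693225,
  3219449942869078, 7487680781120325, 2902814422086985, 6078130702394425, 7135860888249400,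
  5242584764470088, 7371819743343429, 5049404431672377, 8362232680944425, 9605447198204761,
  7442188487521093, 6386479289476153, 9136357585326889, 9876328909771561, 4802745854023498,
  8803051046639655, 3923169802532168, 5682694190155578, 8508059989582903, 4925916826784585,
  8849425100326458, 5541994230785080, 8714084991701800, 6561986765030213, 8955046935021114,
  7054990949033016, 9183839743525432, 10122628104262440, 9922107138016564, 9095853142853177,
  8409499166844983, 9078149189354041, 9940030081827380, 10703007139436583, 7318429547968326,
  10141230619439401, 3958354174621000, 8543244361671735, 8613613105849399, 3940750113395529,
  7079782511034937, 5577178602873912, 8585701123113528, 7336047245947717, 10478796857152295,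
  7090175321121848, 8515332378935864, 10157812476351272, 8110089715205946, 9289024967812918,
  8462503271474231, 8233719964320313, 10186324981412404, 10846086292189481, 10520241481459253,
  10351306059821353, 8568056387740727, 7705885663576633, 10509793636127527, 10608386291873578,
  3307409268761688, 7741254045946695, 7705489853272903, 10509429422817817, 10767144118993462,
  6139752979403879, 9845033864233814, 7670305481184071, 8972363893338985, 10731959746904630,
  9781368227062616, 9799541570634582, 10696775374815798, 10950472311149072, 3325003059135574,
  7769155757830981, 7564748086727495, 7582857273176901, 10617504801317428, 8989699985675111,
  7688479092142917, 10687942248194612, 10724226115134004, 10491902998254096, 7723663464231749,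
  10591149277659702, 10759410487222836, 10773377974964752, 6122160610584133, 9817133573903668,
  6649945823531848, 9588228479927610, 10344918786851383, 9693400312288086, 9676258915034420,
  10309734414762551, 10916434998830115, 6667539881296709, 9570637096068404, 10301352527098420,
  10337636394037812, 10372820766126644, 9781369381229876, 9799540853065017, 9992868925358648,
  10925265634366021, 10010398826005044, 10943067554153507, 3325002208916809, 7769154907612216,
  5277751017165640, 5295666079867961, 8573305678861097, 9570249110741849, 6667925294031929,
  9241877451248425, 10017033132053289, 7406415990125381, 7406865826325561, 9347499285943081,
  10228208083014441, 10545966942393129, 8989699285861946, 7688478241924152, 9218808444502584,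
  10333898638168872, 10221509353501236, 10724225264915239, 10491900907172136, 7723662614012984,
  8550236655403576, 10369083010257704, 10538237421773364, 10759409637004071, 10794594009092903]

theorem a11 : certsOK 11 certs11 = true := by decide +kernel

theorem b11 : hintsOK 11 certs11 (codes 11) hints11 = true := by decide +kernel

end LTree


/-- Every ordered tree on `n ≤ 9` or `n = 11` vertices admits an L-shaped embedding
(respecting the cyclic neighbor orders) in every point set of `n` points. -/
theorem small_ordered_trees_embed (n : ℕ) (hn : n ≤ 9 ∨ n = 11)
    (G : SimpleGraph (Fin n)) (ord : Fin n → List (Fin n))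
    (hG : IsOrderedTree G ord)
    (S : Finset (ℝ × ℝ)) (hS : IsPointSet S) (hcard : S.card = n) :
    ∃ φ c, IsLEmbedding G S φ c ∧ RespectsOrder φ c ord := by
  have hcases : n = 0 ∨ n = 1 ∨ n = 2 ∨ n = 3 ∨ n = 4 ∨ n = 5 ∨ n = 6 ∨ n = 7 ∨ n = 8 ∨ n = 9 ∨
      n = 11 := by omega
  rcases hcases with rfl | rfl | rfl | rfl | rfl | rfl | rfl | rfl | rfl | rfl | rfl
  · exact (hG.1.connected.nonempty.some).elim0
  · exact LTree.good_one G ord hG S hS hcard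
  · exact LTree.main (by omega) (by omega) LTree.a2 LTree.b2 G ord hG S hS hcard
  · exact LTree.main (by omega) (by omega) LTree.a3 LTree.b3 G ord hG S hS hcard
  · exact LTree.main (by omega) (by omega) LTree.a4 LTree.b4 G ord hG S hS hcard
  · exact LTree.main (by omega) (by omega) LTree.a5 LTree.b5 G ord hG S hS hcard
  · exact LTree.main (by omega) (by omega) LTree.a6 LTree.b6 G ord hG S hS hcard
  · exact LTree.main (by omega) (by omega) LTree.a7 LTree.b7 G ord hG S hS hcard
  · exact LTree.main (by omega) (by omega) LTree.a8 LTree.b8 G ord hG S hS hcard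
  · exact LTree.main (by omega) (by omega) LTree.a9 LTree.b9 G ord hG S hS hcard
  · exact LTree.main (by omega) (by omega) LTree.a11 LTree.b11 G ord hG S hS hcard
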